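/- arXiv:0811.2854 — 2 statements merged into one kernel-verified Lean document; each statement's English description precedes it below -/
import Mathlib

section
/- (Diestel) Let a, b ∈ (0, 1) with a ≠ b, and let p, q, r ∈ (1, ∞) with 1/r = 1/p + 1/q. Then there exists a constant c = c(p, q, a, b) such that for all Schwartz functions f, g on ℝ, ‖ ( Σ_{n∈ℤ} [ ∫_{ℝ²} e^{2πi x(ξ₁+ξ₂)} f̂(ξ₁) ĝ(ξ₂) 1_{[a^n, a^{n−1}]}(ξ₁) 1_{[−b^n, b^n]}(ξ₂) dξ₁ dξ₂ ]² )^{1/2} ‖_{L^r(ℝ)} ≤ c ‖f‖_{L^p(ℝ)} ‖g‖_{L^q(ℝ)}. -/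
open MeasureTheory Real Set
open scoped ENNReal

/-- The Fourier transform `f̂(ξ) = ∫ f(t) e^{-2πitξ} dt`. -/
noncomputable def FT (f : ℝ → ℂ) (ξ : ℝ) : ℂ :=
  ∫ t : ℝ, Complex.exp (((-2 * Real.pi * t * ξ : ℝ) : ℂ) * Complex.I) * f t

namespace SquareFunction

open scoped SchwartzMap FourierTransform Topology

/-- The uncentered Hardy–Littlewood maximal function on the line. -/
noncomputable def maximal (g : ℝ → ℝ≥0∞) (x : ℝ) : ℝ≥0∞ :=
  ⨆ (I : ℝ × ℝ) (_ : I.1 < x ∧ x < I.2), (∫⁻ y in Ioo I.1 I.2, g y) / ENNReal.ofReal (I.2 - I.1)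

theorem lt_maximal_iff {g : ℝ → ℝ≥0∞} {x : ℝ} {l : ℝ≥0∞} :
    l < maximal g x ↔ ∃ s t, s < x ∧ x < t ∧
      l < (∫⁻ y in Ioo s t, g y) / ENNReal.ofReal (t - s) := by
  simp [maximal, lt_iSup_iff, and_assoc]

theorem isOpen_lt_maximal (g : ℝ → ℝ≥0∞) (l : ℝ≥0∞) : IsOpen {x | l < maximal g x} := by
  rw [isOpen_iff_mem_nhds]
  intro x hx
  obtain ⟨s, t, hs, ht, h⟩ := lt_maximal_iff.1 hx
  filter_upwards [Ioo_mem_nhds hs ht] with y hy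
  exact lt_maximal_iff.2 ⟨s, t, hy.1, hy.2, h⟩

theorem measurable_maximal (g : ℝ → ℝ≥0∞) : Measurable (maximal g) :=
  measurable_of_Ioi fun l => (isOpen_lt_maximal g l).measurableSet

theorem div_le_maximal {g : ℝ → ℝ≥0∞} {x s t : ℝ} (hs : s < x) (ht : x < t) :
    (∫⁻ y in Ioo s t, g y) / ENNReal.ofReal (t - s) ≤ maximal g x :=
  le_iSup₂_of_le (s, t) ⟨hs, ht⟩ le_rfl

theorem setLIntegral_le_maximal {g : ℝ → ℝ≥0∞} {x s t : ℝ} (hs : s < x) (ht : x < t) :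
    ∫⁻ y in Ioo s t, g y ≤ maximal g x * ENNReal.ofReal (t - s) := by
  have h := div_le_maximal (g := g) hs ht
  rwa [ENNReal.div_le_iff (by simp; linarith) (by simp)] at h

theorem setLIntegral_le_of_left_endpoint {g : ℝ → ℝ≥0∞} {s t l : ℝ} (hst : s < t) (hl : 0 ≤ l)
    (h : maximal g s ≤ ENNReal.ofReal l) :
    ∫⁻ y in Ioo s t, g y ≤ ENNReal.ofReal (l * (t - s)) := by
  have hlim : Filter.Tendsto (fun s' => ENNReal.ofReal (l * (t - s'))) (nhdsWithin s (Iio s))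
      (nhds (ENNReal.ofReal (l * (t - s)))) := by
    refine (Continuous.tendsto ?_ s).mono_left nhdsWithin_le_nhds
    exact ENNReal.continuous_ofReal.comp (by fun_prop)
  refine ge_of_tendsto hlim ?_
  filter_upwards [self_mem_nhdsWithin] with s' hs'
  calc ∫⁻ y in Ioo s t, g y ≤ ∫⁻ y in Ioo s' t, g y :=
        lintegral_mono_set (Ioo_subset_Ioo_left (le_of_lt hs'))
    _ ≤ maximal g s * ENNReal.ofReal (t - s') := setLIntegral_le_maximal hs' hst
    _ ≤ ENNReal.ofReal l * ENNReal.ofReal (t - s') := by gcongr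
    _ = _ := (ENNReal.ofReal_mul hl).symm

/-- The weak type `(1,1)` bound. -/
theorem maximal_weak_type (g : ℝ → ℝ≥0∞) (hg : ∫⁻ y, g y ≠ ∞) {l : ℝ} (hl : 0 < l) :
    ENNReal.ofReal l * volume {x | ENNReal.ofReal l < maximal g x} ≤ 5 * ∫⁻ y, g y := by
  set T : Set (ℝ × ℝ) := {I | I.1 < I.2 ∧
    ENNReal.ofReal l * ENNReal.ofReal (I.2 - I.1) < ∫⁻ y in Ioo I.1 I.2, g y} with hT
  have hrad : ∀ I ∈ T, (I.2 - I.1) / 2 ≤ (∫⁻ y, g y).toReal / l := by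
    intro I hI
    have h1 : ENNReal.ofReal (l * (I.2 - I.1)) ≤ ∫⁻ y, g y := by
      rw [ENNReal.ofReal_mul hl.le]
      exact hI.2.le.trans (setLIntegral_le_lintegral _ _)
    have h2 := (ENNReal.ofReal_le_iff_le_toReal hg).1 h1
    rw [le_div_iff₀ hl]
    have := mul_pos hl (sub_pos.2 hI.1)
    nlinarith
  obtain ⟨u, huT, hdisj, hcov⟩ := Vitali.exists_disjoint_subfamily_covering_enlargement_closedBall
    T (fun I => (I.1 + I.2) / 2) (fun I => (I.2 - I.1) / 2) _ hrad 5 (by norm_num)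
  have hball : ∀ I : ℝ × ℝ, Metric.closedBall ((I.1 + I.2) / 2) ((I.2 - I.1) / 2) = Icc I.1 I.2 := by
    intro I
    rw [Real.closedBall_eq_Icc]
    congr 1 <;> ring
  have hcount : u.Countable := by
    refine hdisj.countable_of_nonempty_interior fun I hI => ?_
    simp only [hball, interior_Icc]
    exact nonempty_Ioo.2 (huT hI).1
  have hsub : {x | ENNReal.ofReal l < maximal g x} ⊆
      ⋃ I ∈ u, Metric.closedBall ((I.1 + I.2) / 2) (5 * ((I.2 - I.1) / 2)) := by
    intro x hx
    obtain ⟨s, t, hs, ht, h⟩ := lt_maximal_iff.1 hx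
    have hst : (s, t) ∈ T := by
      refine ⟨hs.trans ht, ?_⟩
      rwa [ENNReal.lt_div_iff_mul_lt (Or.inl (by simp; linarith)) (Or.inl (by simp))] at h
    obtain ⟨J, hJ, hJs⟩ := hcov _ hst
    rw [hball] at hJs
    exact mem_biUnion hJ (hJs ⟨hs.le, ht.le⟩)
  calc ENNReal.ofReal l * volume {x | ENNReal.ofReal l < maximal g x}
      ≤ ENNReal.ofReal l * ∑' I : u, volume
          (Metric.closedBall ((I.1.1 + I.1.2) / 2) (5 * ((I.1.2 - I.1.1) / 2))) := by
        gcongr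
        exact (measure_mono hsub).trans (measure_biUnion_le _ hcount _)
    _ = ∑' I : u, 5 * (ENNReal.ofReal l * ENNReal.ofReal (I.1.2 - I.1.1)) := by
        rw [← ENNReal.tsum_mul_left]
        refine tsum_congr fun I => ?_
        rw [Real.volume_closedBall]
        have : 2 * (5 * ((I.1.2 - I.1.1) / 2)) = 5 * (I.1.2 - I.1.1) := by ring
        rw [this, ENNReal.ofReal_mul (by norm_num)]
        simp only [ENNReal.ofReal_ofNat]
        ring
    _ ≤ ∑' I : u, 5 * ∫⁻ y in Ioo I.1.1 I.1.2, g y := by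
        gcongr with I
        exact (huT I.2).2.le
    _ = 5 * ∫⁻ y in ⋃ I ∈ u, Ioo I.1 I.2, g y := by
        rw [ENNReal.tsum_mul_left, lintegral_biUnion hcount (fun _ _ => measurableSet_Ioo)]
        intro I hI J hJ hIJ
        refine (hdisj hI hJ hIJ).mono ?_ ?_ <;> simp only [hball] <;> exact Ioo_subset_Icc_self
    _ ≤ 5 * ∫⁻ y, g y := by
        gcongr
        exact Measure.restrict_le_self

theorem maximal_mono {g h : ℝ → ℝ≥0∞} (hgh : ∀ y, g y ≤ h y) (x : ℝ) :
    maximal g x ≤ maximal h x := by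
  unfold maximal
  gcongr
  exact hgh _

theorem maximal_const_add_le (c : ℝ≥0∞) (g : ℝ → ℝ≥0∞) (x : ℝ) :
    maximal (fun y => c + g y) x ≤ c + maximal g x := by
  refine iSup₂_le fun I hI => ?_
  rw [lintegral_add_left measurable_const, setLIntegral_const, Real.volume_Ioo, ENNReal.add_div]
  gcongr
  · exact ENNReal.div_le_of_le_mul le_rfl
  · exact div_le_maximal hI.1 hI.2

theorem maximal_le_of_le {g : ℝ → ℝ≥0∞} {c : ℝ≥0∞} (h : ∀ y, g y ≤ c) (x : ℝ) :
    maximal g x ≤ c := by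
  refine iSup₂_le fun I hI => ?_
  refine ENNReal.div_le_of_le_mul ?_
  calc ∫⁻ y in Ioo I.1 I.2, g y ≤ ∫⁻ _ in Ioo I.1 I.2, c := lintegral_mono h
    _ = _ := by rw [setLIntegral_const, Real.volume_Ioo]

/-- The weak type bound, restricted to the part where the function is large. -/
theorem maximal_weak_type_restricted (g : ℝ → ℝ≥0∞) (hgm : Measurable g) (hg : ∫⁻ y, g y ≠ ∞)
    {l : ℝ} (hl : 0 < l) :
    ENNReal.ofReal l * volume {x | ENNReal.ofReal l < maximal g x} ≤
      10 * ∫⁻ y, {y | ENNReal.ofReal l < 2 * g y}.indicator g y := by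
  have hms : MeasurableSet {y | ENNReal.ofReal l < 2 * g y} :=
    measurableSet_lt measurable_const (hgm.const_mul 2)
  set h : ℝ → ℝ≥0∞ := {y | ENNReal.ofReal l < 2 * g y}.indicator g with hh
  have hle : ∀ y, g y ≤ ENNReal.ofReal (l / 2) + h y := by
    intro y
    by_cases hy : y ∈ {y | ENNReal.ofReal l < 2 * g y}
    · simp [hh, indicator_of_mem hy]
    · simp only [hh, indicator_of_notMem hy, add_zero]
      simp only [mem_ofPred_eq, not_lt] at hy
      rw [ENNReal.ofReal_div_of_pos (by norm_num), ENNReal.ofReal_ofNat,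
        ENNReal.le_div_iff_mul_le (by simp) (by simp), mul_comm]
      exact hy
  have hsub : {x | ENNReal.ofReal l < maximal g x} ⊆
      {x | ENNReal.ofReal (l / 2) < maximal h x} := by
    intro x hx
    simp only [mem_ofPred_eq] at hx ⊢
    have h1 : maximal g x ≤ ENNReal.ofReal (l / 2) + maximal h x :=
      (maximal_mono hle x).trans (maximal_const_add_le _ _ x)
    have h2 : ENNReal.ofReal l = ENNReal.ofReal (l / 2) + ENNReal.ofReal (l / 2) := by
      rw [← ENNReal.ofReal_add (by positivity) (by positivity)]
      congr 1
      ring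
    rw [h2] at hx
    exact (ENNReal.add_lt_add_iff_left (by simp)).1 (hx.trans_le h1)
  have hfin : ∫⁻ y, h y ≠ ∞ := by
    refine ne_top_of_le_ne_top hg (lintegral_mono fun y => ?_)
    exact indicator_le_self _ _ y
  have hw := maximal_weak_type h hfin (half_pos hl)
  calc ENNReal.ofReal l * volume {x | ENNReal.ofReal l < maximal g x}
      ≤ (2 * ENNReal.ofReal (l / 2)) * volume {x | ENNReal.ofReal (l / 2) < maximal h x} := by
        gcongr
        rw [← ENNReal.ofReal_ofNat 2, ← ENNReal.ofReal_mul (by norm_num)]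
        exact ENNReal.ofReal_le_ofReal (by linarith)
    _ ≤ 2 * (5 * ∫⁻ y, h y) := by
        rw [mul_assoc]
        gcongr
    _ = _ := by rw [← mul_assoc]; norm_num

theorem ae_le_maximal (g : ℝ → ℝ≥0∞) (hgm : Measurable g) (hg : ∫⁻ y, g y ≠ ∞) :
    ∀ᵐ x, g x ≤ maximal g x := by
  filter_upwards [(Besicovitch.vitaliFamily (volume : Measure ℝ)).ae_tendsto_lintegral_div
    hgm.aemeasurable hg] with x hx
  refine le_of_tendsto (hx.comp (Besicovitch.tendsto_filterAt volume x)) ?_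
  filter_upwards [self_mem_nhdsWithin] with r hr
  have hr : 0 < r := hr
  have h := div_le_maximal (g := g) (x := x) (s := x - r) (t := x + r) (by linarith) (by linarith)
  simp only [Function.comp]
  rw [Real.volume_closedBall, Real.closedBall_eq_Icc,
    ← setLIntegral_congr (Ioo_ae_eq_Icc (μ := volume) (a := x - r) (b := x + r))]
  have e : x + r - (x - r) = 2 * r := by ring
  rwa [e] at h

theorem lintegral_Iio_rpow {a y : ℝ} (ha : 0 < a) (hy : 0 ≤ y) :
    ∫⁻ t in Ioi 0, (Iio y).indicator (fun t => ENNReal.ofReal (t ^ (a - 1))) t =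
      ENNReal.ofReal (y ^ a / a) := by
  rw [lintegral_indicator measurableSet_Iio, Measure.restrict_restrict measurableSet_Iio,
    inter_comm, Ioi_inter_Iio, setLIntegral_congr Ioo_ae_eq_Ioc,
    ← ofReal_integral_eq_lintegral_ofReal, ← intervalIntegral.integral_of_le hy,
    integral_rpow (Or.inl (by linarith))]
  · simp [Real.zero_rpow ha.ne']
  · have := intervalIntegral.intervalIntegrable_rpow' (a := 0) (b := y) (r := a - 1) (by linarith)
    rwa [intervalIntegrable_iff_integrableOn_Ioc_of_le hy] at this
  · filter_upwards [ae_restrict_mem measurableSet_Ioc] with t ht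
    exact Real.rpow_nonneg ht.1.le _

theorem lintegral_Ioi_rpow {b y : ℝ} (hb : 0 < b) (hy : 0 < y) :
    ∫⁻ t in Ioi y, ENNReal.ofReal (t ^ (-b - 1)) = ENNReal.ofReal (y ^ (-b) / b) := by
  rw [← ofReal_integral_eq_lintegral_ofReal (integrableOn_Ioi_rpow_of_lt (by linarith) hy),
    integral_Ioi_rpow_of_lt (by linarith) hy]
  · congr 1
    have : -b - 1 + 1 = -b := by ring
    rw [this, neg_div_neg_eq]
  · filter_upwards [ae_restrict_mem measurableSet_Ioi] with t ht
    exact Real.rpow_nonneg (hy.le.trans (le_of_lt ht)) _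

theorem lintegral_rpow_eq_lintegral_meas_lt (h : ℝ → ℝ≥0∞) (hm : Measurable h)
    (hfin : ∀ x, h x ≠ ∞) {p : ℝ} (hp : 0 < p) :
    ∫⁻ x, h x ^ p = ENNReal.ofReal p * ∫⁻ t in Ioi (0 : ℝ),
      volume {x | ENNReal.ofReal t < h x} * ENNReal.ofReal (t ^ (p - 1)) := by
  have h1 := lintegral_rpow_eq_lintegral_meas_lt_mul (volume : Measure ℝ)
    (f := fun x => (h x).toReal) (Filter.Eventually.of_forall fun x => ENNReal.toReal_nonneg)
    hm.ennreal_toReal.aemeasurable hp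
  convert h1 using 1
  · refine lintegral_congr fun x => ?_
    rw [← ENNReal.ofReal_rpow_of_nonneg ENNReal.toReal_nonneg hp.le, ENNReal.ofReal_toReal (hfin x)]
  · congr 1
    refine setLIntegral_congr_fun measurableSet_Ioi fun t ht => ?_
    congr 3 with x
    exact ENNReal.ofReal_lt_iff_lt_toReal (le_of_lt ht) (hfin x)

/-- The Hardy–Littlewood maximal theorem on `L^p`, for bounded integrable functions. -/
theorem maximal_strong_type {p : ℝ} (hp : 1 < p) (g : ℝ → ℝ≥0∞) (hgm : Measurable g)
    (hg : ∫⁻ y, g y ≠ ∞) {B : ℝ≥0∞} (hB : B ≠ ∞) (hgB : ∀ y, g y ≤ B) :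
    ∫⁻ x, maximal g x ^ p ≤
      ENNReal.ofReal p * 10 * ENNReal.ofReal (2 ^ (p - 1) / (p - 1)) * ∫⁻ y, g y ^ p := by
  have hgfin : ∀ y, g y ≠ ∞ := fun y => ne_top_of_le_ne_top hB (hgB y)
  rw [lintegral_rpow_eq_lintegral_meas_lt _ (measurable_maximal g)
    (fun x => ne_top_of_le_ne_top hB (maximal_le_of_le hgB x)) (by linarith)]
  have hmeas : Measurable fun z : ℝ × ℝ =>
      {w : ℝ × ℝ | ENNReal.ofReal w.1 < 2 * g w.2}.indicator
        (fun w => g w.2 * ENNReal.ofReal (w.1 ^ (p - 1 - 1))) z := by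
    refine Measurable.indicator (by fun_prop) ?_
    exact measurableSet_lt (by fun_prop) (by fun_prop)
  calc ENNReal.ofReal p * ∫⁻ t in Ioi (0 : ℝ),
        volume {x | ENNReal.ofReal t < maximal g x} * ENNReal.ofReal (t ^ (p - 1))
      ≤ ENNReal.ofReal p * ∫⁻ t in Ioi (0 : ℝ), 10 * ∫⁻ y,
        {w : ℝ × ℝ | ENNReal.ofReal w.1 < 2 * g w.2}.indicator
        (fun w => g w.2 * ENNReal.ofReal (w.1 ^ (p - 1 - 1))) (t, y) := by
        gcongr ENNReal.ofReal p * ?_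
        refine setLIntegral_mono' measurableSet_Ioi fun t ht => ?_
        have ht : 0 < t := ht
        have e1 : ENNReal.ofReal (t ^ (p - 1)) =
            ENNReal.ofReal t * ENNReal.ofReal (t ^ (p - 1 - 1)) := by
          rw [← ENNReal.ofReal_mul ht.le, Real.rpow_sub_one ht.ne' (p - 1)]
          congr 1
          field_simp
        have e2 : ∀ y, {w : ℝ × ℝ | ENNReal.ofReal w.1 < 2 * g w.2}.indicator
            (fun w => g w.2 * ENNReal.ofReal (w.1 ^ (p - 1 - 1))) (t, y) =
            {y | ENNReal.ofReal t < 2 * g y}.indicator g y * ENNReal.ofReal (t ^ (p - 1 - 1)) := by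
          intro y
          by_cases hy : ENNReal.ofReal t < 2 * g y <;> simp [indicator, hy]
        simp_rw [e2]
        rw [lintegral_mul_const' _ _ (by simp), e1, ← mul_assoc, ← mul_assoc]
        refine mul_le_mul_left ?_ _
        rw [mul_comm]
        exact maximal_weak_type_restricted g hgm hg ht
    _ = ENNReal.ofReal p * 10 * ∫⁻ y, ∫⁻ t in Ioi (0 : ℝ),
        {w : ℝ × ℝ | ENNReal.ofReal w.1 < 2 * g w.2}.indicator
        (fun w => g w.2 * ENNReal.ofReal (w.1 ^ (p - 1 - 1))) (t, y) := by
        rw [lintegral_const_mul' _ _ (by simp), ← mul_assoc, lintegral_lintegral_swap]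
        exact hmeas.aemeasurable
    _ ≤ ENNReal.ofReal p * 10 * ∫⁻ y, ENNReal.ofReal (2 ^ (p - 1) / (p - 1)) * g y ^ p := by
        gcongr with y
        have e3 : ∀ t ∈ Ioi (0 : ℝ), {w : ℝ × ℝ | ENNReal.ofReal w.1 < 2 * g w.2}.indicator
            (fun w => g w.2 * ENNReal.ofReal (w.1 ^ (p - 1 - 1))) (t, y) =
            g y * (Iio (2 * (g y).toReal)).indicator
              (fun t => ENNReal.ofReal (t ^ (p - 1 - 1))) t := by
          intro t ht
          have : ENNReal.ofReal t < 2 * g y ↔ t < 2 * (g y).toReal := by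
            rw [ENNReal.ofReal_lt_iff_lt_toReal (le_of_lt ht)
              (ENNReal.mul_ne_top (by simp) (hgfin y)), ENNReal.toReal_mul]
            simp
          by_cases h : t < 2 * (g y).toReal
          · simp [indicator, this, h]
          · simp [indicator, this, h]
        rw [setLIntegral_congr_fun measurableSet_Ioi e3, lintegral_const_mul' _ _ (hgfin y),
          lintegral_Iio_rpow (by linarith) (by positivity)]
        obtain ⟨r, hr0, hr⟩ : ∃ r : ℝ, 0 ≤ r ∧ g y = ENNReal.ofReal r :=
          ⟨(g y).toReal, ENNReal.toReal_nonneg, (ENNReal.ofReal_toReal (hgfin y)).symm⟩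
        rw [hr, ENNReal.toReal_ofReal hr0, ENNReal.ofReal_rpow_of_nonneg hr0 (by linarith),
          ← ENNReal.ofReal_mul hr0, ← ENNReal.ofReal_mul (div_nonneg (by positivity) (by linarith))]
        refine ENNReal.ofReal_le_ofReal (le_of_eq ?_)
        rw [Real.mul_rpow (by norm_num) hr0]
        have : r ^ p = r * r ^ (p - 1) := by
          rcases eq_or_lt_of_le hr0 with h0 | h0
          · rw [← h0, Real.zero_rpow (by linarith), zero_mul]
          · rw [Real.rpow_sub_one h0.ne']
            field_simp
        rw [this]
        ring
    _ = _ := by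
        rw [lintegral_const_mul' _ _ (by simp), ← mul_assoc]

/-- The maximal open intervals contained in a set. -/
def components (U : Set ℝ) : Set (ℝ × ℝ) :=
  {J | J.1 < J.2 ∧ J.1 ∉ U ∧ J.2 ∉ U ∧ Ioo J.1 J.2 ⊆ U}

theorem components_pairwiseDisjoint (U : Set ℝ) :
    (components U).PairwiseDisjoint fun J => Ioo J.1 J.2 := by
  rintro I ⟨-, hI1, hI2, hI⟩ J ⟨-, hJ1, hJ2, hJ⟩ hne
  refine disjoint_left.2 fun x hxI hxJ => hne ?_
  have h1 : I.1 = J.1 := by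
    rcases lt_trichotomy I.1 J.1 with h | h | h
    · exact absurd (hI ⟨h, hxJ.1.trans hxI.2⟩) hJ1
    · exact h
    · exact absurd (hJ ⟨h, hxI.1.trans hxJ.2⟩) hI1
  have h2 : I.2 = J.2 := by
    rcases lt_trichotomy I.2 J.2 with h | h | h
    · exact absurd (hJ ⟨hxJ.1.trans hxI.2, h⟩) hI2
    · exact h
    · exact absurd (hI ⟨hxI.1.trans hxJ.2, h⟩) hJ2
  exact Prod.ext h1 h2

theorem components_countable (U : Set ℝ) : (components U).Countable := by
  refine (components_pairwiseDisjoint U).countable_of_nonempty_interior fun J hJ => ?_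
  rw [interior_Ioo]
  exact nonempty_Ioo.2 hJ.1

theorem biUnion_components {U : Set ℝ} (hU : IsOpen U) (hfin : volume U ≠ ∞) :
    ⋃ J ∈ components U, Ioo J.1 J.2 = U := by
  refine subset_antisymm (iUnion₂_subset fun J hJ => hJ.2.2.2) fun x hx => ?_
  have hl : (Uᶜ ∩ Iic x).Nonempty := by
    by_contra hne
    rw [not_nonempty_iff_eq_empty] at hne
    have : Iic x ⊆ U := fun y hy => by
      by_contra hyU
      exact (hne ▸ (⟨hyU, hy⟩ : y ∈ Uᶜ ∩ Iic x) : y ∈ (∅ : Set ℝ))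
    exact hfin (top_unique (Real.volume_Iic (a := x) ▸ measure_mono this))
  have hr : (Uᶜ ∩ Ici x).Nonempty := by
    by_contra hne
    rw [not_nonempty_iff_eq_empty] at hne
    have : Ici x ⊆ U := fun y hy => by
      by_contra hyU
      exact (hne ▸ (⟨hyU, hy⟩ : y ∈ Uᶜ ∩ Ici x) : y ∈ (∅ : Set ℝ))
    exact hfin (top_unique (Real.volume_Ici (a := x) ▸ measure_mono this))
  have hbl : BddAbove (Uᶜ ∩ Iic x) := ⟨x, fun y hy => hy.2⟩
  have hbr : BddBelow (Uᶜ ∩ Ici x) := ⟨x, fun y hy => hy.2⟩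
  have hs := (hU.isClosed_compl.inter isClosed_Iic).csSup_mem hl hbl
  have ht := (hU.isClosed_compl.inter isClosed_Ici).csInf_mem hr hbr
  set s := sSup (Uᶜ ∩ Iic x)
  set t := sInf (Uᶜ ∩ Ici x)
  have hsx : s < x := lt_of_le_of_ne hs.2 fun h => hs.1 (h ▸ hx)
  have hxt : x < t := lt_of_le_of_ne ht.2 fun h => ht.1 (h ▸ hx)
  refine mem_biUnion (x := (s, t)) ⟨hsx.trans hxt, hs.1, ht.1, fun y hy => ?_⟩ ⟨hsx, hxt⟩
  by_contra hyU
  rcases le_total y x with h | h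
  · exact absurd (le_csSup hbl ⟨hyU, h⟩) (not_le.2 hy.1)
  · exact absurd (csInf_le hbr ⟨hyU, h⟩) (not_le.2 hy.2)

/-- Convolution of a kernel with a function. -/
noncomputable def conv (K f : ℝ → ℂ) (x : ℝ) : ℂ := ∫ y, K (x - y) * f y

theorem integrable_conv_integrand {K f : ℝ → ℂ} (hK : Continuous K) {R : ℝ}
    (hR : ∀ x, ‖K x‖ ≤ R) (hf : Integrable f) (x : ℝ) : Integrable fun y => K (x - y) * f y := by
  refine hf.bdd_mul (c := R) ?_ (Filter.Eventually.of_forall fun y => hR _)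
  exact Continuous.aestronglyMeasurable (by fun_prop)

theorem continuous_conv {K f : ℝ → ℂ} (hK : Continuous K) {R : ℝ}
    (hR : ∀ x, ‖K x‖ ≤ R) (hf : Integrable f) : Continuous (conv K f) := by
  refine continuous_of_dominated (bound := fun y => R * ‖f y‖) ?_ ?_ (hf.norm.const_mul R) ?_
  · exact fun x => (integrable_conv_integrand hK hR hf x).aestronglyMeasurable
  · intro x
    filter_upwards with y
    rw [norm_mul]
    gcongr
    exact hR _
  · filter_upwards with y
    fun_prop

theorem lintegral_inv_sq_tail {h : ℝ} (hh : 0 < h) (c : ℝ) :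
    ∫⁻ x, {x | 2 * h ≤ |x - c|}.indicator (fun x => ENNReal.ofReal (h / |x - c| ^ 2)) x ≤ 1 := by
  refine (lintegral_sub_right_eq_self (fun x : ℝ =>
    {x | 2 * h ≤ |x|}.indicator (fun x => ENNReal.ofReal (h / |x| ^ 2)) x) c).trans_le ?_
  set F : ℝ → ℝ≥0∞ := (Ici (2 * h)).indicator fun x => ENNReal.ofReal (h / |x| ^ 2) with hF
  have hle : ∀ x : ℝ, {x | 2 * h ≤ |x|}.indicator (fun x => ENNReal.ofReal (h / |x| ^ 2)) x ≤
      F x + F (-x) := by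
    intro x
    by_cases hx : 2 * h ≤ |x|
    · rw [indicator_of_mem (by exact hx)]
      rcases le_total 0 x with h0 | h0
      · rw [abs_of_nonneg h0] at hx
        refine le_add_right (le_of_eq ?_)
        rw [hF, indicator_of_mem (by exact hx)]
      · rw [abs_of_nonpos h0] at hx
        refine le_add_left (le_of_eq ?_)
        rw [hF, indicator_of_mem (by exact hx), abs_neg]
    · rw [indicator_of_notMem (by exact hx)]
      exact zero_le
  have hFm : Measurable F := Measurable.indicator (by fun_prop) measurableSet_Ici
  have hFi : ∫⁻ x, F x = ENNReal.ofReal (1 / 2) := by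
    rw [hF, lintegral_indicator measurableSet_Ici, setLIntegral_congr Ioi_ae_eq_Ici.symm]
    have : ∀ x ∈ Ioi (2 * h), ENNReal.ofReal (h / |x| ^ 2) =
        ENNReal.ofReal h * ENNReal.ofReal (x ^ (-1 - 1 : ℝ)) := by
      intro x hx
      have hx0 : 0 < x := lt_trans (by positivity) (mem_Ioi.1 hx)
      rw [← ENNReal.ofReal_mul hh.le, sq_abs]
      congr 1
      have : (-1 - 1 : ℝ) = -(2 : ℕ) := by norm_num
      rw [this, Real.rpow_neg hx0.le, Real.rpow_natCast]
      rfl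
    rw [setLIntegral_congr_fun measurableSet_Ioi this, lintegral_const_mul' _ _ (by simp),
      lintegral_Ioi_rpow one_pos (by positivity), ← ENNReal.ofReal_mul hh.le]
    congr 1
    rw [Real.rpow_neg_one]
    field_simp
  calc _ ≤ ∫⁻ x, (F x + F (-x)) := lintegral_mono hle
    _ = ENNReal.ofReal (1 / 2) + ENNReal.ofReal (1 / 2) := by
        rw [lintegral_add_left hFm, lintegral_neg_eq_self F, hFi]
    _ = 1 := by
        rw [← ENNReal.ofReal_add (by norm_num) (by norm_num)]
        norm_num

open Classical in
/-- The good part of the Calderón–Zygmund decomposition with exceptional set `U`: on each component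
of `U` the function is replaced by its average. -/
noncomputable def goodPart (U : Set ℝ) (f : ℝ → ℂ) (x : ℝ) : ℂ :=
  if h : ∃ J ∈ components U, x ∈ Ioo J.1 J.2 then
    ⨍ y in Ioo h.choose.1 h.choose.2, f y
  else f x

theorem goodPart_of_mem {U : Set ℝ} {f : ℝ → ℂ} {x : ℝ} {J : ℝ × ℝ} (hJ : J ∈ components U)
    (hx : x ∈ Ioo J.1 J.2) : goodPart U f x = ⨍ y in Ioo J.1 J.2, f y := by
  have h : ∃ J ∈ components U, x ∈ Ioo J.1 J.2 := ⟨J, hJ, hx⟩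
  have : h.choose = J := by
    by_contra hne
    exact disjoint_left.1 (components_pairwiseDisjoint U h.choose_spec.1 hJ hne)
      h.choose_spec.2 hx
  rw [goodPart, dif_pos h, this]

theorem goodPart_of_notMem {U : Set ℝ} {f : ℝ → ℂ} {x : ℝ} (hx : x ∉ U) :
    goodPart U f x = f x := by
  rw [goodPart, dif_neg]
  rintro ⟨J, hJ, hxJ⟩
  exact hx (hJ.2.2.2 hxJ)

theorem aestronglyMeasurable_goodPart {U : Set ℝ} (hU : IsOpen U) (hfin : volume U ≠ ∞)
    {f : ℝ → ℂ} (hf : AEStronglyMeasurable f) : AEStronglyMeasurable (goodPart U f) := by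
  have h1 : AEStronglyMeasurable (goodPart U f) (volume.restrict Uᶜ) :=
    hf.restrict.congr (by
      filter_upwards [ae_restrict_mem hU.measurableSet.compl] with x hx
      exact (goodPart_of_notMem hx).symm)
  have h2 : AEStronglyMeasurable (goodPart U f) (volume.restrict U) := by
    have := (components_countable U).to_subtype
    suffices AEStronglyMeasurable (goodPart U f)
        (volume.restrict (⋃ J : components U, Ioo J.1.1 J.1.2)) by
      have h := biUnion_components hU hfin
      rw [biUnion_eq_iUnion] at h
      rwa [h] at this
    rw [aestronglyMeasurable_iUnion_iff]
    intro J
    refine (aestronglyMeasurable_const (b := ⨍ y in Ioo J.1.1 J.1.2, f y)).congr ?_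
    filter_upwards [ae_restrict_mem measurableSet_Ioo] with x hx
    exact (goodPart_of_mem J.2 hx).symm
  have := (aestronglyMeasurable_union_iff (μ := volume) (s := U) (t := Uᶜ)
    (f := goodPart U f)).2 ⟨h2, h1⟩
  rwa [union_compl_self, Measure.restrict_univ] at this

section

variable {f : ℝ → ℂ} {l : ℝ}

theorem setLIntegral_component_le (hl : 0 < l) {J : ℝ × ℝ}
    (hJ : J ∈ components {x | ENNReal.ofReal l < maximal (fun y => ‖f y‖ₑ) x}) :
    ∫⁻ y in Ioo J.1 J.2, ‖f y‖ₑ ≤ ENNReal.ofReal (l * (J.2 - J.1)) :=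
  setLIntegral_le_of_left_endpoint hJ.1 hl.le (not_lt.1 hJ.2.1)

theorem enorm_average_component_le (hl : 0 < l) {J : ℝ × ℝ}
    (hJ : J ∈ components {x | ENNReal.ofReal l < maximal (fun y => ‖f y‖ₑ) x}) :
    ‖⨍ y in Ioo J.1 J.2, f y‖ₑ ≤ ENNReal.ofReal l := by
  have h0 : 0 < J.2 - J.1 := sub_pos.2 hJ.1
  rw [setAverage_eq, enorm_smul, measureReal_def, Real.volume_Ioo, ENNReal.toReal_ofReal h0.le,
    Real.enorm_of_nonneg (by positivity)]
  calc ENNReal.ofReal (J.2 - J.1)⁻¹ * ‖∫ y in Ioo J.1 J.2, f y‖ₑ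
      ≤ ENNReal.ofReal (J.2 - J.1)⁻¹ * ENNReal.ofReal (l * (J.2 - J.1)) := by
        gcongr
        exact (enorm_integral_le_lintegral_enorm _).trans (setLIntegral_component_le hl hJ)
    _ = ENNReal.ofReal l := by
        rw [← ENNReal.ofReal_mul (by positivity)]
        congr 1
        field_simp

theorem ae_enorm_goodPart_le (hl : 0 < l) (hfm : Measurable f) (hf : Integrable f)
    (hfin : volume {x | ENNReal.ofReal l < maximal (fun y => ‖f y‖ₑ) x} ≠ ∞) :
    ∀ᵐ x, ‖goodPart {x | ENNReal.ofReal l < maximal (fun y => ‖f y‖ₑ) x} f x‖ₑ ≤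
      min (maximal (fun y => ‖f y‖ₑ) x) (ENNReal.ofReal l) := by
  filter_upwards [ae_le_maximal (fun y => ‖f y‖ₑ) hfm.enorm hf.2.ne] with x hx
  by_cases hxU : x ∈ {x | ENNReal.ofReal l < maximal (fun y => ‖f y‖ₑ) x}
  · have hxU' := hxU
    rw [← biUnion_components (isOpen_lt_maximal _ _) hfin] at hxU'
    obtain ⟨J, hJ, hxJ⟩ := mem_iUnion₂.1 hxU'
    rw [goodPart_of_mem hJ hxJ, min_eq_right (le_of_lt hxU)]
    exact enorm_average_component_le hl hJ
  · rw [goodPart_of_notMem hxU]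
    exact le_min hx (hx.trans (not_lt.1 hxU))

theorem setIntegral_sub_goodPart (hf : Integrable f) {U : Set ℝ} {J : ℝ × ℝ}
    (hJ : J ∈ components U) :
    IntegrableOn (goodPart U f) (Ioo J.1 J.2) ∧
      ∫ y in Ioo J.1 J.2, (f y - goodPart U f y) = 0 := by
  have hc : IntegrableOn (goodPart U f) (Ioo J.1 J.2) :=
    (integrableOn_const (C := ⨍ y in Ioo J.1 J.2, f y) (by simp)).congr_fun
      (fun x hx => (goodPart_of_mem hJ hx).symm) measurableSet_Ioo
  refine ⟨hc, ?_⟩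
  rw [integral_sub hf.integrableOn hc,
    setIntegral_congr_fun measurableSet_Ioo (fun x hx => goodPart_of_mem hJ hx),
    setIntegral_const, setAverage_eq, smul_smul, mul_inv_cancel₀, one_smul, sub_self]
  rw [measureReal_def, Real.volume_Ioo, ENNReal.toReal_ofReal (sub_nonneg.2 hJ.1.le)]
  exact (sub_pos.2 hJ.1).ne'

theorem setLIntegral_bad_component_le (hl : 0 < l) {J : ℝ × ℝ}
    (hfm : Measurable f)
    (hJ : J ∈ components {x | ENNReal.ofReal l < maximal (fun y => ‖f y‖ₑ) x}) :
    ∫⁻ y in Ioo J.1 J.2,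
      ‖f y - goodPart {x | ENNReal.ofReal l < maximal (fun y => ‖f y‖ₑ) x} f y‖ₑ ≤
      2 * ENNReal.ofReal l * volume (Ioo J.1 J.2) := by
  calc _ ≤ ∫⁻ y in Ioo J.1 J.2, (‖f y‖ₑ + ENNReal.ofReal l) := by
        refine setLIntegral_mono' measurableSet_Ioo fun y hy => ?_
        refine enorm_sub_le.trans ?_
        rw [goodPart_of_mem hJ hy]
        gcongr
        exact enorm_average_component_le hl hJ
    _ = (∫⁻ y in Ioo J.1 J.2, ‖f y‖ₑ) + ENNReal.ofReal l * volume (Ioo J.1 J.2) := by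
        rw [lintegral_add_left hfm.enorm, setLIntegral_const]
    _ ≤ ENNReal.ofReal (l * (J.2 - J.1)) + ENNReal.ofReal l * volume (Ioo J.1 J.2) := by
        gcongr
        exact setLIntegral_component_le hl hJ
    _ = _ := by
        rw [Real.volume_Ioo, ENNReal.ofReal_mul hl.le]
        ring

theorem integrable_goodPart (hl : 0 < l) (hfm : Measurable f) (hf : Integrable f)
    (hfin : volume {x | ENNReal.ofReal l < maximal (fun y => ‖f y‖ₑ) x} ≠ ∞) :
    Integrable (goodPart {x | ENNReal.ofReal l < maximal (fun y => ‖f y‖ₑ) x} f) := by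
  set U := {x | ENNReal.ofReal l < maximal (fun y => ‖f y‖ₑ) x} with hU
  have hUo : IsOpen U := isOpen_lt_maximal _ _
  refine ⟨aestronglyMeasurable_goodPart hUo hfin hf.1, ?_⟩
  calc ∫⁻ x, ‖goodPart U f x‖ₑ
      ≤ ∫⁻ x, (‖f x‖ₑ + U.indicator (fun _ => ENNReal.ofReal l) x) := by
        refine lintegral_mono_ae ?_
        filter_upwards [ae_enorm_goodPart_le hl hfm hf hfin] with x hx
        by_cases hxU : x ∈ U
        · rw [indicator_of_mem hxU]
          exact le_add_left (hx.trans (min_le_right _ _))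
        · rw [goodPart_of_notMem hxU]
          exact le_self_add
    _ = (∫⁻ x, ‖f x‖ₑ) + ENNReal.ofReal l * volume U := by
        rw [lintegral_add_left hfm.enorm, lintegral_indicator hUo.measurableSet, setLIntegral_const]
    _ < ∞ := ENNReal.add_lt_top.2 ⟨hf.2, ENNReal.mul_lt_top (by simp) (lt_top_iff_ne_top.2 hfin)⟩

end

theorem enorm_conv_le_of_integral_eq_zero {K b : ℝ → ℂ} {c h B x : ℝ} (hB : 0 ≤ B)
    (hreg : ∀ y, |y - c| ≤ h → ‖K (x - y) - K (x - c)‖ ≤ B * h / |x - c| ^ 2)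
    (hb : IntegrableOn b (Ioo (c - h) (c + h))) (h0 : ∫ y in Ioo (c - h) (c + h), b y = 0)
    (hKb : IntegrableOn (fun y => K (x - y) * b y) (Ioo (c - h) (c + h))) :
    ‖∫ y in Ioo (c - h) (c + h), K (x - y) * b y‖ₑ ≤
      ENNReal.ofReal B * ENNReal.ofReal (h / |x - c| ^ 2) *
        ∫⁻ y in Ioo (c - h) (c + h), ‖b y‖ₑ := by
  have h1 : ∫ y in Ioo (c - h) (c + h), K (x - y) * b y =
      ∫ y in Ioo (c - h) (c + h), (K (x - y) - K (x - c)) * b y := by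
    simp_rw [sub_mul]
    rw [integral_sub hKb (hb.const_mul _), integral_const_mul, h0, mul_zero, sub_zero]
  rw [h1]
  refine (enorm_integral_le_lintegral_enorm _).trans ?_
  rw [← lintegral_const_mul' _ _ (by finiteness)]
  refine setLIntegral_mono' measurableSet_Ioo fun y hy => ?_
  rw [enorm_mul, ← ENNReal.ofReal_mul hB]
  gcongr
  rw [← ofReal_norm]
  refine ENNReal.ofReal_le_ofReal ((hreg y ?_).trans_eq (mul_div_assoc _ _ _))
  rw [abs_le]
  constructor <;> linarith [hy.1, hy.2]

section

variable {f : ℝ → ℂ} {l : ℝ}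

theorem lintegral_conv_bad_le (hl : 0 < l) (hfm : Measurable f) (hf : Integrable f)
    (hfin : volume {x | ENNReal.ofReal l < maximal (fun y => ‖f y‖ₑ) x} ≠ ∞)
    {K : ℝ → ℂ} {B R : ℝ} (hB : 0 ≤ B) (hK : Continuous K) (hR : ∀ x, ‖K x‖ ≤ R)
    (hreg : ∀ c h x y, 0 < h → |y - c| ≤ h → 2 * h ≤ |x - c| →
      ‖K (x - y) - K (x - c)‖ ≤ B * h / |x - c| ^ 2) :
    ∃ E : Set ℝ, MeasurableSet E ∧
      volume E ≤ 2 * volume {x | ENNReal.ofReal l < maximal (fun y => ‖f y‖ₑ) x} ∧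
      ∫⁻ x in Eᶜ, ‖conv K (fun y => f y -
        goodPart {x | ENNReal.ofReal l < maximal (fun y => ‖f y‖ₑ) x} f y) x‖ₑ ≤
      2 * ENNReal.ofReal (B * l) *
        volume {x | ENNReal.ofReal l < maximal (fun y => ‖f y‖ₑ) x} := by
  have hgi := integrable_goodPart hl hfm hf hfin
  set U := {x | ENNReal.ofReal l < maximal (fun y => ‖f y‖ₑ) x} with hU
  have hUo : IsOpen U := isOpen_lt_maximal _ _
  have : Countable (components U) := (components_countable U).to_subtype
  set b : ℝ → ℂ := fun y => f y - goodPart U f y with hb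
  have hbi : Integrable b := hf.sub hgi
  have hcov : ⋃ J : components U, Ioo J.1.1 J.1.2 = U := by
    have h := biUnion_components hUo hfin
    rwa [biUnion_eq_iUnion] at h
  have hdisj : Pairwise (Function.onFun Disjoint fun J : components U => Ioo J.1.1 J.1.2) :=
    fun I J hIJ => components_pairwiseDisjoint U I.2 J.2 (fun h => hIJ (Subtype.ext h))
  have hvol : ∑' J : components U, volume (Ioo J.1.1 J.1.2) = volume U := by
    rw [← measure_iUnion hdisj (fun J => measurableSet_Ioo), hcov]
  set c : components U → ℝ := fun J => (J.1.1 + J.1.2) / 2 with hc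
  set h : components U → ℝ := fun J => (J.1.2 - J.1.1) / 2 with hh
  have hh0 : ∀ J, 0 < h J := fun J => half_pos (sub_pos.2 J.2.1)
  have hIoo : ∀ J : components U, Ioo J.1.1 J.1.2 = Ioo (c J - h J) (c J + h J) := by
    intro J
    congr 1 <;> simp only [hc, hh] <;> ring
  refine ⟨⋃ J : components U, Ioo (c J - 2 * h J) (c J + 2 * h J),
    MeasurableSet.iUnion fun _ => measurableSet_Ioo, ?_, ?_⟩
  · refine (measure_iUnion_le _).trans_eq ?_
    rw [← hvol, ← ENNReal.tsum_mul_left]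
    congr 1
    ext J
    rw [Real.volume_Ioo, Real.volume_Ioo, ← ENNReal.ofReal_ofNat, ← ENNReal.ofReal_mul (by simp)]
    congr 1
    simp only [hh]
    ring
  · have hpt : ∀ x ∈ (⋃ J : components U, Ioo (c J - 2 * h J) (c J + 2 * h J))ᶜ,
        ‖conv K b x‖ₑ ≤ ∑' J : components U, ENNReal.ofReal B *
          ({x | 2 * h J ≤ |x - c J|}.indicator
            (fun x => ENNReal.ofReal (h J / |x - c J| ^ 2)) x) *
          (2 * ENNReal.ofReal l * volume (Ioo J.1.1 J.1.2)) := by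
      intro x hx
      have hx' : ∀ J, 2 * h J ≤ |x - c J| := by
        intro J
        by_contra hlt
        refine hx (mem_iUnion.2 ⟨J, ?_⟩)
        have := abs_lt.1 (not_le.1 hlt)
        constructor <;> linarith
      have hint_K := integrable_conv_integrand hK hR hbi x
      have h1 : conv K b x = ∑' J : components U, ∫ y in Ioo J.1.1 J.1.2, K (x - y) * b y := by
        rw [← integral_iUnion (fun J => measurableSet_Ioo) hdisj hint_K.integrableOn, hcov, conv,
          setIntegral_eq_integral_of_forall_compl_eq_zero]
        intro y hy
        simp only [hb, goodPart_of_notMem hy, sub_self, mul_zero]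
      rw [h1]
      refine enorm_tsum_le_tsum_enorm.trans (ENNReal.tsum_le_tsum fun J => ?_)
      rw [indicator_of_mem (by exact hx' J)]
      have h2 := setLIntegral_bad_component_le hl hfm J.2
      have h3 := (setIntegral_sub_goodPart hf J.2).2
      rw [hIoo J] at h2 h3 ⊢
      refine (enorm_conv_le_of_integral_eq_zero hB
        (fun y hy => hreg _ _ _ _ (hh0 J) hy (hx' J)) hbi.integrableOn h3
        hint_K.integrableOn).trans ?_
      gcongr
    refine (setLIntegral_mono_ae' (MeasurableSet.iUnion fun _ => measurableSet_Ioo).compl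
      (Filter.Eventually.of_forall hpt)).trans ?_
    refine (setLIntegral_le_lintegral _ _).trans ?_
    have hm : ∀ J, Measurable ({x | 2 * h J ≤ |x - c J|}.indicator
            (fun x => ENNReal.ofReal (h J / |x - c J| ^ 2))) := fun J =>
      Measurable.indicator (by fun_prop) (measurableSet_le measurable_const (by fun_prop))
    rw [lintegral_tsum fun J => (((hm J).const_mul _).mul_const _).aemeasurable]
    rw [ENNReal.ofReal_mul hB, ← hvol, ← ENNReal.tsum_mul_left]
    refine ENNReal.tsum_le_tsum fun J => ?_
    rw [lintegral_mul_const _ ((hm J).const_mul _), lintegral_const_mul _ (hm J)]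
    calc _ ≤ ENNReal.ofReal B * 1 * (2 * ENNReal.ofReal l * volume (Ioo J.1.1 J.1.2)) := by
          gcongr
          exact lintegral_inv_sq_tail (hh0 J) _
      _ = _ := by ring

theorem meas_conv_lt_le (hl : 0 < l) (hfm : Measurable f) (hf : Integrable f)
    {K : ℝ → ℂ} {A : ℝ≥0∞} {B R : ℝ} (hB : 0 ≤ B) (hK : Continuous K) (hR : ∀ x, ‖K x‖ ≤ R)
    (hreg : ∀ c h x y, 0 < h → |y - c| ≤ h → 2 * h ≤ |x - c| →
      ‖K (x - y) - K (x - c)‖ ≤ B * h / |x - c| ^ 2)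
    (hL2 : ∀ f, Integrable f → ∫⁻ x, ‖conv K f x‖ₑ ^ 2 ≤ A * ∫⁻ x, ‖f x‖ₑ ^ 2) :
    ENNReal.ofReal l ^ 2 * volume {x | ENNReal.ofReal (2 * l) < ‖conv K f x‖ₑ} ≤
      (A + 2 + 2 * ENNReal.ofReal B) *
        ∫⁻ x, min (maximal (fun y => ‖f y‖ₑ) x) (ENNReal.ofReal l) ^ 2 := by
  have hfin : volume {x | ENNReal.ofReal l < maximal (fun y => ‖f y‖ₑ) x} ≠ ∞ := by
    have h := maximal_weak_type (fun y => ‖f y‖ₑ) hf.2.ne hl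
    intro htop
    rw [htop, ENNReal.mul_top (by simpa using hl)] at h
    exact (ENNReal.mul_lt_top (by simp) hf.2).not_ge h
  obtain ⟨E, hEm, hE, hbad⟩ := lintegral_conv_bad_le hl hfm hf hfin hB hK hR hreg
  have hgi := integrable_goodPart hl hfm hf hfin
  have hgle := ae_enorm_goodPart_le hl hfm hf hfin
  have hUo := isOpen_lt_maximal (fun y => ‖f y‖ₑ) (ENNReal.ofReal l)
  set U := {x | ENNReal.ofReal l < maximal (fun y => ‖f y‖ₑ) x} with hU
  set I := ∫⁻ x, min (maximal (fun y => ‖f y‖ₑ) x) (ENNReal.ofReal l) ^ 2 with hI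
  set L := ENNReal.ofReal l with hL
  set b : ℝ → ℂ := fun y => f y - goodPart U f y with hb
  have hUI : L ^ 2 * volume U ≤ I := by
    rw [← setLIntegral_const]
    refine (setLIntegral_mono' hUo.measurableSet fun x hx => ?_).trans
      (setLIntegral_le_lintegral U _)
    rw [min_eq_right (le_of_lt hx)]
  have hg : L ^ 2 * volume {x | L ≤ ‖conv K (goodPart U f) x‖ₑ} ≤ A * I := by
    have hmeas : Measurable fun x => ‖conv K (goodPart U f) x‖ₑ ^ 2 :=
      ((continuous_conv hK hR hgi).measurable.enorm).pow_const 2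
    calc L ^ 2 * volume {x | L ≤ ‖conv K (goodPart U f) x‖ₑ}
        ≤ L ^ 2 * volume {x | L ^ 2 ≤ ‖conv K (goodPart U f) x‖ₑ ^ 2} := by
          refine mul_le_mul_right (measure_mono fun x hx => ?_) _
          have hx' : L ≤ ‖conv K (goodPart U f) x‖ₑ := hx
          exact pow_le_pow_left' hx' 2
      _ ≤ ∫⁻ x, ‖conv K (goodPart U f) x‖ₑ ^ 2 := mul_meas_ge_le_lintegral hmeas _
      _ ≤ A * ∫⁻ x, ‖goodPart U f x‖ₑ ^ 2 := hL2 _ hgi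
      _ ≤ A * I := by
          gcongr 1
          refine lintegral_mono_ae ?_
          filter_upwards [hgle] with x hx
          gcongr
  have hbb : L ^ 2 * volume ({x | L ≤ ‖conv K b x‖ₑ} ∩ Eᶜ) ≤ 2 * ENNReal.ofReal B * I := by
    have hmeas : Measurable fun x => ‖conv K b x‖ₑ :=
      (continuous_conv hK hR (hf.sub hgi)).measurable.enorm
    calc L ^ 2 * volume ({x | L ≤ ‖conv K b x‖ₑ} ∩ Eᶜ)
        = L * (L * (volume.restrict Eᶜ) {x | L ≤ ‖conv K b x‖ₑ}) := by
          rw [Measure.restrict_apply (measurableSet_le measurable_const hmeas)]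
          ring
      _ ≤ L * (2 * ENNReal.ofReal (B * l) * volume U) := by
          refine mul_le_mul_right ?_ _
          exact (mul_meas_ge_le_lintegral hmeas _).trans hbad
      _ = 2 * ENNReal.ofReal B * (L ^ 2 * volume U) := by
          rw [ENNReal.ofReal_mul hB]
          ring
      _ ≤ _ := by gcongr
  have hsub : {x | ENNReal.ofReal (2 * l) < ‖conv K f x‖ₑ} ⊆
      {x | L ≤ ‖conv K (goodPart U f) x‖ₑ} ∪ (E ∪ ({x | L ≤ ‖conv K b x‖ₑ} ∩ Eᶜ)) := by
    intro x hx
    by_cases hxg : L ≤ ‖conv K (goodPart U f) x‖ₑ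
    · exact Or.inl hxg
    by_cases hxE : x ∈ E
    · exact Or.inr (Or.inl hxE)
    refine Or.inr (Or.inr ⟨?_, hxE⟩)
    by_contra hxb
    have hadd : conv K f x = conv K (goodPart U f) x + conv K b x := by
      simp only [conv]
      rw [← integral_add (integrable_conv_integrand hK hR hgi x)
        (integrable_conv_integrand hK hR (f := b) (hf.sub hgi) x)]
      congr 1
      ext y
      simp only [hb]
      ring
    have hx' : ENNReal.ofReal (2 * l) < ‖conv K f x‖ₑ := hx
    rw [hadd, two_mul, ENNReal.ofReal_add hl.le hl.le] at hx'
    exact (hx'.trans_le (enorm_add_le _ _)).not_ge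
      (add_le_add (not_le.1 hxg).le (not_le.1 hxb).le)
  calc _ ≤ L ^ 2 * (volume {x | L ≤ ‖conv K (goodPart U f) x‖ₑ} +
        (volume E + volume ({x | L ≤ ‖conv K b x‖ₑ} ∩ Eᶜ))) := by
        gcongr
        refine (measure_mono hsub).trans ((measure_union_le _ _).trans ?_)
        gcongr
        exact measure_union_le _ _
    _ ≤ A * I + (2 * I + 2 * ENNReal.ofReal B * I) := by
        rw [mul_add, mul_add]
        refine add_le_add hg (add_le_add ?_ hbb)
        calc L ^ 2 * volume E ≤ L ^ 2 * (2 * volume U) := by gcongr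
          _ = 2 * (L ^ 2 * volume U) := by ring
          _ ≤ 2 * I := by gcongr
    _ = _ := by ring

theorem lintegral_min_sq_mul_rpow_le {p m : ℝ} (hp : 0 < p) (hp2 : p < 2) (hm : 0 ≤ m) :
    ∫⁻ t in Ioi (0 : ℝ), min (ENNReal.ofReal m) (ENNReal.ofReal t) ^ 2 *
      ENNReal.ofReal (t ^ (p - 3)) ≤
      ENNReal.ofReal (1 / p + 1 / (2 - p)) * ENNReal.ofReal m ^ p := by
  rcases hm.eq_or_lt with rfl | hm0
  · simp
  have hp2' : 0 < 2 - p := sub_pos.2 hp2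
  calc _ ≤ ∫⁻ t in Ioi (0 : ℝ), ((Iio m).indicator (fun t => ENNReal.ofReal (t ^ (p - 1))) t +
        (Ici m).indicator
          (fun t => ENNReal.ofReal (m ^ 2) * ENNReal.ofReal (t ^ (-(2 - p) - 1))) t) := by
        refine setLIntegral_mono' measurableSet_Ioi fun t ht => ?_
        have ht0 : 0 < t := ht
        rcases lt_or_ge t m with h | h
        · rw [indicator_of_mem (by exact h), min_eq_right (ENNReal.ofReal_le_ofReal h.le),
            ← ENNReal.ofReal_pow ht0.le, ← ENNReal.ofReal_mul (by positivity)]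
          refine le_add_right (le_of_eq ?_)
          rw [← Real.rpow_natCast, ← Real.rpow_add ht0]
          congr 2
          push_cast
          ring
        · rw [indicator_of_mem (a := t) (s := Ici m) (by exact h),
            min_eq_left (ENNReal.ofReal_le_ofReal h), ← ENNReal.ofReal_pow hm]
          refine le_add_left (le_of_eq ?_)
          congr 3
          ring
    _ = ENNReal.ofReal (m ^ p / p) + ENNReal.ofReal (m ^ 2) *
          ENNReal.ofReal (m ^ (-(2 - p)) / (2 - p)) := by
        rw [lintegral_add_left (Measurable.indicator (by fun_prop) measurableSet_Iio),
          lintegral_Iio_rpow hp hm, lintegral_indicator measurableSet_Ici,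
          Measure.restrict_restrict measurableSet_Ici, inter_eq_left.2 (Ici_subset_Ioi.2 hm0),
          setLIntegral_congr Ioi_ae_eq_Ici.symm, lintegral_const_mul' _ _ (by simp),
          lintegral_Ioi_rpow hp2' hm0]
    _ = _ := by
        rw [← ENNReal.ofReal_mul (by positivity), ← ENNReal.ofReal_add (by positivity)
          (by positivity), ENNReal.ofReal_rpow_of_pos hm0, ← ENNReal.ofReal_mul (by positivity)]
        congr 1
        have : m ^ p = m ^ 2 * m ^ (-(2 - p)) := by
          rw [← Real.rpow_natCast, ← Real.rpow_add hm0]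
          congr 1
          push_cast
          ring
        rw [this]
        field_simp

theorem lintegral_conv_rpow_le {p : ℝ} (hp : 1 < p) (hp2 : p < 2) (hfm : Measurable f)
    (hf : Integrable f) {R' : ℝ} (hfR : ∀ x, ‖f x‖ ≤ R')
    {K : ℝ → ℂ} {A : ℝ≥0∞} {B R : ℝ} (hB : 0 ≤ B) (hK : Continuous K) (hR : ∀ x, ‖K x‖ ≤ R)
    (hreg : ∀ c h x y, 0 < h → |y - c| ≤ h → 2 * h ≤ |x - c| →
      ‖K (x - y) - K (x - c)‖ ≤ B * h / |x - c| ^ 2)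
    (hL2 : ∀ f, Integrable f → ∫⁻ x, ‖conv K f x‖ₑ ^ 2 ≤ A * ∫⁻ x, ‖f x‖ₑ ^ 2) :
    ∫⁻ x, ‖conv K f x‖ₑ ^ p ≤ 2 ^ p * (ENNReal.ofReal p * ((A + 2 + 2 * ENNReal.ofReal B) *
      (ENNReal.ofReal (1 / p + 1 / (2 - p)) *
      (ENNReal.ofReal p * 10 * ENNReal.ofReal (2 ^ (p - 1) / (p - 1)))))) *
        ∫⁻ x, ‖f x‖ₑ ^ p := by
  have hp0 : 0 < p := by linarith
  set M := maximal (fun y => ‖f y‖ₑ) with hM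
  have hMm : Measurable M := measurable_maximal _
  have hle : ∀ y, ‖f y‖ₑ ≤ ENNReal.ofReal R' := fun y => by
    rw [← ofReal_norm]
    exact ENNReal.ofReal_le_ofReal (hfR y)
  have hMfin : ∀ x, M x ≠ ∞ := fun x =>
    ne_top_of_le_ne_top ENNReal.ofReal_ne_top (maximal_le_of_le hle x)
  have hcm := (continuous_conv hK hR hf).measurable.enorm
  have h2 : (2 : ℝ≥0∞) ≠ 0 := by simp
  have hsc : ∀ x, ‖conv K f x‖ₑ ^ p = 2 ^ p * (‖conv K f x‖ₑ / 2) ^ p := by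
    intro x
    rw [← ENNReal.mul_rpow_of_nonneg _ _ hp0.le, ENNReal.mul_div_cancel h2 (by simp)]
  have hset : ∀ t : ℝ, {x | ENNReal.ofReal t < ‖conv K f x‖ₑ / 2} =
      {x | ENNReal.ofReal (2 * t) < ‖conv K f x‖ₑ} := by
    intro t
    ext x
    rw [mem_ofPred_eq, mem_ofPred_eq, ENNReal.lt_div_iff_mul_lt (by simp) (by simp), mul_comm,
      ENNReal.ofReal_mul (by simp), ENNReal.ofReal_ofNat]
  set D := A + 2 + 2 * ENNReal.ofReal B with hD
  have hFm : Measurable (Function.uncurry fun (t x : ℝ) =>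
      min (M x) (ENNReal.ofReal t) ^ 2 * ENNReal.ofReal (t ^ (p - 3))) := by
    apply Measurable.mul
    · exact ((hMm.comp measurable_snd).min (by fun_prop)).pow_const 2
    · fun_prop
  calc ∫⁻ x, ‖conv K f x‖ₑ ^ p = 2 ^ p * (ENNReal.ofReal p * ∫⁻ t in Ioi (0 : ℝ),
        volume {x | ENNReal.ofReal (2 * t) < ‖conv K f x‖ₑ} * ENNReal.ofReal (t ^ (p - 1))) := by
        simp_rw [hsc, ← hset]
        rw [lintegral_const_mul _ ((hcm.div_const 2).pow_const p),
          lintegral_rpow_eq_lintegral_meas_lt _ (hcm.div_const 2) (by finiteness) hp0]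
    _ ≤ 2 ^ p * (ENNReal.ofReal p * ∫⁻ t in Ioi (0 : ℝ), D *
        ∫⁻ x, min (M x) (ENNReal.ofReal t) ^ 2 * ENNReal.ofReal (t ^ (p - 3))) := by
        gcongr 2 ^ p * (ENNReal.ofReal p * ?_)
        refine setLIntegral_mono' measurableSet_Ioi fun t ht => ?_
        have ht0 : 0 < t := ht
        have h := meas_conv_lt_le ht0 hfm hf hB hK hR hreg hL2
        have hsplit : ENNReal.ofReal (t ^ (p - 1)) =
            ENNReal.ofReal t ^ 2 * ENNReal.ofReal (t ^ (p - 3)) := by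
          rw [← ENNReal.ofReal_pow ht0.le, ← ENNReal.ofReal_mul (by positivity),
            ← Real.rpow_natCast, ← Real.rpow_add ht0]
          congr 2
          push_cast
          ring
        rw [lintegral_mul_const _ ((hMm.min measurable_const).pow_const 2), hsplit, ← mul_assoc,
          ← mul_assoc, mul_comm (volume _)]
        gcongr
    _ = 2 ^ p * (ENNReal.ofReal p * (D * ∫⁻ x, ∫⁻ t in Ioi (0 : ℝ),
        min (M x) (ENNReal.ofReal t) ^ 2 * ENNReal.ofReal (t ^ (p - 3)))) := by
        rw [lintegral_const_mul _ (Measurable.lintegral_prod_right hFm),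
          lintegral_lintegral_swap hFm.aemeasurable]
    _ ≤ 2 ^ p * (ENNReal.ofReal p * (D * (ENNReal.ofReal (1 / p + 1 / (2 - p)) *
          ∫⁻ x, M x ^ p))) := by
        rw [← lintegral_const_mul _ (hMm.pow_const p)]
        gcongr with x
        have h := lintegral_min_sq_mul_rpow_le hp0 hp2 (m := (M x).toReal) ENNReal.toReal_nonneg
        rwa [ENNReal.ofReal_toReal (hMfin x)] at h
    _ ≤ 2 ^ p * (ENNReal.ofReal p * (D * (ENNReal.ofReal (1 / p + 1 / (2 - p)) *
          (ENNReal.ofReal p * 10 * ENNReal.ofReal (2 ^ (p - 1) / (p - 1)) *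
            ∫⁻ x, ‖f x‖ₑ ^ p)))) := by
        gcongr
        exact maximal_strong_type hp _ hfm.enorm hf.2.ne ENNReal.ofReal_ne_top hle
    _ = _ := by ring

end

/-- Integrable convolution kernels with quantitative `L²` and regularity bounds. -/
structure IsCZKernel (A B : ℝ) (K : ℝ → ℂ) : Prop where
  continuous : Continuous K
  integrable : Integrable K
  bounded : ∃ R, ∀ x, ‖K x‖ ≤ R
  regular : ∀ c h x y, 0 < h → |y - c| ≤ h → 2 * h ≤ |x - c| →
      ‖K (x - y) - K (x - c)‖ ≤ B * h / |x - c| ^ 2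
  lintegral_sq_le : ∀ f, Integrable f →
    ∫⁻ x, ‖conv K f x‖ₑ ^ 2 ≤ ENNReal.ofReal A * ∫⁻ x, ‖f x‖ₑ ^ 2

theorem conv_neg (K f : ℝ → ℂ) (x : ℝ) :
    conv (fun z => K (-z)) f x = conv K (fun y => f (-y)) (-x) := by
  rw [conv, conv, ← integral_neg_eq_self]
  congr 1
  ext y
  congr 2
  ring

theorem IsCZKernel.neg {A B : ℝ} {K : ℝ → ℂ} (hK : IsCZKernel A B K) :
    IsCZKernel A B fun z => K (-z) where
  continuous := hK.continuous.comp continuous_neg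
  integrable := hK.integrable.comp_neg
  bounded := hK.bounded.imp fun R hR x => hR _
  regular c h x y h0 hy hx := by
    have := hK.regular (-c) h (-x) (-y) h0
      (by rwa [neg_sub_neg, abs_sub_comm]) (by rwa [neg_sub_neg, abs_sub_comm])
    rwa [neg_sub_neg, neg_sub_neg, abs_sub_comm c, ← neg_sub x y, ← neg_sub x c] at this
  lintegral_sq_le f hf := by
    have h1 : ∫⁻ x, ‖conv (fun z => K (-z)) f x‖ₑ ^ 2 =
        ∫⁻ x, ‖conv K (fun y => f (-y)) x‖ₑ ^ 2 := by
      simp_rw [conv_neg]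
      exact (Measure.measurePreserving_neg volume).lintegral_comp_emb
        (Homeomorph.neg ℝ).measurableEmbedding fun x => ‖conv K (fun y => f (-y)) x‖ₑ ^ 2
    have h2 : ∫⁻ x, ‖f (-x)‖ₑ ^ 2 = ∫⁻ x, ‖f x‖ₑ ^ 2 :=
      (Measure.measurePreserving_neg volume).lintegral_comp_emb
        (Homeomorph.neg ℝ).measurableEmbedding fun x => ‖f x‖ₑ ^ 2
    rw [h1, ← h2]
    exact hK.lintegral_sq_le _ hf.comp_neg

theorem norm_conv_le {K f : ℝ → ℂ} {R : ℝ} (hR : ∀ x, ‖f x‖ ≤ R) (hK : Integrable K) (x : ℝ) :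
    ‖conv K f x‖ ≤ (∫ y, ‖K y‖) * R := by
  rw [← integral_sub_left_eq_self (fun y => ‖K y‖) volume x, ← integral_mul_const]
  refine norm_integral_le_of_norm_le ((hK.norm.comp_sub_left x).mul_const R)
    (Filter.Eventually.of_forall fun y => ?_)
  rw [norm_mul]
  gcongr
  exact hR y

theorem integrable_conv {K f : ℝ → ℂ} (hK : Integrable K) (hf : Integrable f) :
    Integrable (conv K f) := by
  have h := hf.integrable_convolution (ContinuousLinearMap.mul ℝ ℂ) hK
  refine h.congr (Filter.Eventually.of_forall fun x => ?_)
  simp only [MeasureTheory.convolution, conv, ContinuousLinearMap.mul_apply']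
  congr 1
  ext y
  ring

theorem integral_conv_mul {K f h : ℝ → ℂ} (hf : Integrable f)
    (hh : Integrable h) (hKc : Continuous K) {R : ℝ} (hR : ∀ x, ‖K x‖ ≤ R) :
    ∫ x, conv K f x * h x = ∫ y, f y * conv (fun z => K (-z)) h y := by
  simp_rw [conv, ← integral_mul_const, ← integral_const_mul]
  rw [integral_integral_swap]
  · congr 1
    ext y
    congr 1
    ext x
    rw [neg_sub]
    ring
  · have h1 : Integrable (fun z : ℝ × ℝ => h z.1 * f z.2) := hh.mul_prod hf
    have h2 : Integrable (fun z : ℝ × ℝ => K (z.1 - z.2) * (h z.1 * f z.2)) :=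
      h1.bdd_mul (c := R) (Continuous.aestronglyMeasurable (by fun_prop))
        (Filter.Eventually.of_forall fun z => hR _)
    refine h2.congr (Filter.Eventually.of_forall fun z => ?_)
    simp only [Function.uncurry]
    ring

theorem lintegral_rpow_lt_top_of_bounded {f : ℝ → ℂ} (hf : Integrable f) {R : ℝ}
    (hR : ∀ x, ‖f x‖ ≤ R) {p : ℝ} (hp : 1 ≤ p) : ∫⁻ x, ‖f x‖ₑ ^ p < ∞ := by
  have hle : ∀ x, ‖f x‖ₑ ≤ ENNReal.ofReal R := fun x => by
    rw [← ofReal_norm]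
    exact ENNReal.ofReal_le_ofReal (hR x)
  calc ∫⁻ x, ‖f x‖ₑ ^ p ≤ ∫⁻ x, ENNReal.ofReal R ^ (p - 1) * ‖f x‖ₑ := by
        refine lintegral_mono fun x => ?_
        calc ‖f x‖ₑ ^ p = ‖f x‖ₑ ^ ((p - 1) + 1) := by ring_nf
          _ = ‖f x‖ₑ ^ (p - 1) * ‖f x‖ₑ := by
            rw [ENNReal.rpow_add_of_nonneg _ _ (by linarith) zero_le_one, ENNReal.rpow_one]
          _ ≤ _ := by
            gcongr
            exact hle x
    _ < ∞ := by
        rw [lintegral_const_mul' _ _ (by finiteness)]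
        exact ENNReal.mul_lt_top (by finiteness) hf.2

theorem IsCZKernel.exists_lintegral_rpow_le_of_lt_two (A B : ℝ) (hB : 0 ≤ B) {p : ℝ}
    (hp : 1 < p) (hp2 : p < 2) : ∃ C : ℝ≥0∞, C ≠ ∞ ∧ ∀ K, IsCZKernel A B K →
      ∀ f : ℝ → ℂ, Measurable f → Integrable f → ∀ R, (∀ x, ‖f x‖ ≤ R) →
        ∫⁻ x, ‖conv K f x‖ₑ ^ p ≤ C * ∫⁻ x, ‖f x‖ₑ ^ p := by
  refine ⟨_, ?_, fun K hK f hfm hf R hfR =>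
    lintegral_conv_rpow_le hp hp2 hfm hf hfR hB hK.continuous hK.bounded.choose_spec
      hK.regular hK.lintegral_sq_le⟩
  finiteness

theorem IsCZKernel.exists_lintegral_rpow_le_of_two_lt (A B : ℝ) (hB : 0 ≤ B) {p : ℝ}
    (hp2 : 2 < p) : ∃ C : ℝ≥0∞, C ≠ ∞ ∧ ∀ K, IsCZKernel A B K →
      ∀ f : ℝ → ℂ, Measurable f → Integrable f → ∀ R, (∀ x, ‖f x‖ ≤ R) →
        ∫⁻ x, ‖conv K f x‖ₑ ^ p ≤ C * ∫⁻ x, ‖f x‖ₑ ^ p := by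
  have hpq : p.HolderConjugate (p / (p - 1)) := Real.HolderConjugate.conjExponent (by linarith)
  set q := p / (p - 1) with hq
  have hq2 : q < 2 := by
    rw [hq, div_lt_iff₀ (by linarith)]
    linarith
  have hq1 : 1 < q := hpq.symm.lt
  have hp0 : 0 < p := by linarith
  obtain ⟨C, hC, hCK⟩ := IsCZKernel.exists_lintegral_rpow_le_of_lt_two A B hB hq1 hq2
  refine ⟨C ^ (p / q), by finiteness, fun K hK f hfm hf R hfR => ?_⟩
  obtain ⟨R₀, hR₀⟩ := hK.bounded
  set u := conv K f with hu
  have hui : Integrable u := integrable_conv hK.integrable hf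
  have huc : Continuous u := continuous_conv hK.continuous hR₀ hf
  have hub : ∀ x, ‖u x‖ ≤ (∫ y, ‖K y‖) * R := norm_conv_le hfR hK.integrable
  set Q := (∫ y, ‖K y‖) * R with hQ
  have hQ0 : 0 ≤ Q := (norm_nonneg _).trans (hub 0)
  set h : ℝ → ℂ := fun x => (starRingEnd ℂ) (u x) * ((‖u x‖ ^ (p - 2) : ℝ) : ℂ) with hh
  have hhc : Continuous h := by
    refine (Complex.continuous_conj.comp huc).mul (Complex.continuous_ofReal.comp ?_)
    exact huc.norm.rpow_const fun x => Or.inr (by linarith)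
  have hhn : ∀ x, ‖h x‖ = ‖u x‖ ^ (p - 1) := by
    intro x
    rw [hh, norm_mul, RCLike.norm_conj, Complex.norm_real, Real.norm_of_nonneg (by positivity)]
    rcases (norm_nonneg (u x)).eq_or_lt with h0 | h0
    · rw [← h0, zero_mul, Real.zero_rpow (by linarith)]
    · conv_lhs => rw [← Real.rpow_one ‖u x‖, Real.rpow_one, ← Real.rpow_one_add' h0.le (by linarith)]
      congr 1
      ring
  have hhb : ∀ x, ‖h x‖ ≤ Q ^ (p - 1) := fun x => by
    rw [hhn]
    exact Real.rpow_le_rpow (norm_nonneg _) (hub x) (by linarith)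
  have hhi : Integrable h := by
    refine (hui.norm.mul_const (Q ^ (p - 2))).mono' hhc.aestronglyMeasurable
      (Filter.Eventually.of_forall fun x => ?_)
    rw [hh, norm_mul, RCLike.norm_conj, Complex.norm_real, Real.norm_of_nonneg (by positivity)]
    gcongr
    exact hub x
  have hprod : ∀ x, u x * h x = ((‖u x‖ ^ p : ℝ) : ℂ) := by
    intro x
    rw [hh]
    simp only
    rw [← mul_assoc, Complex.mul_conj, Complex.normSq_eq_norm_sq, ← Complex.ofReal_mul]
    congr 1
    rw [← Real.rpow_natCast, ← Real.rpow_add_of_nonneg (norm_nonneg _) (by positivity) (by linarith)]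
    congr 1
    push_cast
    ring
  have hdual : ENNReal.ofReal (∫ x, ‖u x‖ ^ p) ≤
      ∫⁻ y, ‖f y‖ₑ * ‖conv (fun z => K (-z)) h y‖ₑ := by
    have h1 := integral_conv_mul hf hhi hK.continuous hR₀
    rw [← hu, integral_congr_ae (Filter.Eventually.of_forall hprod), integral_complex_ofReal] at h1
    calc ENNReal.ofReal (∫ x, ‖u x‖ ^ p) = ‖((∫ x, ‖u x‖ ^ p : ℝ) : ℂ)‖ₑ := by
          rw [← ofReal_norm, Complex.norm_real,
            Real.norm_of_nonneg (integral_nonneg fun x => by positivity)]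
      _ ≤ ∫⁻ y, ‖f y * conv (fun z => K (-z)) h y‖ₑ := by
          rw [h1]
          exact enorm_integral_le_lintegral_enorm _
      _ = _ := by simp_rw [enorm_mul]
  have hIfin : ∫⁻ x, ‖u x‖ₑ ^ p < ∞ := lintegral_rpow_lt_top_of_bounded hui hub (by linarith)
  set I := ∫⁻ x, ‖u x‖ₑ ^ p with hI
  have hIeq : ENNReal.ofReal (∫ x, ‖u x‖ ^ p) = I := by
    have he : ∀ x, ENNReal.ofReal (‖u x‖ ^ p) = ‖u x‖ₑ ^ p := fun x => by
      rw [← ENNReal.ofReal_rpow_of_nonneg (norm_nonneg _) hp0.le, ofReal_norm]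
    rw [ofReal_integral_eq_lintegral_ofReal, hI]
    · simp_rw [he]
    · refine ⟨(huc.norm.rpow_const fun x => Or.inr hp0.le).aestronglyMeasurable, ?_⟩
      refine (lintegral_congr fun x => ?_).trans_lt hIfin
      rw [← he, Real.enorm_of_nonneg (by positivity)]
    · exact Filter.Eventually.of_forall fun x => by positivity
  have hhI : ∫⁻ x, ‖h x‖ₑ ^ q = I := by
    refine lintegral_congr fun x => ?_
    rw [← ofReal_norm, hhn, ← ENNReal.ofReal_rpow_of_nonneg (norm_nonneg _) (by linarith),
      ofReal_norm, ← ENNReal.rpow_mul]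
    congr 1
    rw [hq]
    have : p - 1 ≠ 0 := by linarith
    field_simp
  have hconvm : Measurable fun y => ‖conv (fun z => K (-z)) h y‖ₑ :=
    (continuous_conv hK.neg.continuous (R := R₀) (fun x => hR₀ _) hhi).measurable.enorm
  have hmain : I ≤ (∫⁻ y, ‖f y‖ₑ ^ p) ^ (1 / p) * (C * I) ^ (1 / q) := by
    rw [← hIeq]
    refine hdual.trans ((ENNReal.lintegral_mul_le_Lp_mul_Lq volume hpq
      hfm.enorm.aemeasurable hconvm.aemeasurable).trans ?_)
    rw [hIeq, ← hhI]
    have hq0 : 0 < 1 / q := by positivity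
    gcongr
    exact hCK _ hK.neg h hhc.measurable hhi _ hhb
  rcases eq_or_ne I 0 with h0 | h0
  · rw [h0]
    exact zero_le
  have hdiv : I ^ (1 / p) ≤ (∫⁻ y, ‖f y‖ₑ ^ p) ^ (1 / p) * C ^ (1 / q) := by
    rw [ENNReal.mul_rpow_of_nonneg _ _ (by positivity), ← mul_assoc] at hmain
    have hsplit : I = I ^ (1 / p) * I ^ (1 / q) := by
      rw [← ENNReal.rpow_add _ _ h0 hIfin.ne, one_div, one_div, hpq.inv_add_inv_eq_one,
        ENNReal.rpow_one]
    have hne0 : I ^ (1 / q) ≠ 0 := by simp [h0, hIfin.ne]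
    have hnet : I ^ (1 / q) ≠ ∞ := ENNReal.rpow_ne_top_of_nonneg (by positivity) hIfin.ne
    rw [← ENNReal.mul_le_mul_iff_left hne0 hnet, ← hsplit]
    exact hmain
  calc I = (I ^ (1 / p)) ^ p := by
        rw [← ENNReal.rpow_mul, one_div, inv_mul_cancel₀ hp0.ne', ENNReal.rpow_one]
    _ ≤ ((∫⁻ y, ‖f y‖ₑ ^ p) ^ (1 / p) * C ^ (1 / q)) ^ p := by gcongr
    _ = _ := by
        rw [ENNReal.mul_rpow_of_nonneg _ _ hp0.le, ← ENNReal.rpow_mul, ← ENNReal.rpow_mul,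
          one_div_mul_cancel hp0.ne', ENNReal.rpow_one, mul_comm]
        congr 2
        ring

theorem IsCZKernel.exists_lintegral_rpow_le (A B : ℝ) (hB : 0 ≤ B) {p : ℝ} (hp : 1 < p) :
    ∃ C : ℝ≥0∞, C ≠ ∞ ∧ ∀ K, IsCZKernel A B K →
      ∀ f : ℝ → ℂ, Measurable f → Integrable f → ∀ R, (∀ x, ‖f x‖ ≤ R) →
        ∫⁻ x, ‖conv K f x‖ₑ ^ p ≤ C * ∫⁻ x, ‖f x‖ₑ ^ p := by
  rcases lt_trichotomy p 2 with h | rfl | h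
  · exact IsCZKernel.exists_lintegral_rpow_le_of_lt_two A B hB hp h
  · refine ⟨ENNReal.ofReal A, by finiteness, fun K hK f _ hf _ _ => ?_⟩
    simpa using hK.lintegral_sq_le f hf
  · exact IsCZKernel.exists_lintegral_rpow_le_of_two_lt A B hB h

theorem schwartz_bounded (f : 𝓢(ℝ, ℂ)) : ∃ R, ∀ x, ‖f x‖ ≤ R := by
  obtain ⟨C, -, hC⟩ := f.decay 0 0
  exact ⟨C, fun x => by simpa using hC x⟩

theorem conv_eq_convolution (K f : 𝓢(ℝ, ℂ)) (x : ℝ) :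
    conv K f x = SchwartzMap.convolution (ContinuousLinearMap.mul ℂ ℂ) f K x := by
  rw [SchwartzMap.convolution_apply]
  simp only [MeasureTheory.convolution, conv, ContinuousLinearMap.mul_apply']
  congr 1
  ext y
  ring

theorem eLpNorm_two_sq (f : ℝ → ℂ) : eLpNorm f 2 volume ^ 2 = ∫⁻ x, ‖f x‖ₑ ^ 2 := by
  rw [eLpNorm_eq_lintegral_rpow_enorm_toReal (by simp) (by simp), ← ENNReal.rpow_natCast,
    ← ENNReal.rpow_mul]
  simp

theorem lintegral_sq_eq (f : 𝓢(ℝ, ℂ)) :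
    ∫⁻ x, ‖f x‖ₑ ^ 2 = ENNReal.ofReal (∫ x, ‖f x‖ ^ 2) := by
  rw [ofReal_integral_eq_lintegral_ofReal]
  · refine lintegral_congr fun x => ?_
    rw [ENNReal.ofReal_pow (norm_nonneg _), ofReal_norm]
  · exact (memLp_two_iff_integrable_sq_norm f.continuous.aestronglyMeasurable).1 (f.memLp 2)
  · exact Filter.Eventually.of_forall fun x => by positivity

theorem lintegral_conv_sq_le_schwartz (K f : 𝓢(ℝ, ℂ)) {Q : ℝ} (hQ : ∀ ξ, ‖𝓕 K ξ‖ ≤ Q) :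
    ∫⁻ x, ‖conv K f x‖ₑ ^ 2 ≤ ENNReal.ofReal (Q ^ 2) * ∫⁻ x, ‖f x‖ₑ ^ 2 := by
  simp_rw [conv_eq_convolution]
  rw [lintegral_sq_eq, lintegral_sq_eq, ← ENNReal.ofReal_mul (by positivity),
    ← SchwartzMap.integral_norm_sq_fourier, ← SchwartzMap.integral_norm_sq_fourier f,
    ← integral_const_mul]
  have hi : ∀ g : 𝓢(ℝ, ℂ), Integrable fun x => ‖g x‖ ^ 2 := fun g =>
    (memLp_two_iff_integrable_sq_norm g.continuous.aestronglyMeasurable).1 (g.memLp 2)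
  refine ENNReal.ofReal_le_ofReal (integral_mono (hi _) ((hi _).const_mul _) fun ξ => ?_)
  rw [SchwartzMap.fourier_convolution, SchwartzMap.pairing_apply_apply]
  simp only [ContinuousLinearMap.mul_apply', norm_mul, mul_pow]
  rw [mul_comm]
  gcongr
  exact hQ ξ

theorem enorm_conv_le_eLpNorm (K : 𝓢(ℝ, ℂ)) {f : ℝ → ℂ} (hf : AEStronglyMeasurable f) (x : ℝ) :
    ‖conv K f x‖ₑ ≤ eLpNorm K 2 volume * eLpNorm f 2 volume := by
  have h2 : (2 : ℝ).HolderConjugate 2 := Real.HolderConjugate.two_two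
  have hKm : Measurable fun y => ‖K (x - y)‖ₑ :=
    (K.continuous.comp (by fun_prop)).measurable.enorm
  refine (enorm_integral_le_lintegral_enorm _).trans ?_
  simp_rw [enorm_mul]
  refine (ENNReal.lintegral_mul_le_Lp_mul_Lq volume h2 hKm.aemeasurable hf.enorm).trans_eq ?_
  rw [eLpNorm_eq_lintegral_rpow_enorm_toReal (by simp) (by simp),
    eLpNorm_eq_lintegral_rpow_enorm_toReal (by simp) (by simp), ENNReal.toReal_ofNat,
    lintegral_sub_left_eq_self (fun y => ‖K y‖ₑ ^ (2 : ℝ)) x]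

theorem conv_sub {K f g : ℝ → ℂ} (hK : Continuous K) {R : ℝ} (hR : ∀ x, ‖K x‖ ≤ R)
    (hf : Integrable f) (hg : Integrable g) (x : ℝ) :
    conv K (f - g) x = conv K f x - conv K g x := by
  simp only [conv]
  rw [← integral_sub (integrable_conv_integrand hK hR hf x) (integrable_conv_integrand hK hR hg x)]
  simp only [Pi.sub_apply, mul_sub]

theorem tendsto_conv_of_eLpNorm (K : 𝓢(ℝ, ℂ)) {f : ℝ → ℂ} (hf : Integrable f)
    {g : ℕ → ℝ → ℂ} (hg : ∀ n, Integrable (g n)) {e : ℕ → ℝ≥0∞}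
    (he : Filter.Tendsto e Filter.atTop (𝓝 0)) (hge : ∀ n, eLpNorm (f - g n) 2 volume ≤ e n)
    (x : ℝ) : Filter.Tendsto (fun n => conv K (g n) x) Filter.atTop (𝓝 (conv K f x)) := by
  obtain ⟨R, hR⟩ := schwartz_bounded K
  have hK2 : eLpNorm K 2 volume ≠ ∞ := (K.memLp 2 volume).2.ne
  have h1 : Filter.Tendsto (fun n => eLpNorm K 2 volume * e n) Filter.atTop (𝓝 0) := by
    have h := ENNReal.Tendsto.const_mul he (Or.inr hK2)
    rwa [mul_zero] at h
  refine tendsto_iff_edist_tendsto_0.2 (tendsto_of_tendsto_of_tendsto_of_le_of_le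
    tendsto_const_nhds h1 (fun _ => zero_le) fun n => ?_)
  calc edist (conv K (g n) x) (conv K f x) = ‖conv K (f - g n) x‖ₑ := by
        rw [edist_comm, edist_eq_enorm_sub, conv_sub K.continuous hR hf (hg n)]
    _ ≤ eLpNorm K 2 volume * eLpNorm (f - g n) 2 volume :=
        enorm_conv_le_eLpNorm K (hf.1.sub (hg n).1) x
    _ ≤ eLpNorm K 2 volume * e n := mul_le_mul_right (hge n) _

theorem lintegral_conv_sq_le (K : 𝓢(ℝ, ℂ)) {Q : ℝ} (hQ0 : 0 < Q) (hQ : ∀ ξ, ‖𝓕 K ξ‖ ≤ Q)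
    (f : ℝ → ℂ) (hf : Integrable f) :
    ∫⁻ x, ‖conv K f x‖ₑ ^ 2 ≤ ENNReal.ofReal (Q ^ 2) * ∫⁻ x, ‖f x‖ₑ ^ 2 := by
  by_cases hfin : ∫⁻ x, ‖f x‖ₑ ^ 2 = ∞
  · rw [hfin, ENNReal.mul_top (by simpa using by positivity)]
    exact le_top
  have hf2 : MemLp f 2 := ⟨hf.1, by
    rw [← eLpNorm_two_sq] at hfin
    by_contra h
    rw [not_lt_top_iff] at h
    exact hfin (by rw [h]; simp)⟩
  obtain ⟨e, he0, he⟩ : ∃ e : ℕ → ℝ, (∀ n, 0 < e n) ∧ Filter.Tendsto e Filter.atTop (𝓝 0) :=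
    ⟨fun n => 1 / ((n : ℝ) + 1), fun n => by positivity, tendsto_one_div_add_atTop_nhds_zero_nat⟩
  have he' := ENNReal.tendsto_ofReal he
  rw [ENNReal.ofReal_zero] at he'
  have key : ∀ n : ℕ, ∃ g : 𝓢(ℝ, ℂ), eLpNorm (f - ⇑g) 2 volume ≤ ENNReal.ofReal (e n) := by
    intro n
    obtain ⟨g, hg1, hg2, hg3⟩ := hf2.exist_eLpNorm_sub_le (by simp) (by simp) (he0 n)
    exact ⟨hg1.toSchwartzMap hg2, hg3⟩
  choose g hg using key
  obtain ⟨R, hR⟩ := schwartz_bounded K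
  have hlim := tendsto_conv_of_eLpNorm K hf (fun n => (g n).integrable) he' hg
  have hcm : ∀ n, AEStronglyMeasurable (conv K (g n)) := fun n =>
    (continuous_conv K.continuous hR (g n).integrable).aestronglyMeasurable
  have hsch : ∀ n, eLpNorm (conv K (g n)) 2 volume ≤ ENNReal.ofReal Q *
      (eLpNorm f 2 volume + ENNReal.ofReal (e n)) := by
    intro n
    have h1 := lintegral_conv_sq_le_schwartz K (g n) hQ
    rw [← eLpNorm_two_sq, ← eLpNorm_two_sq, ENNReal.ofReal_pow hQ0.le, ← mul_pow] at h1
    refine ((ENNReal.pow_le_pow_left_iff two_ne_zero).1 h1).trans ?_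
    gcongr
    have : (g n : ℝ → ℂ) = f - (f - ⇑(g n)) := by simp
    rw [this]
    refine (eLpNorm_sub_le hf.1 (hf.1.sub (g n).continuous.aestronglyMeasurable)
      (by simp)).trans ?_
    gcongr
    exact hg n
  have hmain : eLpNorm (conv K f) 2 volume ≤ ENNReal.ofReal Q * eLpNorm f 2 volume := by
    refine (Lp.eLpNorm_lim_le_liminf_eLpNorm hcm _
      (Filter.Eventually.of_forall hlim)).trans ?_
    have h2 := ENNReal.Tendsto.const_mul (a := ENNReal.ofReal Q)
      ((tendsto_const_nhds (x := eLpNorm f 2 volume)).add he') (Or.inr ENNReal.ofReal_ne_top)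
    rw [add_zero] at h2
    rw [← h2.liminf_eq]
    exact Filter.liminf_le_liminf (Filter.Eventually.of_forall hsch)
  rw [← eLpNorm_two_sq, ← eLpNorm_two_sq, ENNReal.ofReal_pow hQ0.le, ← mul_pow]
  gcongr

theorem norm_sub_le_of_deriv_le {K : ℝ → ℂ} (hK : Differentiable ℝ K) {D : ℝ}
    (hD : ∀ x, ‖deriv K x‖ * x ^ 2 ≤ D) {c h x y : ℝ} (h0 : 0 < h) (hy : |y - c| ≤ h)
    (hx : 2 * h ≤ |x - c|) : ‖K (x - y) - K (x - c)‖ ≤ 4 * D * h / |x - c| ^ 2 := by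
  have hD0 : 0 ≤ D := by simpa using hD 0
  have hxc : 0 < |x - c| := by linarith
  have hbound : ∀ z ∈ Metric.closedBall (x - c) h, ‖deriv K z‖ ≤ 4 * D / |x - c| ^ 2 := by
    intro z hz
    rw [Metric.mem_closedBall, Real.dist_eq] at hz
    have hz2 : |x - c| / 2 ≤ |z| := by
      have := abs_sub_abs_le_abs_sub (x - c) z
      rw [abs_sub_comm (x - c) z] at this
      linarith
    rw [le_div_iff₀ (by positivity)]
    calc ‖deriv K z‖ * |x - c| ^ 2 = 4 * (‖deriv K z‖ * (|x - c| / 2) ^ 2) := by ring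
      _ ≤ 4 * (‖deriv K z‖ * |z| ^ 2) := by gcongr
      _ ≤ 4 * D := by
        rw [sq_abs]
        gcongr
        exact hD z
  have h1 := (convex_closedBall (x - c) h).norm_image_sub_le_of_norm_deriv_le
    (fun z _ => hK z) hbound (x := x - c) (y := x - y) (Metric.mem_closedBall_self h0.le)
    (by rw [Metric.mem_closedBall, Real.dist_eq, sub_sub_sub_cancel_left, abs_sub_comm]; exact hy)
  calc _ ≤ 4 * D / |x - c| ^ 2 * ‖x - y - (x - c)‖ := h1
    _ ≤ 4 * D / |x - c| ^ 2 * h := by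
      gcongr
      rw [sub_sub_sub_cancel_left, Real.norm_eq_abs, abs_sub_comm]
      exact hy
    _ = _ := by ring

theorem isCZKernel_of_schwartz (K : 𝓢(ℝ, ℂ)) {Q D : ℝ} (hQ0 : 0 < Q) (hQ : ∀ ξ, ‖𝓕 K ξ‖ ≤ Q)
    (hD : ∀ x, ‖deriv K x‖ * x ^ 2 ≤ D) : IsCZKernel (Q ^ 2) (4 * D) K where
  continuous := K.continuous
  integrable := K.integrable
  bounded := schwartz_bounded K
  regular _ _ _ _ h0 hy hx := norm_sub_le_of_deriv_le K.differentiable hD h0 hy hx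
  lintegral_sq_le := lintegral_conv_sq_le K hQ0 hQ

theorem exists_sum_min_zpow_le {ρ : ℝ} (h0 : 0 < ρ) (h1 : ρ < 1) : ∃ C, 0 < C ∧
    ∀ (S : Finset ℤ) (y : ℝ), 0 < y → ∑ n ∈ S, min (ρ ^ n * y) (ρ ^ n * y)⁻¹ ≤ C := by
  have hs : Summable fun j : ℤ => ρ ^ j.natAbs := by
    refine Summable.of_nat_of_neg ?_ ?_ <;> simpa using summable_geometric_of_lt_one h0.le h1
  refine ⟨ρ⁻¹ * ∑' j : ℤ, ρ ^ j.natAbs, ?_, fun S y hy => ?_⟩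
  · have := hs.tsum_pos (fun j => by positivity) 0 (by simp)
    positivity
  obtain ⟨m, hm1, hm2⟩ := exists_mem_Ioc_zpow hy (one_lt_inv_iff₀.2 ⟨h0, h1⟩)
  have hterm : ∀ n : ℤ, min (ρ ^ n * y) (ρ ^ n * y)⁻¹ ≤ ρ⁻¹ * ρ ^ (n - m).natAbs := by
    intro n
    rw [inv_zpow', neg_add] at hm2
    rw [inv_zpow'] at hm1
    rcases le_total m n with h | h
    · refine (min_le_left _ _).trans ?_
      calc ρ ^ n * y ≤ ρ ^ n * ρ ^ (-m + -1) := by gcongr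
        _ = ρ⁻¹ * ρ ^ ((n - m).natAbs : ℤ) := by
          rw [← zpow_add₀ h0.ne', ← zpow_neg_one, ← zpow_add₀ h0.ne']
          congr 1
          omega
        _ = _ := by rw [zpow_natCast]
    · refine (min_le_right _ _).trans ?_
      calc (ρ ^ n * y)⁻¹ ≤ (ρ ^ n * ρ ^ (-m))⁻¹ := by gcongr
        _ = ρ ^ ((n - m).natAbs : ℤ) := by
          rw [← zpow_add₀ h0.ne', ← zpow_neg]
          congr 1
          omega
        _ = 1 * ρ ^ (n - m).natAbs := by rw [zpow_natCast, one_mul]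
        _ ≤ _ := by
          gcongr
          exact (one_le_inv₀ h0).2 h1.le
  calc _ ≤ ∑ n ∈ S, ρ⁻¹ * ρ ^ (n - m).natAbs := Finset.sum_le_sum fun n _ => hterm n
    _ = ρ⁻¹ * ∑ n ∈ S, ρ ^ (n - m).natAbs := by rw [Finset.mul_sum]
    _ ≤ ρ⁻¹ * ∑' n : ℤ, ρ ^ (n - m).natAbs := by
      gcongr
      exact ((Equiv.subRight m).summable_iff.2 hs).sum_le_tsum S fun _ _ => by positivity
    _ = _ := by
      congr 1
      exact (Equiv.subRight m).tsum_eq fun j : ℤ => ρ ^ j.natAbs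

/-- The dilate `ξ ↦ η (ξ t)` of a Schwartz function. -/
noncomputable def dilate (t : ℝˣ) (η : 𝓢(ℝ, ℂ)) : 𝓢(ℝ, ℂ) :=
  SchwartzMap.compCLMOfContinuousLinearEquiv ℂ (ContinuousLinearEquiv.unitsEquivAut ℝ t) η

@[simp]
theorem dilate_apply (t : ℝˣ) (η : 𝓢(ℝ, ℂ)) (ξ : ℝ) : dilate t η ξ = η (ξ * t) := by
  simp [dilate]

theorem fourierInv_dilate (t : ℝˣ) (η : 𝓢(ℝ, ℂ)) (x : ℝ) :
    𝓕⁻ (dilate t η) x = |(t : ℝ)⁻¹| • 𝓕⁻ η ((t : ℝ)⁻¹ * x) := by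
  rw [SchwartzMap.fourierInv_coe, SchwartzMap.fourierInv_coe, Real.fourierInv_eq',
    Real.fourierInv_eq', ← Measure.integral_comp_mul_right _ (t : ℝ)]
  refine integral_congr_ae (Filter.Eventually.of_forall fun ξ => ?_)
  have ht : (t : ℝ) ≠ 0 := t.ne_zero
  simp only [dilate_apply]
  congr 4
  simp
  field_simp

/-- The Fourier multiplier with symbol `m`, applied to `f`. -/
noncomputable def mult (m : ℝ → ℂ) (f : 𝓢(ℝ, ℂ)) (x : ℝ) : ℂ := 𝓕⁻ (fun ξ => m ξ * 𝓕 f ξ) x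

theorem mult_eq_conv (m f : 𝓢(ℝ, ℂ)) (x : ℝ) : mult m f x = conv (𝓕⁻ m : 𝓢(ℝ, ℂ)) f x := by
  rw [conv_eq_convolution]
  have h : SchwartzMap.convolution (ContinuousLinearMap.mul ℂ ℂ) f (𝓕⁻ m : 𝓢(ℝ, ℂ)) =
      𝓕⁻ (SchwartzMap.pairing (ContinuousLinearMap.mul ℂ ℂ) (𝓕 f) m) := by
    rw [← FourierTransform.fourierInv_fourier_eq (F := 𝓢(ℝ, ℂ)) (SchwartzMap.convolution _ _ _),
      SchwartzMap.fourier_convolution, FourierTransform.fourier_fourierInv_eq]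
  rw [h, SchwartzMap.fourierInv_coe, mult]
  refine congrArg (fun u : ℝ → ℂ => 𝓕⁻ u x) (funext fun ξ => ?_)
  rw [SchwartzMap.pairing_apply_apply]
  simp [mul_comm]

theorem exists_norm_le_min (η : 𝓢(ℝ, ℂ)) (h0 : η 0 = 0) :
    ∃ C, 0 < C ∧ ∀ u, u ≠ 0 → ‖η u‖ ≤ C * min |u| |u|⁻¹ := by
  obtain ⟨C₁, hC₁, h₁⟩ := η.decay 1 0
  obtain ⟨C₂, hC₂, h₂⟩ := (SchwartzMap.derivCLM ℂ ℂ η).decay 0 0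
  have hlip : ∀ u, ‖η u‖ ≤ C₂ * |u| := by
    intro u
    have := convex_univ.norm_image_sub_le_of_norm_deriv_le (f := η) (C := C₂) (x := 0) (y := u)
      (fun z _ => η.differentiable z) (fun z _ => by simpa using h₂ z) (mem_univ _) (mem_univ _)
    simpa [h0] using this
  refine ⟨max C₁ C₂, by positivity, fun u hu => ?_⟩
  rw [mul_min_of_nonneg _ _ (by positivity)]
  refine le_min ((hlip u).trans (by gcongr; exact le_max_right _ _)) ?_
  have := h₁ u
  rw [← div_eq_mul_inv, le_div_iff₀ (abs_pos.2 hu), mul_comm]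
  refine le_trans (by simpa using this) (le_max_left _ _)

theorem exists_deriv_le_min (k : 𝓢(ℝ, ℂ)) :
    ∃ C, 0 < C ∧ ∀ u, u ≠ 0 → u ^ 2 * ‖deriv k u‖ ≤ C * min |u| |u|⁻¹ := by
  obtain ⟨C₁, hC₁, h₁⟩ := (SchwartzMap.derivCLM ℂ ℂ k).decay 1 0
  obtain ⟨C₂, hC₂, h₂⟩ := (SchwartzMap.derivCLM ℂ ℂ k).decay 3 0
  refine ⟨max C₁ C₂, by positivity, fun u hu => ?_⟩
  have hu' := abs_pos.2 hu
  have h₁ := h₁ u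
  have h₂ := h₂ u
  simp only [norm_iteratedFDeriv_zero, SchwartzMap.derivCLM_apply, Real.norm_eq_abs, pow_one]
    at h₁ h₂
  rw [mul_min_of_nonneg _ _ (by positivity), ← sq_abs]
  refine le_min ?_ ?_
  · calc |u| ^ 2 * ‖deriv k u‖ = |u| * ‖deriv k u‖ * |u| := by ring
      _ ≤ max C₁ C₂ * |u| := by gcongr; exact h₁.trans (le_max_left _ _)
  · rw [← div_eq_mul_inv, le_div_iff₀ hu']
    calc |u| ^ 2 * ‖deriv k u‖ * |u| = |u| ^ 3 * ‖deriv k u‖ := by ring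
      _ ≤ _ := h₂.trans (le_max_right _ _)

noncomputable def scaleUnit {ρ : ℝ} (h : 0 < ρ) : ℝˣ := Units.mk0 ρ h.ne'

noncomputable def lacunarySymbol {ρ : ℝ} (h : 0 < ρ) (η : 𝓢(ℝ, ℂ)) (S : Finset ℤ) (c : ℤ → ℂ) :
    𝓢(ℝ, ℂ) :=
  ∑ n ∈ S, c n • dilate (scaleUnit h ^ (-n)) η

theorem lacunarySymbol_apply {ρ : ℝ} (h : 0 < ρ) (η : 𝓢(ℝ, ℂ)) (S : Finset ℤ) (c : ℤ → ℂ)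
    (ξ : ℝ) : lacunarySymbol h η S c ξ = ∑ n ∈ S, c n * η (ξ / ρ ^ n) := by
  simp [lacunarySymbol, scaleUnit, div_eq_mul_inv]

theorem norm_lacunarySymbol_le {ρ : ℝ} (h : 0 < ρ) {η : 𝓢(ℝ, ℂ)} (h0 : η 0 = 0) {C A : ℝ}
    (hC0 : 0 < C) (hC : ∀ u, u ≠ 0 → ‖η u‖ ≤ C * min |u| |u|⁻¹) (hA0 : 0 < A)
    (hA : ∀ (S : Finset ℤ) (y : ℝ), 0 < y → ∑ n ∈ S, min (ρ ^ n * y) (ρ ^ n * y)⁻¹ ≤ A)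
    (S : Finset ℤ) {c : ℤ → ℂ} (hc : ∀ n, ‖c n‖ ≤ 1) (ξ : ℝ) :
    ‖lacunarySymbol h η S c ξ‖ ≤ C * A := by
  rw [lacunarySymbol_apply]
  rcases eq_or_ne ξ 0 with rfl | hξ
  · simp only [zero_div, h0, mul_zero, Finset.sum_const_zero, norm_zero]
    positivity
  calc _ ≤ ∑ n ∈ S, C * min (ρ ^ n * |ξ|⁻¹) (ρ ^ n * |ξ|⁻¹)⁻¹ := by
        refine norm_sum_le_of_le _ fun n _ => ?_
        rw [norm_mul]
        have hρ : 0 < ρ ^ n := by positivity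
        refine (mul_le_of_le_one_left (norm_nonneg _) (hc n)).trans
          ((hC _ (div_ne_zero hξ hρ.ne')).trans_eq ?_)
        rw [min_comm, abs_div, abs_of_pos hρ, inv_div, mul_inv, inv_inv, div_eq_mul_inv,
          div_eq_mul_inv, mul_comm |ξ|]
    _ ≤ _ := by
        rw [← Finset.mul_sum]
        gcongr
        exact hA S _ (by positivity)

theorem fourierInv_lacunarySymbol {ρ : ℝ} (h : 0 < ρ) (η : 𝓢(ℝ, ℂ)) (S : Finset ℤ) (c : ℤ → ℂ)
    (x : ℝ) : 𝓕⁻ (lacunarySymbol h η S c) x =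
      ∑ n ∈ S, c n * ((ρ ^ n : ℝ) * (𝓕⁻ η : 𝓢(ℝ, ℂ)) (ρ ^ n * x)) := by
  have : 𝓕⁻ (lacunarySymbol h η S c) =
      ∑ n ∈ S, c n • (𝓕⁻ (dilate (scaleUnit h ^ (-n)) η) : 𝓢(ℝ, ℂ)) := by
    simp only [lacunarySymbol, ← FourierTransform.fourierInvCLM_apply (R := ℂ), map_sum, map_smul]
  rw [this]
  simp only [sum_apply, smul_apply, fourierInv_dilate, smul_eq_mul]
  refine Finset.sum_congr rfl fun n _ => ?_
  have hρ : 0 < ρ ^ n := by positivity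
  simp [scaleUnit, abs_of_pos h]

theorem norm_deriv_fourierInv_lacunarySymbol_le {ρ : ℝ} (h : 0 < ρ) {η : 𝓢(ℝ, ℂ)} {C A : ℝ}
    (hC0 : 0 < C)
    (hC : ∀ u, u ≠ 0 → u ^ 2 * ‖deriv (𝓕⁻ η : 𝓢(ℝ, ℂ)) u‖ ≤ C * min |u| |u|⁻¹) (hA0 : 0 < A)
    (hA : ∀ (S : Finset ℤ) (y : ℝ), 0 < y → ∑ n ∈ S, min (ρ ^ n * y) (ρ ^ n * y)⁻¹ ≤ A)
    (S : Finset ℤ) {c : ℤ → ℂ} (hc : ∀ n, ‖c n‖ ≤ 1) (x : ℝ) :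
    ‖deriv (𝓕⁻ (lacunarySymbol h η S c) : 𝓢(ℝ, ℂ)) x‖ * x ^ 2 ≤ C * A := by
  rcases eq_or_ne x 0 with rfl | hx
  · simp only [ne_eq, OfNat.ofNat_ne_zero, not_false_eq_true, zero_pow, mul_zero]
    positivity
  have hd : HasDerivAt (𝓕⁻ (lacunarySymbol h η S c) : 𝓢(ℝ, ℂ))
      (∑ n ∈ S, c n * ((ρ ^ n : ℝ) * (ρ ^ n • deriv (𝓕⁻ η : 𝓢(ℝ, ℂ)) (ρ ^ n * x)))) x := by
    have he : ((𝓕⁻ (lacunarySymbol h η S c) : 𝓢(ℝ, ℂ)) : ℝ → ℂ) = fun x =>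
        ∑ n ∈ S, c n * ((ρ ^ n : ℝ) * (𝓕⁻ η : 𝓢(ℝ, ℂ)) (ρ ^ n * x)) :=
      funext (fourierInv_lacunarySymbol h η S c)
    rw [he]
    refine HasDerivAt.fun_sum fun n _ => HasDerivAt.const_mul _ (HasDerivAt.const_mul _ ?_)
    have h1 := ((𝓕⁻ η : 𝓢(ℝ, ℂ)).differentiable (ρ ^ n * x)).hasDerivAt
    have h2 := h1.scomp x ((hasDerivAt_id x).const_mul (ρ ^ n))
    exact h2.congr_deriv (by simp)
  rw [hd.deriv]
  calc _ ≤ (∑ n ∈ S, ρ ^ n * (ρ ^ n * ‖deriv (𝓕⁻ η : 𝓢(ℝ, ℂ)) (ρ ^ n * x)‖)) * x ^ 2 := by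
        gcongr
        refine norm_sum_le_of_le _ fun n _ => ?_
        have hρ : 0 < ρ ^ n := by positivity
        rw [norm_mul, norm_mul, norm_smul, Complex.norm_real, Real.norm_of_nonneg hρ.le]
        exact mul_le_of_le_one_left (by positivity) (hc n)
    _ = ∑ n ∈ S, (ρ ^ n * x) ^ 2 * ‖deriv (𝓕⁻ η : 𝓢(ℝ, ℂ)) (ρ ^ n * x)‖ := by
        rw [Finset.sum_mul]
        exact Finset.sum_congr rfl fun n _ => by ring
    _ ≤ ∑ n ∈ S, C * min (ρ ^ n * |x|) (ρ ^ n * |x|)⁻¹ := by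
        refine Finset.sum_le_sum fun n _ => ?_
        have hρ : 0 < ρ ^ n := by positivity
        refine (hC _ (mul_ne_zero hρ.ne' hx)).trans_eq ?_
        rw [abs_mul, abs_of_pos hρ]
    _ ≤ _ := by
        rw [← Finset.mul_sum]
        gcongr
        exact hA S _ (by positivity)

theorem exists_lintegral_mult_lacunarySymbol_le {ρ : ℝ} (h : 0 < ρ) (h1 : ρ < 1) {η : 𝓢(ℝ, ℂ)}
    (h0 : η 0 = 0) {p : ℝ} (hp : 1 < p) :
    ∃ C : ℝ≥0∞, C ≠ ∞ ∧ ∀ (S : Finset ℤ) (c : ℤ → ℂ), (∀ n, ‖c n‖ ≤ 1) → ∀ f : 𝓢(ℝ, ℂ),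
      ∫⁻ x, ‖mult (lacunarySymbol h η S c) f x‖ₑ ^ p ≤ C * ∫⁻ x, ‖f x‖ₑ ^ p := by
  obtain ⟨A, hA0, hA⟩ := exists_sum_min_zpow_le h h1
  obtain ⟨C₁, hC₁0, hC₁⟩ := exists_norm_le_min η h0
  obtain ⟨C₂, hC₂0, hC₂⟩ := exists_deriv_le_min (𝓕⁻ η : 𝓢(ℝ, ℂ))
  obtain ⟨C, hC, hmain⟩ := IsCZKernel.exists_lintegral_rpow_le ((C₁ * A) ^ 2) (4 * (C₂ * A))
    (by positivity) hp
  refine ⟨C, hC, fun S c hc f => ?_⟩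
  obtain ⟨R, hR⟩ := schwartz_bounded f
  simp_rw [mult_eq_conv]
  refine hmain _ (isCZKernel_of_schwartz _ (by positivity) (fun ξ => ?_) fun x => ?_) f
    f.continuous.measurable f.integrable R hR
  · rw [FourierTransform.fourier_fourierInv_eq]
    exact norm_lacunarySymbol_le h h0 hC₁0 hC₁ hA0 hA S hc ξ
  · exact norm_deriv_fourierInv_lacunarySymbol_le h hC₂0 hC₂ hA0 hA S hc x

section

variable {ι : Type*} [DecidableEq ι]

/-- The sign `1` on `P` and `-1` off `P`. -/
def sgn (P : Finset ι) (n : ι) : ℝ := if n ∈ P then 1 else -1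

/-- The average of `φ` of the signed sums of `a` over all choices of signs on `S`. -/
noncomputable def signAvg (S : Finset ι) (φ : ℝ → ℝ) (a : ι → ℝ) : ℝ :=
  (2 ^ S.card)⁻¹ * ∑ P ∈ S.powerset, φ (∑ n ∈ S, sgn P n * a n)

theorem signAvg_mono (S : Finset ι) {φ ψ : ℝ → ℝ} (h : ∀ x, φ x ≤ ψ x) (a : ι → ℝ) :
    signAvg S φ a ≤ signAvg S ψ a := by
  unfold signAvg
  gcongr
  exact h _

theorem signAvg_add (S : Finset ι) (φ ψ : ℝ → ℝ) (a : ι → ℝ) :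
    signAvg S (fun x => φ x + ψ x) a = signAvg S φ a + signAvg S ψ a := by
  simp only [signAvg, Finset.sum_add_distrib, mul_add]

theorem signAvg_const_mul (S : Finset ι) (t : ℝ) (φ : ℝ → ℝ) (a : ι → ℝ) :
    signAvg S (fun x => t * φ x) a = t * signAvg S φ a := by
  simp only [signAvg, ← Finset.mul_sum]
  ring

theorem signAvg_const (S : Finset ι) (t : ℝ) (a : ι → ℝ) : signAvg S (fun _ => t) a = t := by
  simp [signAvg, Finset.card_powerset]

theorem signAvg_comp_mul (S : Finset ι) (φ : ℝ → ℝ) (t : ℝ) (a : ι → ℝ) :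
    signAvg S φ (fun n => t * a n) = signAvg S (fun x => φ (t * x)) a := by
  simp only [signAvg, Finset.mul_sum, mul_left_comm t]

theorem signAvg_exp (S : Finset ι) (a : ι → ℝ) : signAvg S exp a = ∏ n ∈ S, cosh (a n) := by
  have h : ∑ P ∈ S.powerset, exp (∑ n ∈ S, sgn P n * a n) =
      ∏ n ∈ S, (exp (a n) + exp (-a n)) := by
    rw [Finset.prod_add]
    refine Finset.sum_congr rfl fun P hP => ?_
    rw [Real.exp_sum, ← Finset.prod_sdiff (Finset.mem_powerset.1 hP), mul_comm]
    congr 1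
    · exact Finset.prod_congr rfl fun n hn => by simp [sgn, hn]
    · refine Finset.prod_congr rfl fun n hn => ?_
      simp [sgn, (Finset.mem_sdiff.1 hn).2]
  simp only [signAvg, h, Real.cosh_eq, Finset.prod_div_distrib, Finset.prod_const]
  ring

theorem signAvg_exp_le (S : Finset ι) (a : ι → ℝ) (h : ∑ n ∈ S, a n ^ 2 = 1) :
    signAvg S exp a ≤ exp (1 / 2) := by
  rw [signAvg_exp, ← h, Finset.sum_div, Real.exp_sum]
  exact Finset.prod_le_prod (fun _ _ => (cosh_pos _).le) fun n _ => cosh_le_exp_half_sq _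

theorem sum_powerset_sq (S : Finset ι) (a : ι → ℝ) :
    ∑ P ∈ S.powerset, (∑ n ∈ S, sgn P n * a n) ^ 2 = 2 ^ S.card * ∑ n ∈ S, a n ^ 2 := by
  induction S using Finset.induction_on with
  | empty => simp
  | insert i S hi ih =>
    rw [Finset.sum_powerset_insert hi, ← Finset.sum_add_distrib, Finset.card_insert_of_notMem hi,
      Finset.sum_insert hi, pow_succ]
    have : ∀ P ∈ S.powerset, (∑ n ∈ insert i S, sgn P n * a n) ^ 2 +
        (∑ n ∈ insert i S, sgn (insert i P) n * a n) ^ 2 =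
        (∑ n ∈ S, sgn P n * a n) ^ 2 * 2 + 2 * a i ^ 2 := by
      intro P hP
      have hiP : i ∉ P := fun h => hi (Finset.mem_powerset.1 hP h)
      have h1 : ∑ n ∈ S, sgn (insert i P) n * a n = ∑ n ∈ S, sgn P n * a n := by
        refine Finset.sum_congr rfl fun n hn => ?_
        have : n ≠ i := fun h => hi (h ▸ hn)
        simp [sgn, this]
      rw [Finset.sum_insert hi, Finset.sum_insert hi, h1]
      simp only [sgn, hiP, Finset.mem_insert_self, if_true, if_false]
      ring
    rw [Finset.sum_congr rfl this, Finset.sum_add_distrib, ← Finset.sum_mul, ih]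
    simp only [Finset.sum_const, Finset.card_powerset, nsmul_eq_mul]
    push_cast
    ring

theorem signAvg_sq (S : Finset ι) (a : ι → ℝ) :
    signAvg S (fun x => x ^ 2) a = ∑ n ∈ S, a n ^ 2 := by
  rw [signAvg, sum_powerset_sq]
  field_simp

theorem abs_rpow_le_exp {p : ℝ} (hp : 0 < p) (x : ℝ) :
    |x| ^ p ≤ p ^ p * (exp x + exp ((-1) * x)) := by
  have h1 : |x| / p ≤ exp (|x| / p) := by linarith [add_one_le_exp (|x| / p)]
  have h2 : (|x| / p) ^ p ≤ exp |x| := by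
    refine (rpow_le_rpow (by positivity) h1 hp.le).trans_eq ?_
    rw [← exp_mul, div_mul_cancel₀ _ hp.ne']
  rw [div_rpow (abs_nonneg _) hp.le, div_le_iff₀' (by positivity)] at h2
  refine h2.trans ?_
  gcongr
  rcases abs_cases x with ⟨h, -⟩ | ⟨h, -⟩ <;> rw [h]
  · linarith [exp_pos (-1 * x)]
  · rw [neg_one_mul]
    linarith [exp_pos x]

theorem signAvg_rpow_le_of_sum_eq_one {p : ℝ} (hp : 0 < p) (S : Finset ι) (a : ι → ℝ)
    (h : ∑ n ∈ S, a n ^ 2 = 1) :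
    signAvg S (fun x => |x| ^ p) a ≤ p ^ p * (2 * exp (1 / 2)) := by
  refine (signAvg_mono S (abs_rpow_le_exp hp) a).trans ?_
  rw [signAvg_const_mul, signAvg_add S exp, ← signAvg_comp_mul]
  have h1 := signAvg_exp_le S a h
  have h2 := signAvg_exp_le S (fun n => (-1) * a n) (by simpa using h)
  gcongr
  linarith

theorem sq_le_of_thresholds {p r s : ℝ} (hr : 0 < r) (hs : 0 < s) (x : ℝ) :
    x ^ 2 ≤ r ^ 2 + ((s ^ (2 - p) + r ^ (2 - p)) * |x| ^ p + s⁻¹ ^ 2 * |x| ^ (4 : ℝ)) := by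
  have e4 : |x| ^ (4 : ℝ) = |x| ^ 4 := by norm_cast
  rw [e4, ← sq_abs]
  have hx := abs_nonneg x
  have hrp := rpow_nonneg hx p
  have hs1 := rpow_pos_of_pos hs (2 - p)
  have hr1 := rpow_pos_of_pos hr (2 - p)
  rcases le_total |x| r with h | h
  · have : |x| ^ 2 ≤ r ^ 2 := by gcongr
    have : 0 ≤ (s ^ (2 - p) + r ^ (2 - p)) * |x| ^ p + s⁻¹ ^ 2 * |x| ^ 4 := by positivity
    linarith
  have hx0 : 0 < |x| := hr.trans_le h
  rcases le_total s |x| with h' | h'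
  · have : |x| ^ 2 ≤ s⁻¹ ^ 2 * |x| ^ 4 := by
      have h3 : 1 ≤ s⁻¹ * |x| := by rw [inv_mul_eq_div]; exact (one_le_div hs).2 h'
      calc |x| ^ 2 = 1 ^ 2 * |x| ^ 2 := by ring
        _ ≤ (s⁻¹ * |x|) ^ 2 * |x| ^ 2 := by gcongr
        _ = _ := by ring
    have : 0 ≤ r ^ 2 + (s ^ (2 - p) + r ^ (2 - p)) * |x| ^ p := by positivity
    linarith
  · have e : |x| ^ 2 = |x| ^ (2 - p) * |x| ^ p := by
      rw [← rpow_add hx0, sub_add_cancel]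
      norm_cast
    have : |x| ^ (2 - p) ≤ s ^ (2 - p) + r ^ (2 - p) := by
      rcases le_total p 2 with hp | hp
      · have := rpow_le_rpow hx h' (sub_nonneg.2 hp)
        linarith
      · have := rpow_le_rpow_of_nonpos hr h (sub_nonpos.2 hp)
        linarith
    have h5 : |x| ^ 2 ≤ (s ^ (2 - p) + r ^ (2 - p)) * |x| ^ p := by
      rw [e]
      gcongr
    have : 0 ≤ r ^ 2 + s⁻¹ ^ 2 * |x| ^ 4 := by positivity
    linarith

theorem exists_le_signAvg_rpow_of_sum_eq_one (p : ℝ) : ∃ K, 0 < K ∧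
    ∀ (S : Finset ι) (a : ι → ℝ), ∑ n ∈ S, a n ^ 2 = 1 →
      1 ≤ K * signAvg S (fun x => |x| ^ p) a := by
  set C : ℝ := 4 ^ (4 : ℝ) * (2 * exp (1 / 2)) with hC
  have hC0 : 0 < C := by positivity
  set s : ℝ := √(4 * C)
  have hs : 0 < s := by positivity
  have hs2 : s ^ 2 = 4 * C := sq_sqrt (by positivity)
  refine ⟨2 * (s ^ (2 - p) + (1 / 2) ^ (2 - p)), by positivity, fun S a h => ?_⟩
  have h1 := signAvg_mono S (sq_le_of_thresholds (p := p) (half_pos one_pos) hs) a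
  rw [signAvg_sq, h, signAvg_add S (fun _ => (1 / 2 : ℝ) ^ 2), signAvg_const, signAvg_add,
    signAvg_const_mul, signAvg_const_mul] at h1
  have h2 := signAvg_rpow_le_of_sum_eq_one (p := 4) (by norm_num) S a h
  have h3 : s⁻¹ ^ 2 * signAvg S (fun x => |x| ^ (4 : ℝ)) a ≤ 1 / 4 := by
    rw [inv_pow, hs2]
    calc _ ≤ (4 * C)⁻¹ * C := by gcongr
      _ = 1 / 4 := by field_simp
  linarith

theorem exists_khintchine_real {p : ℝ} (hp : 0 < p) : ∃ K, 0 < K ∧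
    ∀ (S : Finset ι) (a : ι → ℝ),
      signAvg S (fun x => |x| ^ p) a ≤ K * (∑ n ∈ S, a n ^ 2) ^ (p / 2) ∧
      (∑ n ∈ S, a n ^ 2) ^ (p / 2) ≤ K * signAvg S (fun x => |x| ^ p) a := by
  obtain ⟨K, hK, hlow⟩ := exists_le_signAvg_rpow_of_sum_eq_one (ι := ι) p
  set K' := p ^ p * (2 * exp (1 / 2))
  refine ⟨max K K', by positivity, fun S a => ?_⟩
  have hnn : ∀ b : ι → ℝ, 0 ≤ signAvg S (fun x => |x| ^ p) b := fun b => by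
    unfold signAvg
    positivity
  set σ := √(∑ n ∈ S, a n ^ 2) with hσ
  have hσ2 : σ ^ 2 = ∑ n ∈ S, a n ^ 2 := sq_sqrt (by positivity)
  have hσ0 : 0 ≤ σ := sqrt_nonneg _
  clear_value σ
  rw [← hσ2, ← rpow_natCast, ← rpow_mul (by positivity)]
  simp only [Nat.cast_ofNat, mul_div_cancel₀ p two_ne_zero]
  rcases hσ0.eq_or_lt with h0 | h0
  · rw [← h0, zero_rpow hp.ne', mul_zero]
    refine ⟨?_, mul_nonneg (by positivity) (hnn a)⟩
    rw [← h0, eq_comm] at hσ2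
    have hz : ∀ n ∈ S, a n = 0 := fun n hn => by
      have := (Finset.sum_eq_zero_iff_of_nonneg (fun n _ => sq_nonneg (a n))).1
        (by simpa using hσ2) n hn
      simpa using this
    have : ∀ P : Finset ι, ∑ n ∈ S, sgn P n * a n = 0 := fun P =>
      Finset.sum_eq_zero fun n hn => by rw [hz n hn, mul_zero]
    simp [signAvg, this, zero_rpow hp.ne']
  have hb : ∑ n ∈ S, (σ⁻¹ * a n) ^ 2 = 1 := by
    simp only [mul_pow, ← Finset.mul_sum, ← hσ2]
    field_simp
  have hscale : signAvg S (fun x => |x| ^ p) a =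
      σ ^ p * signAvg S (fun x => |x| ^ p) (fun n => σ⁻¹ * a n) := by
    rw [signAvg_comp_mul, ← signAvg_const_mul]
    congr 1
    ext x
    rw [← abs_of_pos h0, ← mul_rpow (by positivity) (by positivity), ← abs_mul, abs_of_pos h0,
      mul_inv_cancel_left₀ h0.ne']
  have hσp := rpow_pos_of_pos h0 p
  rw [hscale]
  constructor
  · rw [mul_comm]
    gcongr
    exact (signAvg_rpow_le_of_sum_eq_one hp S _ hb).trans (le_max_right _ _)
  · calc σ ^ p = σ ^ p * 1 := (mul_one _).symm
      _ ≤ σ ^ p * (K * signAvg S (fun x => |x| ^ p) (fun n => σ⁻¹ * a n)) := by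
        gcongr
        exact hlow S _ hb
      _ ≤ σ ^ p * (max K K' * signAvg S (fun x => |x| ^ p) (fun n => σ⁻¹ * a n)) := by
        gcongr
        · exact hnn _
        · exact le_max_left _ _
      _ = _ := by ring

/-- The signed sum of `a` over `S` with sign pattern `P`. -/
noncomputable def signSum (S P : Finset ι) (a : ι → ℂ) : ℂ := ∑ n ∈ S, (sgn P n : ℂ) * a n

/-- The mean of the `p`-th powers of the signed sums of `a` over `S`. -/
noncomputable def signMean (S : Finset ι) (p : ℝ) (a : ι → ℂ) : ℝ≥0∞ :=
  (2 ^ S.card)⁻¹ * ∑ P ∈ S.powerset, ‖signSum S P a‖ₑ ^ p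

theorem add_rpow_le_two_rpow_mul {p : ℝ} (hp : 0 < p) {u v : ℝ} (hu : 0 ≤ u) (hv : 0 ≤ v) :
    (u + v) ^ p ≤ 2 ^ p * (u ^ p + v ^ p) := by
  have hup := rpow_nonneg hu p
  have hvp := rpow_nonneg hv p
  rcases le_total u v with h | h
  · calc (u + v) ^ p ≤ (2 * v) ^ p := by gcongr; linarith
      _ = 2 ^ p * v ^ p := mul_rpow (by norm_num) hv
      _ ≤ _ := by gcongr; linarith
  · calc (u + v) ^ p ≤ (2 * u) ^ p := by gcongr; linarith
      _ = 2 ^ p * u ^ p := mul_rpow (by norm_num) hu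
      _ ≤ _ := by gcongr; linarith

theorem signMean_eq (S : Finset ι) {p : ℝ} (hp : 0 < p) (a : ι → ℂ) :
    signMean S p a =
      ENNReal.ofReal ((2 ^ S.card)⁻¹ * ∑ P ∈ S.powerset, ‖signSum S P a‖ ^ p) := by
  rw [ENNReal.ofReal_mul (by positivity), ENNReal.ofReal_inv_of_pos (by positivity),
    ENNReal.ofReal_pow (by norm_num), ENNReal.ofReal_sum_of_nonneg fun _ _ => by positivity]
  simp only [signMean, ← ENNReal.ofReal_rpow_of_nonneg (norm_nonneg _) hp.le, ofReal_norm,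
    ENNReal.ofReal_ofNat]

theorem signSum_re (S P : Finset ι) (a : ι → ℂ) :
    (signSum S P a).re = ∑ n ∈ S, sgn P n * (a n).re := by
  simp [signSum]

theorem signSum_im (S P : Finset ι) (a : ι → ℂ) :
    (signSum S P a).im = ∑ n ∈ S, sgn P n * (a n).im := by
  simp [signSum]

variable (ι) in
theorem exists_khintchine {p : ℝ} (hp : 0 < p) : ∃ K : ℝ≥0∞, K ≠ ∞ ∧
    ∀ (S : Finset ι) (a : ι → ℂ),
      signMean S p a ≤ K * (∑ n ∈ S, ‖a n‖ₑ ^ 2) ^ (p / 2) ∧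
      (∑ n ∈ S, ‖a n‖ₑ ^ 2) ^ (p / 2) ≤ K * signMean S p a := by
  obtain ⟨K, hK, hKh⟩ := exists_khintchine_real (ι := ι) hp
  refine ⟨ENNReal.ofReal (2 ^ p * (2 * K)), ENNReal.ofReal_ne_top, fun S a => ?_⟩
  have hsum : (∑ n ∈ S, ‖a n‖ₑ ^ 2) ^ (p / 2) =
      ENNReal.ofReal ((∑ n ∈ S, ((a n).re ^ 2 + (a n).im ^ 2)) ^ (p / 2)) := by
    rw [← ENNReal.ofReal_rpow_of_nonneg (by positivity) (by positivity),
      ENNReal.ofReal_sum_of_nonneg fun _ _ => by positivity]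
    congr 2
    ext n
    rw [← ofReal_norm, ← ENNReal.ofReal_pow (norm_nonneg _), ← Complex.normSq_eq_norm_sq,
      Complex.normSq_apply]
    ring_nf
  rw [signMean_eq S hp, hsum, ← ENNReal.ofReal_mul (by positivity),
    ← ENNReal.ofReal_mul (by positivity), Finset.sum_add_distrib]
  set X := ∑ n ∈ S, (a n).re ^ 2
  set Y := ∑ n ∈ S, (a n).im ^ 2
  have hX0 : 0 ≤ X := by positivity
  have hY0 : 0 ≤ Y := by positivity
  obtain ⟨hX1, hX2⟩ := hKh S fun n => (a n).re
  obtain ⟨hY1, hY2⟩ := hKh S fun n => (a n).im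
  set M := ((2 ^ S.card)⁻¹ * ∑ P ∈ S.powerset, ‖signSum S P a‖ ^ p : ℝ) with hM
  have hre : signAvg S (fun x => |x| ^ p) (fun n => (a n).re) ≤ M := by
    simp only [signAvg, ← signSum_re, hM]
    gcongr
    exact Complex.abs_re_le_norm _
  have him : signAvg S (fun x => |x| ^ p) (fun n => (a n).im) ≤ M := by
    simp only [signAvg, ← signSum_im, hM]
    gcongr
    exact Complex.abs_im_le_norm _
  have hle : M ≤ 2 ^ p * (signAvg S (fun x => |x| ^ p) (fun n => (a n).re) +
      signAvg S (fun x => |x| ^ p) (fun n => (a n).im)) := by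
    simp only [signAvg, ← signSum_im, ← signSum_re, hM]
    rw [← mul_add, ← Finset.sum_add_distrib, mul_left_comm (2 ^ p), Finset.mul_sum (a := 2 ^ p)]
    gcongr with P hP
    exact (rpow_le_rpow (norm_nonneg _) (Complex.norm_le_abs_re_add_abs_im _) hp.le).trans
      (add_rpow_le_two_rpow_mul hp (abs_nonneg _) (abs_nonneg _))
  have hXle : X ^ (p / 2) ≤ (X + Y) ^ (p / 2) := by gcongr; linarith
  have hYle : Y ^ (p / 2) ≤ (X + Y) ^ (p / 2) := by gcongr; linarith
  constructor
  · refine ENNReal.ofReal_le_ofReal (hle.trans ?_)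
    rw [mul_assoc]
    gcongr
    calc _ ≤ K * X ^ (p / 2) + K * Y ^ (p / 2) := add_le_add hX1 hY1
      _ ≤ K * (X + Y) ^ (p / 2) + K * (X + Y) ^ (p / 2) := by gcongr
      _ = _ := by ring
  · refine ENNReal.ofReal_le_ofReal ?_
    have h2 : (2 : ℝ) ^ (p / 2) ≤ 2 ^ p :=
      rpow_le_rpow_of_exponent_le (by norm_num) (by linarith)
    have hM0 : 0 ≤ M := by positivity
    calc (X + Y) ^ (p / 2) ≤ 2 ^ (p / 2) * (X ^ (p / 2) + Y ^ (p / 2)) :=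
          add_rpow_le_two_rpow_mul (by positivity) hX0 hY0
      _ ≤ 2 ^ p * (K * M + K * M) := by
          gcongr
          · exact hX2.trans (by gcongr)
          · exact hY2.trans (by gcongr)
      _ = _ := by ring

theorem measurable_signSum {S P : Finset ι} {F : ι → ℝ → ℂ} (hF : ∀ n, Measurable (F n)) :
    Measurable fun x => signSum S P fun n => F n x := by
  unfold signSum
  fun_prop

theorem lintegral_signMean (S : Finset ι) (p : ℝ) {F : ι → ℝ → ℂ} (hF : ∀ n, Measurable (F n)) :
    ∫⁻ x, signMean S p (fun n => F n x) =
      (2 ^ S.card)⁻¹ * ∑ P ∈ S.powerset, ∫⁻ x, ‖signSum S P fun n => F n x‖ₑ ^ p := by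
  have hm : ∀ P, Measurable fun x => ‖signSum S P fun n => F n x‖ₑ ^ p := fun P =>
    (measurable_signSum hF).enorm.pow_const p
  simp only [signMean]
  rw [lintegral_const_mul _ (Finset.measurable_fun_sum _ fun P _ => hm P),
    lintegral_finsetSum _ fun P _ => hm P]

variable (ι) in
theorem exists_lintegral_sq_le_of_signSum {p : ℝ} (hp : 0 < p) : ∃ K : ℝ≥0∞, K ≠ ∞ ∧
    ∀ (S : Finset ι) (F : ι → ℝ → ℂ), (∀ n, Measurable (F n)) → ∀ C : ℝ≥0∞,
      (∀ P : Finset ι, ∫⁻ x, ‖signSum S P fun n => F n x‖ₑ ^ p ≤ C) →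
      ∫⁻ x, (∑ n ∈ S, ‖F n x‖ₑ ^ 2) ^ (p / 2) ≤ K * C := by
  obtain ⟨K, hK, hKh⟩ := exists_khintchine ι hp
  refine ⟨K, hK, fun S F hF C hC => ?_⟩
  refine (lintegral_mono fun x => (hKh S fun n => F n x).2).trans ?_
  rw [lintegral_const_mul' _ _ hK, lintegral_signMean S p hF]
  gcongr
  rw [ENNReal.inv_mul_le_iff (by simp) (by simp)]
  refine (Finset.sum_le_sum fun P _ => hC P).trans_eq ?_
  simp [Finset.card_powerset]

variable (ι) in
theorem exists_lintegral_sq_le_lintegral_sq {p : ℝ} (hp : 0 < p) : ∃ K : ℝ≥0∞, K ≠ ∞ ∧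
    ∀ (S : Finset ι) (F H : ι → ℝ → ℂ), (∀ n, Measurable (F n)) → (∀ n, Measurable (H n)) →
      ∀ C : ℝ≥0∞, C ≠ ∞ →
      (∀ P : Finset ι, ∫⁻ x, ‖signSum S P fun n => F n x‖ₑ ^ p ≤
        C * ∫⁻ x, ‖signSum S P fun n => H n x‖ₑ ^ p) →
      ∫⁻ x, (∑ n ∈ S, ‖F n x‖ₑ ^ 2) ^ (p / 2) ≤
        K * C * ∫⁻ x, (∑ n ∈ S, ‖H n x‖ₑ ^ 2) ^ (p / 2) := by
  obtain ⟨K, hK, hKh⟩ := exists_khintchine ι hp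
  refine ⟨K * K, ENNReal.mul_ne_top hK hK, fun S F H hF hH C hCt hC => ?_⟩
  calc _ ≤ ∫⁻ x, K * signMean S p fun n => F n x :=
        lintegral_mono fun x => (hKh S fun n => F n x).2
    _ = K * ((2 ^ S.card)⁻¹ * ∑ P ∈ S.powerset, ∫⁻ x, ‖signSum S P fun n => F n x‖ₑ ^ p) := by
        rw [lintegral_const_mul' _ _ hK, lintegral_signMean S p hF]
    _ ≤ K * ((2 ^ S.card)⁻¹ *
          ∑ P ∈ S.powerset, C * ∫⁻ x, ‖signSum S P fun n => H n x‖ₑ ^ p) := by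
        gcongr with P hP
        exact hC P
    _ = K * C * ∫⁻ x, signMean S p fun n => H n x := by
        rw [lintegral_signMean S p hH, ← Finset.mul_sum]
        ring
    _ ≤ K * C * ∫⁻ x, K * (∑ n ∈ S, ‖H n x‖ₑ ^ 2) ^ (p / 2) := by
        gcongr with x
        exact (hKh S fun n => H n x).1
    _ = _ := by
        rw [lintegral_const_mul' _ _ hK]
        ring

end

theorem mult_eq_integral (m : ℝ → ℂ) (f : 𝓢(ℝ, ℂ)) (x : ℝ) :
    mult m f x = ∫ ξ, Complex.exp (((2 * π * (ξ * x) : ℝ) : ℂ) * Complex.I) * (m ξ * 𝓕 f ξ) := by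
  rw [mult, Real.fourierInv_eq']
  simp [mul_comm x]

structure IsSymbol (m : ℝ → ℂ) : Prop where
  measurable : Measurable m
  bounded : ∃ R, ∀ ξ, ‖m ξ‖ ≤ R

theorem IsSymbol.of_schwartz (η : 𝓢(ℝ, ℂ)) : IsSymbol η :=
  ⟨η.continuous.measurable, schwartz_bounded η⟩

theorem IsSymbol.indicator {s : Set ℝ} (hs : MeasurableSet s) : IsSymbol (s.indicator 1) :=
  ⟨measurable_one.indicator hs, 1, fun ξ => by
    rw [norm_indicator_eq_indicator_norm]
    exact indicator_le_self' (fun _ _ => norm_nonneg _) ξ |>.trans (by simp)⟩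

theorem IsSymbol.mul {m₁ m₂ : ℝ → ℂ} (h₁ : IsSymbol m₁) (h₂ : IsSymbol m₂) :
    IsSymbol fun ξ => m₁ ξ * m₂ ξ := by
  obtain ⟨R₁, hR₁⟩ := h₁.bounded
  obtain ⟨R₂, hR₂⟩ := h₂.bounded
  refine ⟨h₁.measurable.mul h₂.measurable, R₁ * R₂, fun ξ => ?_⟩
  rw [norm_mul]
  exact mul_le_mul (hR₁ ξ) (hR₂ ξ) (norm_nonneg _) ((norm_nonneg _).trans (hR₁ ξ))

theorem norm_exp_I_mul (t : ℝ) (z : ℂ) : ‖Complex.exp ((t : ℂ) * Complex.I) * z‖ = ‖z‖ := by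
  rw [norm_mul, Complex.norm_exp_ofReal_mul_I, one_mul]

theorem IsSymbol.integrable_mul {m : ℝ → ℂ} (h : IsSymbol m) (f : 𝓢(ℝ, ℂ)) :
    Integrable fun ξ => m ξ * 𝓕 f ξ := by
  obtain ⟨R, hR⟩ := h.bounded
  exact (𝓕 f : 𝓢(ℝ, ℂ)).integrable.bdd_mul h.measurable.aestronglyMeasurable
    (Filter.Eventually.of_forall hR)

theorem IsSymbol.integrable {m : ℝ → ℂ} (h : IsSymbol m) (f : 𝓢(ℝ, ℂ)) (x : ℝ) :
    Integrable fun ξ =>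
      Complex.exp (((2 * π * (ξ * x) : ℝ) : ℂ) * Complex.I) * (m ξ * 𝓕 f ξ) :=
  (h.integrable_mul f).mono
    (AEStronglyMeasurable.mul (by fun_prop) (h.integrable_mul f).1)
    (Filter.Eventually.of_forall fun ξ => (norm_exp_I_mul _ _).le)

theorem IsSymbol.continuous_mult {m : ℝ → ℂ} (h : IsSymbol m) (f : 𝓢(ℝ, ℂ)) :
    Continuous (mult m f) := by
  have : mult m f = fun x => ∫ ξ,
      Complex.exp (((2 * π * (ξ * x) : ℝ) : ℂ) * Complex.I) * (m ξ * 𝓕 f ξ) :=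
    funext (mult_eq_integral m f)
  rw [this]
  refine continuous_of_dominated (fun x => (h.integrable f x).1)
    (fun x => Filter.Eventually.of_forall fun ξ => (norm_exp_I_mul _ _).le)
    (h.integrable_mul f).norm (Filter.Eventually.of_forall fun ξ => by fun_prop)

theorem IsSymbol.measurable_mult {m : ℝ → ℂ} (h : IsSymbol m) (f : 𝓢(ℝ, ℂ)) :
    Measurable (mult m f) :=
  (h.continuous_mult f).measurable

theorem mult_congr_ae {m₁ m₂ : ℝ → ℂ} (h : m₁ =ᵐ[volume] m₂) (f : 𝓢(ℝ, ℂ)) (x : ℝ) :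
    mult m₁ f x = mult m₂ f x := by
  rw [mult_eq_integral, mult_eq_integral]
  refine integral_congr_ae ?_
  filter_upwards [h] with ξ hξ
  rw [hξ]

theorem mult_add {m₁ m₂ : ℝ → ℂ} (h₁ : IsSymbol m₁) (h₂ : IsSymbol m₂) (f : 𝓢(ℝ, ℂ)) (x : ℝ) :
    mult (fun ξ => m₁ ξ + m₂ ξ) f x = mult m₁ f x + mult m₂ f x := by
  simp only [mult_eq_integral]
  rw [← integral_add (h₁.integrable f x) (h₂.integrable f x)]
  simp only [add_mul, mul_add]

theorem mult_sub {m₁ m₂ : ℝ → ℂ} (h₁ : IsSymbol m₁) (h₂ : IsSymbol m₂) (f : 𝓢(ℝ, ℂ)) (x : ℝ) :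
    mult (fun ξ => m₁ ξ - m₂ ξ) f x = mult m₁ f x - mult m₂ f x := by
  simp only [mult_eq_integral]
  rw [← integral_sub (h₁.integrable f x) (h₂.integrable f x)]
  simp only [sub_mul, mul_sub]

theorem mult_symbol_sum {ι : Type*} (S : Finset ι) (c : ι → ℂ) {m : ι → ℝ → ℂ}
    (h : ∀ n, IsSymbol (m n)) (f : 𝓢(ℝ, ℂ)) (x : ℝ) :
    mult (fun ξ => ∑ n ∈ S, c n * m n ξ) f x = ∑ n ∈ S, c n * mult (m n) f x := by
  simp only [mult_eq_integral, ← integral_const_mul]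
  rw [← integral_finsetSum _ fun n _ => ((h n).integrable f x).const_mul (c n)]
  refine integral_congr_ae (Filter.Eventually.of_forall fun ξ => ?_)
  simp only [Finset.sum_mul, Finset.mul_sum]
  exact Finset.sum_congr rfl fun n _ => by ring

theorem fourier_sum {ι : Type*} (S : Finset ι) (c : ι → ℂ) (f : ι → 𝓢(ℝ, ℂ)) (ξ : ℝ) :
    𝓕 (∑ n ∈ S, c n • f n) ξ = ∑ n ∈ S, c n * 𝓕 (f n) ξ := by
  have : 𝓕 (∑ n ∈ S, c n • f n) = ∑ n ∈ S, c n • 𝓕 (f n) := by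
    simp only [← FourierTransform.fourierCLM_apply (R := ℂ), map_sum, map_smul]
  rw [this]
  simp [sum_apply]

theorem mult_sum {ι : Type*} (S : Finset ι) (c : ι → ℂ) {m : ℝ → ℂ} (h : IsSymbol m)
    (f : ι → 𝓢(ℝ, ℂ)) (x : ℝ) :
    mult m (∑ n ∈ S, c n • f n) x = ∑ n ∈ S, c n * mult m (f n) x := by
  simp only [mult_eq_integral, ← integral_const_mul, fourier_sum]
  rw [← integral_finsetSum _ fun n _ => (h.integrable (f n) x).const_mul (c n)]
  refine integral_congr_ae (Filter.Eventually.of_forall fun ξ => ?_)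
  simp only [Finset.mul_sum]
  exact Finset.sum_congr rfl fun n _ => by ring

noncomputable def schwartzMult (η f : 𝓢(ℝ, ℂ)) : 𝓢(ℝ, ℂ) :=
  𝓕⁻ (SchwartzMap.pairing (ContinuousLinearMap.mul ℂ ℂ) η (𝓕 f))

theorem fourier_schwartzMult (η f : 𝓢(ℝ, ℂ)) (ξ : ℝ) :
    𝓕 (schwartzMult η f) ξ = η ξ * 𝓕 f ξ := by
  rw [schwartzMult, FourierTransform.fourier_fourierInv_eq, SchwartzMap.pairing_apply_apply,
    ContinuousLinearMap.mul_apply']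

theorem schwartzMult_apply (η f : 𝓢(ℝ, ℂ)) (x : ℝ) : schwartzMult η f x = mult η f x := by
  rw [schwartzMult, SchwartzMap.fourierInv_coe, mult]
  refine congrArg (fun u : ℝ → ℂ => 𝓕⁻ u x) (funext fun ξ => ?_)
  rw [SchwartzMap.pairing_apply_apply, ContinuousLinearMap.mul_apply']

theorem mult_schwartzMult (m : ℝ → ℂ) (η f : 𝓢(ℝ, ℂ)) (x : ℝ) :
    mult m (schwartzMult η f) x = mult (fun ξ => m ξ * η ξ) f x := by
  simp only [mult, fourier_schwartzMult, mul_assoc]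

theorem tendsto_mult {m : ℝ → ℂ} {M : ℕ → ℝ → ℂ} {R : ℝ} (hM : ∀ N, Measurable (M N))
    (hR : ∀ N ξ, ‖M N ξ‖ ≤ R)
    (hlim : ∀ ξ, Filter.Tendsto (fun N => M N ξ) Filter.atTop (𝓝 (m ξ))) (f : 𝓢(ℝ, ℂ)) (x : ℝ) :
    Filter.Tendsto (fun N => mult (M N) f x) Filter.atTop (𝓝 (mult m f x)) := by
  have hs : ∀ N, IsSymbol (M N) := fun N => ⟨hM N, R, hR N⟩
  simp only [mult_eq_integral]
  refine tendsto_integral_of_dominated_convergence (fun ξ => R * ‖𝓕 f ξ‖)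
    (fun N => ((hs N).integrable f x).1) ((𝓕 f : 𝓢(ℝ, ℂ)).integrable.norm.const_mul R)
    (fun N => Filter.Eventually.of_forall fun ξ => ?_)
    (Filter.Eventually.of_forall fun ξ => ((hlim ξ).mul_const _).const_mul _)
  rw [norm_exp_I_mul, norm_mul]
  gcongr
  exact hR N ξ

theorem lintegral_mult_le_of_tendsto {m : ℝ → ℂ} {M : ℕ → ℝ → ℂ} {R p : ℝ}
    (hM : ∀ N, Measurable (M N)) (hR : ∀ N ξ, ‖M N ξ‖ ≤ R)
    (hlim : ∀ ξ, Filter.Tendsto (fun N => M N ξ) Filter.atTop (𝓝 (m ξ))) (f : 𝓢(ℝ, ℂ))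
    {C : ℝ≥0∞} (hC : ∀ N, ∫⁻ x, ‖mult (M N) f x‖ₑ ^ p ≤ C) : ∫⁻ x, ‖mult m f x‖ₑ ^ p ≤ C := by
  have hs : ∀ N, IsSymbol (M N) := fun N => ⟨hM N, R, hR N⟩
  have hl : ∀ x, ‖mult m f x‖ₑ ^ p =
      Filter.liminf (fun N => ‖mult (M N) f x‖ₑ ^ p) Filter.atTop := fun x =>
    ((tendsto_mult hM hR hlim f x).enorm.ennrpow_const p).liminf_eq.symm
  simp only [hl]
  refine (lintegral_liminf_le fun N => ((hs N).measurable_mult f).enorm.pow_const p).trans ?_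
  exact (Filter.liminf_le_liminf (Filter.Eventually.of_forall hC)).trans_eq
    (Filter.liminf_const C)

noncomputable def riserDiff (ξ : ℝ) : ℝ := smoothTransition (ξ - 1) - smoothTransition (ξ / 2 - 1)

theorem contDiff_riserDiff {n : ℕ∞} : ContDiff ℝ n riserDiff := by
  unfold riserDiff
  exact (smoothTransition.contDiff.comp (by fun_prop)).sub
    (smoothTransition.contDiff.comp (by fun_prop))

theorem riserDiff_of_le {ξ : ℝ} (h : ξ ≤ 1) : riserDiff ξ = 0 := by
  rw [riserDiff, smoothTransition.zero_of_nonpos (by linarith),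
    smoothTransition.zero_of_nonpos (by linarith), sub_zero]

theorem riserDiff_of_ge {ξ : ℝ} (h : 4 ≤ ξ) : riserDiff ξ = 0 := by
  rw [riserDiff, smoothTransition.one_of_one_le (by linarith),
    smoothTransition.one_of_one_le (by linarith), sub_self]

theorem exists_schwartz_of_support {φ : ℝ → ℝ} (hφ : ContDiff ℝ (⊤ : ℕ∞) φ) {a b : ℝ}
    (h : ∀ ξ, ξ ∉ Icc a b → φ ξ = 0) : ∃ η : 𝓢(ℝ, ℂ), ∀ ξ, η ξ = φ ξ := by
  have h1 : HasCompactSupport fun ξ => (φ ξ : ℂ) :=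
    HasCompactSupport.intro isCompact_Icc fun ξ hξ => by rw [h ξ hξ, Complex.ofReal_zero]
  exact ⟨h1.toSchwartzMap (Complex.ofRealCLM.contDiff.comp hφ), fun ξ => rfl⟩

def symmRange (N : ℕ) : Finset ℤ :=
  (Finset.range (2 * N)).map (Nat.castEmbedding.trans (Equiv.subRight (N : ℤ)).toEmbedding)

theorem sum_riserDiff (N : ℕ) (ξ : ℝ) :
    ∑ n ∈ symmRange N, riserDiff (ξ / (1 / 2) ^ n) =
      smoothTransition (2 ^ N * ξ / 2 - 1) - smoothTransition (ξ / 2 ^ N / 2 - 1) := by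
  rw [symmRange, Finset.sum_map]
  have h : ∀ j : ℕ, riserDiff (ξ / (1 / 2) ^ ((j : ℤ) - N)) =
      smoothTransition (2 ^ (j + 1) * ξ / 2 ^ N / 2 - 1) -
        smoothTransition (2 ^ j * ξ / 2 ^ N / 2 - 1) := by
    intro j
    have : ξ / (1 / 2) ^ ((j : ℤ) - N) = 2 ^ j * ξ / 2 ^ N := by
      rw [zpow_sub₀ (by norm_num), zpow_natCast, zpow_natCast]
      rw [one_div_pow, one_div_pow]
      field_simp
    rw [riserDiff, this, pow_succ]
    ring_nf
  simp only [Function.Embedding.trans_apply, Nat.castEmbedding_apply, Equiv.coe_toEmbedding,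
    Equiv.subRight_apply, h]
  rw [Finset.sum_range_sub fun j : ℕ => smoothTransition (2 ^ j * ξ / 2 ^ N / 2 - 1)]
  congr 2
  · rw [two_mul, pow_add]
    field_simp
  · rw [pow_zero, one_mul]

theorem tendsto_sum_riserDiff (ξ : ℝ) :
    Filter.Tendsto (fun N => ∑ n ∈ symmRange N, riserDiff (ξ / (1 / 2) ^ n)) Filter.atTop
      (𝓝 ((Ioi 0).indicator 1 ξ)) := by
  simp only [sum_riserDiff]
  rcases le_or_gt ξ 0 with h | h
  · rw [indicator_of_notMem (by simpa using h)]
    refine tendsto_const_nhds.congr fun N => ?_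
    have h1 : 2 ^ N * ξ ≤ 0 := mul_nonpos_of_nonneg_of_nonpos (by positivity) h
    have h2 : ξ / 2 ^ N ≤ 0 := div_nonpos_of_nonpos_of_nonneg h (by positivity)
    rw [smoothTransition.zero_of_nonpos (by linarith),
      smoothTransition.zero_of_nonpos (by linarith), sub_zero]
  · rw [indicator_of_mem (by exact h)]
    have hp : Filter.Tendsto (fun N : ℕ => (2 : ℝ) ^ N) Filter.atTop Filter.atTop :=
      tendsto_pow_atTop_atTop_of_one_lt one_lt_two
    refine tendsto_const_nhds.congr' ?_
    filter_upwards [hp.eventually_ge_atTop (4 / ξ), hp.eventually_ge_atTop ξ] with N h4 hξ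
    rw [div_le_iff₀ h] at h4
    have : ξ / 2 ^ N ≤ 1 := (div_le_one (by positivity)).2 hξ
    rw [smoothTransition.one_of_one_le (by linarith),
      smoothTransition.zero_of_nonpos (by linarith), sub_zero, Pi.one_apply]

theorem exists_lintegral_halfLine_le {p : ℝ} (hp : 1 < p) : ∃ C : ℝ≥0∞, C ≠ ∞ ∧
    ∀ f : 𝓢(ℝ, ℂ), ∫⁻ x, ‖mult ((Ioi 0).indicator 1) f x‖ₑ ^ p ≤ C * ∫⁻ x, ‖f x‖ₑ ^ p := by
  obtain ⟨η, hη⟩ := exists_schwartz_of_support contDiff_riserDiff (a := 1) (b := 4) fun ξ hξ => by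
    rw [mem_Icc, not_and_or, not_le, not_le] at hξ
    rcases hξ with h | h
    exacts [riserDiff_of_le h.le, riserDiff_of_ge h.le]
  have hh : (0 : ℝ) < 1 / 2 := by norm_num
  obtain ⟨C, hC, hmain⟩ := exists_lintegral_mult_lacunarySymbol_le hh (by norm_num)
    (η := η) (by rw [hη, riserDiff_of_le zero_le_one, Complex.ofReal_zero]) hp
  have heq : ∀ N ξ, lacunarySymbol hh η (symmRange N) (fun _ => 1) ξ =
      ((∑ n ∈ symmRange N, riserDiff (ξ / (1 / 2) ^ n) : ℝ) : ℂ) := fun N ξ => by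
    simp [lacunarySymbol_apply, hη]
  refine ⟨C, hC, fun f => lintegral_mult_le_of_tendsto (R := 1)
    (fun N => (lacunarySymbol hh η (symmRange N) fun _ => 1).continuous.measurable)
    (fun N ξ => ?_) (fun ξ => ?_) f fun N => hmain (symmRange N) (fun _ => 1) (by simp) f⟩
  · rw [heq, Complex.norm_real, sum_riserDiff, Real.norm_eq_abs, abs_le]
    constructor <;> linarith [smoothTransition.nonneg (2 ^ N * ξ / 2 - 1),
      smoothTransition.le_one (2 ^ N * ξ / 2 - 1), smoothTransition.nonneg (ξ / 2 ^ N / 2 - 1),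
      smoothTransition.le_one (ξ / 2 ^ N / 2 - 1)]
  · simp only [heq]
    convert (Complex.continuous_ofReal.tendsto _).comp (tendsto_sum_riserDiff ξ) using 2
    · rfl
    · by_cases h : 0 < ξ <;> simp [h]

/-- The modulation of `f` whose Fourier transform is `𝓕 f (ξ + α)`. -/
noncomputable def modulate (α : ℝ) (f : 𝓢(ℝ, ℂ)) : 𝓢(ℝ, ℂ) :=
  𝓕⁻ (SchwartzMap.compSubConstCLM ℂ (-α) (𝓕 f))

theorem fourier_modulate (α : ℝ) (f : 𝓢(ℝ, ℂ)) (ξ : ℝ) : 𝓕 (modulate α f) ξ = 𝓕 f (ξ + α) := by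
  rw [modulate, FourierTransform.fourier_fourierInv_eq, SchwartzMap.compSubConstCLM_apply,
    sub_neg_eq_add]

theorem norm_mult_modulate (m : ℝ → ℂ) (α : ℝ) (f : 𝓢(ℝ, ℂ)) (x : ℝ) :
    ‖mult (fun ξ => m (ξ + α)) (modulate α f) x‖ = ‖mult m f x‖ := by
  have h : mult (fun ξ => m (ξ + α)) (modulate α f) x =
      Complex.exp (((-(2 * π * (α * x)) : ℝ) : ℂ) * Complex.I) * mult m f x := by
    simp only [mult_eq_integral, fourier_modulate, ← integral_const_mul]
    rw [← integral_add_right_eq_self (fun ξ => _ * (_ * (m ξ * 𝓕 f ξ))) α]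
    refine integral_congr_ae (Filter.Eventually.of_forall fun ξ => ?_)
    simp only
    rw [← mul_assoc (Complex.exp _) (Complex.exp _), ← Complex.exp_add]
    congr 2
    push_cast
    ring
  rw [h, norm_exp_I_mul]

theorem mult_one (f : 𝓢(ℝ, ℂ)) (x : ℝ) : mult (fun _ => 1) f x = f x := by
  simp only [mult, one_mul]
  rw [← SchwartzMap.fourierInv_coe, FourierTransform.fourierInv_fourier_eq]

theorem norm_modulate (α : ℝ) (f : 𝓢(ℝ, ℂ)) (x : ℝ) : ‖modulate α f x‖ = ‖f x‖ := by
  rw [← mult_one, ← mult_one f]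
  exact norm_mult_modulate (fun _ => 1) α f x

theorem enorm_mult_Ioi (α : ℝ) (f : 𝓢(ℝ, ℂ)) (x : ℝ) :
    ‖mult ((Ioi α).indicator 1) f x‖ₑ = ‖mult ((Ioi 0).indicator 1) (modulate α f) x‖ₑ := by
  have : ((Ioi 0).indicator 1 : ℝ → ℂ) = fun ξ => (Ioi α).indicator 1 (ξ + α) := by
    ext ξ
    simp [indicator]
  rw [this, ← ofReal_norm, ← ofReal_norm, norm_mult_modulate]

theorem isSymbol_Ioi (α : ℝ) : IsSymbol ((Ioi α).indicator 1) := .indicator measurableSet_Ioi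

section

variable (ι : Type*) [DecidableEq ι]

theorem exists_lintegral_sum_Ioi_le {p : ℝ} (hp : 1 < p) : ∃ C : ℝ≥0∞, C ≠ ∞ ∧
    ∀ (S : Finset ι) (α : ι → ℝ) (f : ι → 𝓢(ℝ, ℂ)),
      ∫⁻ x, (∑ n ∈ S, ‖mult ((Ioi (α n)).indicator 1) (f n) x‖ₑ ^ 2) ^ (p / 2) ≤
        C * ∫⁻ x, (∑ n ∈ S, ‖f n x‖ₑ ^ 2) ^ (p / 2) := by
  obtain ⟨K, hK, hKh⟩ := exists_lintegral_sq_le_lintegral_sq ι (one_pos.trans hp)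
  obtain ⟨C, hC, hCh⟩ := exists_lintegral_halfLine_le hp
  refine ⟨K * C, ENNReal.mul_ne_top hK hC, fun S α f => ?_⟩
  have hf : ∀ n x, ‖f n x‖ₑ = ‖modulate (α n) (f n) x‖ₑ := fun n x => by
    rw [← ofReal_norm, ← ofReal_norm, norm_modulate]
  have hF : ∀ n x, ‖mult ((Ioi (α n)).indicator 1) (f n) x‖ₑ =
      ‖mult ((Ioi 0).indicator 1) (modulate (α n) (f n)) x‖ₑ := fun n => enorm_mult_Ioi _ _
  simp_rw [hF, hf]
  refine hKh S _ _ (fun n => (isSymbol_Ioi 0).measurable_mult _)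
    (fun n => (modulate (α n) (f n)).continuous.measurable) C hC fun P => ?_
  have := hCh (∑ n ∈ S, (sgn P n : ℂ) • modulate (α n) (f n))
  simp only [mult_sum S _ (isSymbol_Ioi 0), sum_apply, smul_apply, smul_eq_mul] at this
  exact this

theorem sum_enorm_sub_rpow_le {κ : Type*} (S : Finset κ) {q : ℝ} (hq : 0 ≤ q) (u v : κ → ℂ) :
    (∑ n ∈ S, ‖u n - v n‖ₑ ^ 2) ^ q ≤
      4 ^ q * ((∑ n ∈ S, ‖u n‖ₑ ^ 2) ^ q + (∑ n ∈ S, ‖v n‖ₑ ^ 2) ^ q) := by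
  set A := ∑ n ∈ S, ‖u n‖ₑ ^ 2
  set B := ∑ n ∈ S, ‖v n‖ₑ ^ 2
  have h : ∑ n ∈ S, ‖u n - v n‖ₑ ^ 2 ≤ 2 * (A + B) := by
    rw [← Finset.sum_add_distrib, Finset.mul_sum]
    gcongr with n
    have h1 : ‖u n - v n‖ ^ 2 ≤ 2 * (‖u n‖ ^ 2 + ‖v n‖ ^ 2) :=
      (pow_le_pow_left₀ (norm_nonneg _) (norm_sub_le _ _) 2).trans (add_sq_le)
    have h2 := ENNReal.ofReal_le_ofReal h1
    rwa [ENNReal.ofReal_mul (by norm_num), ENNReal.ofReal_add (by positivity) (by positivity),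
      ENNReal.ofReal_pow (norm_nonneg _), ENNReal.ofReal_pow (norm_nonneg _),
      ENNReal.ofReal_pow (norm_nonneg _), ofReal_norm, ofReal_norm, ofReal_norm,
      ENNReal.ofReal_ofNat] at h2
  have h4 : ∑ n ∈ S, ‖u n - v n‖ₑ ^ 2 ≤ 4 * max A B := by
    refine h.trans ?_
    calc 2 * (A + B) ≤ 2 * (max A B + max A B) := by
          gcongr
          exacts [le_max_left _ _, le_max_right _ _]
      _ = 4 * max A B := by ring
  refine (ENNReal.rpow_le_rpow h4 hq).trans ?_
  rw [ENNReal.mul_rpow_of_nonneg _ _ hq]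
  gcongr
  rcases le_total A B with hAB | hAB
  · rw [max_eq_right hAB]
    exact le_add_self
  · rw [max_eq_left hAB]
    exact le_self_add

theorem mult_Icc {α β : ℝ} (h : α ≤ β) (f : 𝓢(ℝ, ℂ)) (x : ℝ) :
    mult ((Icc α β).indicator 1) f x =
      mult ((Ioi α).indicator 1) f x - mult ((Ioi β).indicator 1) f x := by
  rw [← mult_sub (isSymbol_Ioi α) (isSymbol_Ioi β)]
  refine mult_congr_ae ?_ f x
  have h1 : (Icc α β).indicator (1 : ℝ → ℂ) =ᵐ[volume] (Ioc α β).indicator 1 :=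
    indicator_ae_eq_of_ae_eq_set Ioc_ae_eq_Icc.symm
  refine h1.trans (Filter.Eventually.of_forall fun ξ => ?_)
  simp only [indicator, mem_Ioc, mem_Ioi, Pi.one_apply]
  split_ifs <;> grind

theorem exists_lintegral_sum_Icc_le {p : ℝ} (hp : 1 < p) : ∃ C : ℝ≥0∞, C ≠ ∞ ∧
    ∀ (S : Finset ι) (α β : ι → ℝ) (f : ι → 𝓢(ℝ, ℂ)), (∀ n, α n ≤ β n) →
      ∫⁻ x, (∑ n ∈ S, ‖mult ((Icc (α n) (β n)).indicator 1) (f n) x‖ₑ ^ 2) ^ (p / 2) ≤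
        C * ∫⁻ x, (∑ n ∈ S, ‖f n x‖ₑ ^ 2) ^ (p / 2) := by
  obtain ⟨C, hC, hCh⟩ := exists_lintegral_sum_Ioi_le ι hp
  have hp2 : 0 ≤ p / 2 := by linarith
  have h4 : (4 : ℝ≥0∞) ^ (p / 2) ≠ ∞ := ENNReal.rpow_ne_top_of_nonneg hp2 (by simp)
  refine ⟨4 ^ (p / 2) * (C + C), ENNReal.mul_ne_top h4 (by simp [hC]), fun S α β f hαβ => ?_⟩
  simp only [mult_Icc (hαβ _)]
  refine (lintegral_mono fun x => sum_enorm_sub_rpow_le S hp2 _ _).trans ?_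
  have hm : Measurable fun x =>
      (∑ n ∈ S, ‖mult ((Ioi (α n)).indicator 1) (f n) x‖ₑ ^ 2) ^ (p / 2) :=
    (Finset.measurable_fun_sum _ fun n _ =>
      ((isSymbol_Ioi (α n)).measurable_mult (f n)).enorm.pow_const 2).pow_const _
  rw [lintegral_const_mul' _ _ h4, lintegral_add_left hm, mul_assoc, add_mul]
  gcongr
  exacts [hCh S α f, hCh S β f]

theorem exists_lintegral_sum_dilate_le {ρ : ℝ} (h : 0 < ρ) (h1 : ρ < 1) {η : 𝓢(ℝ, ℂ)}
    (h0 : η 0 = 0) {p : ℝ} (hp : 1 < p) : ∃ C : ℝ≥0∞, C ≠ ∞ ∧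
    ∀ (S : Finset ℤ) (f : 𝓢(ℝ, ℂ)),
      ∫⁻ x, (∑ n ∈ S, ‖mult (dilate (scaleUnit h ^ (-n)) η) f x‖ₑ ^ 2) ^ (p / 2) ≤
        C * ∫⁻ x, ‖f x‖ₑ ^ p := by
  obtain ⟨K, hK, hKh⟩ := exists_lintegral_sq_le_of_signSum ℤ (one_pos.trans hp)
  obtain ⟨C, hC, hCh⟩ := exists_lintegral_mult_lacunarySymbol_le h h1 h0 hp
  refine ⟨K * C, ENNReal.mul_ne_top hK hC, fun S f => ?_⟩
  rw [mul_assoc]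
  refine hKh S _ (fun n => (IsSymbol.of_schwartz _).measurable_mult f) _ fun P => ?_
  have := hCh S (fun n => sgn P n) (fun n => by unfold sgn; split_ifs <;> simp) f
  convert this using 4 with x
  rw [signSum, ← mult_symbol_sum S _ fun n => IsSymbol.of_schwartz _]
  refine congrArg (fun m : ℝ → ℂ => ‖mult m f x‖ₑ) (funext fun ξ => ?_)
  simp [lacunarySymbol, sum_apply]

theorem dilate_scaleUnit {ρ : ℝ} (h : 0 < ρ) (n : ℤ) (η : 𝓢(ℝ, ℂ)) (ξ : ℝ) :
    dilate (scaleUnit h ^ (-n)) η ξ = η (ξ / ρ ^ n) := by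
  simp [scaleUnit, div_eq_mul_inv]

theorem exists_lintegral_tsum_Icc_le {ρ : ℝ} (h : 0 < ρ) (h1 : ρ < 1) {η : 𝓢(ℝ, ℂ)}
    (h0 : η 0 = 0) {p : ℝ} (hp : 1 < p) : ∃ C : ℝ≥0∞, C ≠ ∞ ∧
    ∀ (α β : ℤ → ℝ), (∀ n, α n ≤ β n) → ∀ f : 𝓢(ℝ, ℂ),
      ∫⁻ x, (∑' n, ‖mult (fun ξ => (Icc (α n) (β n)).indicator 1 ξ * η (ξ / ρ ^ n)) f x‖ₑ ^ 2)
        ^ (p / 2) ≤ C * ∫⁻ x, ‖f x‖ₑ ^ p := by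
  obtain ⟨C₁, hC₁, hh₁⟩ := exists_lintegral_sum_Icc_le ℤ hp
  obtain ⟨C₂, hC₂, hh₂⟩ := exists_lintegral_sum_dilate_le h h1 h0 hp
  refine ⟨C₁ * C₂, ENNReal.mul_ne_top hC₁ hC₂, fun α β hαβ f => ?_⟩
  have hfin : ∀ S : Finset ℤ, ∫⁻ x, (∑ n ∈ S,
      ‖mult (fun ξ => (Icc (α n) (β n)).indicator 1 ξ * η (ξ / ρ ^ n)) f x‖ₑ ^ 2) ^ (p / 2) ≤
        C₁ * C₂ * ∫⁻ x, ‖f x‖ₑ ^ p := by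
    intro S
    have h3 := hh₁ S α β (fun n => schwartzMult (dilate (scaleUnit h ^ (-n)) η) f) hαβ
    have h4 := hh₂ S f
    simp only [mult_schwartzMult, schwartzMult_apply, dilate_scaleUnit] at h3
    rw [mul_assoc]
    refine h3.trans ?_
    gcongr
  have hm : ∀ S : Finset ℤ, Measurable fun x => (∑ n ∈ S,
      ‖mult (fun ξ => (Icc (α n) (β n)).indicator 1 ξ * η (ξ / ρ ^ n)) f x‖ₑ ^ 2) ^ (p / 2) := by
    refine fun S => (Finset.measurable_fun_sum _ fun n _ =>
      (IsSymbol.measurable_mult ?_ f).enorm.pow_const 2).pow_const _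
    simp only [← dilate_scaleUnit h]
    exact (IsSymbol.indicator measurableSet_Icc).mul (.of_schwartz _)
  have hl : ∀ x, (∑' n, ‖mult (fun ξ => (Icc (α n) (β n)).indicator 1 ξ * η (ξ / ρ ^ n)) f x‖ₑ
      ^ 2) ^ (p / 2) = Filter.liminf (fun S : Finset ℤ => (∑ n ∈ S,
        ‖mult (fun ξ => (Icc (α n) (β n)).indicator 1 ξ * η (ξ / ρ ^ n)) f x‖ₑ ^ 2) ^ (p / 2))
        Filter.atTop := fun x =>
    (ENNReal.summable.hasSum.ennrpow_const (p / 2)).liminf_eq.symm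
  simp only [hl]
  exact (lintegral_liminf_le hm).trans <|
    (Filter.liminf_le_liminf (Filter.Eventually.of_forall hfin)).trans_eq (Filter.liminf_const _)

end

theorem exists_norm_mul_one_add_sq_le (k : 𝓢(ℝ, ℂ)) :
    ∃ A, 0 < A ∧ ∀ u, ‖k u‖ * (1 + |u|) ^ 2 ≤ A := by
  obtain ⟨C₀, hC₀, h₀⟩ := k.decay 0 0
  obtain ⟨C₂, hC₂, h₂⟩ := k.decay 2 0
  refine ⟨2 * (C₀ + C₂), by positivity, fun u => ?_⟩
  have h₀ := h₀ u
  have h₂ := h₂ u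
  simp only [norm_iteratedFDeriv_zero, Real.norm_eq_abs, pow_zero, one_mul] at h₀ h₂
  calc ‖k u‖ * (1 + |u|) ^ 2 ≤ ‖k u‖ * (2 * (1 ^ 2 + |u| ^ 2)) := by
        gcongr
        exact add_sq_le
    _ = 2 * (‖k u‖ + |u| ^ 2 * ‖k u‖) := by ring
    _ ≤ _ := by gcongr

theorem exists_enorm_le_tsum (k : 𝓢(ℝ, ℂ)) : ∃ A, 0 < A ∧ ∀ t, 0 < t → ∀ x y : ℝ,
    ‖k (t * (x - y))‖ₑ ≤ ∑' j : ℕ, ENNReal.ofReal (A / 4 ^ j) *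
      (Ioo (x - 2 ^ (j + 1) / t) (x + 2 ^ (j + 1) / t)).indicator 1 y := by
  obtain ⟨A, hA, hk⟩ := exists_norm_mul_one_add_sq_le k
  refine ⟨A, hA, fun t ht x y => ?_⟩
  set u := t * (x - y) with hu
  obtain ⟨j, hj1, hj2⟩ := exists_nat_pow_near (x := 1 + |u|) (by linarith [abs_nonneg u])
    one_lt_two
  refine le_trans ?_ (ENNReal.le_tsum j)
  have hy : y ∈ Ioo (x - 2 ^ (j + 1) / t) (x + 2 ^ (j + 1) / t) := by
    have h1 : |x - y| < 2 ^ (j + 1) / t := by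
      have h2 : |u| = t * |x - y| := by rw [hu, abs_mul, abs_of_pos ht]
      rw [lt_div_iff₀ ht, mul_comm, ← h2]
      linarith
    rw [abs_lt] at h1
    constructor <;> linarith
  rw [indicator_of_mem hy, Pi.one_apply, mul_one, ← ofReal_norm]
  refine ENNReal.ofReal_le_ofReal ?_
  rw [le_div_iff₀ (by positivity)]
  refine le_trans ?_ (hk u)
  gcongr
  calc (4 : ℝ) ^ j = (2 ^ j) ^ 2 := by rw [← pow_mul, mul_comm, pow_mul]; norm_num
    _ ≤ _ := by gcongr

theorem exists_lintegral_kernel_le_maximal (k : 𝓢(ℝ, ℂ)) : ∃ C : ℝ≥0∞, C ≠ ∞ ∧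
    ∀ t, 0 < t → ∀ g : ℝ → ℝ≥0∞, Measurable g → ∀ x,
      ENNReal.ofReal t * ∫⁻ y, ‖k (t * (x - y))‖ₑ * g y ≤ C * maximal g x := by
  obtain ⟨A, hA, hk⟩ := exists_enorm_le_tsum k
  have hs : Summable fun j : ℕ => 4 * A * (1 / 2 : ℝ) ^ j := summable_geometric_two.mul_left _
  refine ⟨∑' j : ℕ, ENNReal.ofReal (4 * A * (1 / 2) ^ j), ?_, fun t ht g hg x => ?_⟩
  · rw [← ENNReal.ofReal_tsum_of_nonneg (fun j => by positivity) hs]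
    exact ENNReal.ofReal_ne_top
  calc _ ≤ ENNReal.ofReal t * ∫⁻ y, ∑' j : ℕ, ENNReal.ofReal (A / 4 ^ j) *
          (Ioo (x - 2 ^ (j + 1) / t) (x + 2 ^ (j + 1) / t)).indicator g y := by
        gcongr with y
        refine (mul_le_mul_left (hk t ht x y) (g y)).trans_eq ?_
        rw [← ENNReal.tsum_mul_right]
        refine tsum_congr fun j => ?_
        rw [mul_assoc]
        congr 1
        simp only [indicator]
        split_ifs <;> simp
    _ = ∑' j : ℕ, ENNReal.ofReal t * (ENNReal.ofReal (A / 4 ^ j) *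
          ∫⁻ y in Ioo (x - 2 ^ (j + 1) / t) (x + 2 ^ (j + 1) / t), g y) := by
        rw [lintegral_tsum fun j => ((hg.indicator measurableSet_Ioo).const_mul _).aemeasurable,
          ← ENNReal.tsum_mul_left]
        refine tsum_congr fun j => ?_
        rw [lintegral_const_mul _ (hg.indicator measurableSet_Ioo),
          lintegral_indicator measurableSet_Ioo]
    _ ≤ ∑' j : ℕ, ENNReal.ofReal (4 * A * (1 / 2) ^ j) * maximal g x := by
        refine ENNReal.tsum_le_tsum fun j => ?_
        have h0 : 0 < 2 ^ (j + 1) / t := by positivity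
        calc _ ≤ ENNReal.ofReal t * (ENNReal.ofReal (A / 4 ^ j) * (maximal g x *
              ENNReal.ofReal (x + 2 ^ (j + 1) / t - (x - 2 ^ (j + 1) / t)))) := by
              gcongr
              exact setLIntegral_le_maximal (by linarith) (by linarith)
          _ = ENNReal.ofReal (t * (A / 4 ^ j) *
              (x + 2 ^ (j + 1) / t - (x - 2 ^ (j + 1) / t))) * maximal g x := by
              rw [ENNReal.ofReal_mul (by positivity), ENNReal.ofReal_mul (by positivity)]
              ring
          _ = _ := by
              congr 2
              have h4 : (4 : ℝ) ^ j = 2 ^ j * 2 ^ j := by rw [← mul_pow]; norm_num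
              rw [h4, pow_succ, one_div, inv_pow]
              field_simp
              ring
    _ = _ := ENNReal.tsum_mul_right

theorem exists_enorm_mult_le_maximal {ρ : ℝ} (h : 0 < ρ) (m : 𝓢(ℝ, ℂ)) : ∃ C : ℝ≥0∞, C ≠ ∞ ∧
    ∀ (n : ℤ) (f : 𝓢(ℝ, ℂ)) (x : ℝ),
      ‖mult (fun ξ => m (ξ / ρ ^ n)) f x‖ₑ ≤ C * maximal (fun y => ‖f y‖ₑ) x := by
  obtain ⟨C, hC, hCh⟩ := exists_lintegral_kernel_le_maximal (𝓕⁻ m)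
  refine ⟨C, hC, fun n f x => ?_⟩
  have hρ : 0 < ρ ^ n := by positivity
  have : (fun ξ => m (ξ / ρ ^ n)) = dilate (scaleUnit h ^ (-n)) m :=
    funext fun ξ => (dilate_scaleUnit h n m ξ).symm
  rw [this, mult_eq_conv]
  refine le_trans ?_ (hCh _ hρ (fun y => ‖f y‖ₑ) f.continuous.measurable.enorm x)
  refine (enorm_integral_le_lintegral_enorm _).trans ?_
  rw [← lintegral_const_mul' _ _ ENNReal.ofReal_ne_top]
  refine lintegral_mono fun y => ?_
  rw [enorm_mul, fourierInv_dilate, enorm_smul, ← mul_assoc]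
  simp only [scaleUnit, zpow_neg, Units.val_inv_eq_inv_val, Units.val_zpow_eq_zpow_val,
    Units.val_mk0, inv_inv, abs_of_pos hρ, Real.enorm_of_nonneg hρ.le]
  exact le_rfl

noncomputable def plateau (u : ℝ) : ℝ := smoothTransition (2 - u) * smoothTransition (2 + u)

theorem contDiff_plateau {n : ℕ∞} : ContDiff ℝ n plateau := by
  unfold plateau
  exact (smoothTransition.contDiff.comp (by fun_prop)).mul
    (smoothTransition.contDiff.comp (by fun_prop))

theorem plateau_of_abs_le {u : ℝ} (h : |u| ≤ 1) : plateau u = 1 := by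
  rw [abs_le] at h
  rw [plateau, smoothTransition.one_of_one_le (by linarith),
    smoothTransition.one_of_one_le (by linarith), mul_one]

theorem plateau_of_le_abs {u : ℝ} (h : 2 ≤ |u|) : plateau u = 0 := by
  rcases le_abs.1 h with h | h
  · rw [plateau, smoothTransition.zero_of_nonpos (by linarith), zero_mul]
  · rw [plateau, smoothTransition.zero_of_nonpos (x := 2 + u) (by linarith), mul_zero]

theorem le_tsum_sq_rpow {ι : Type*} (z : ι → ℝ≥0∞) (n : ι) :
    z n ≤ (∑' n, z n ^ 2) ^ (1 / 2 : ℝ) := by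
  refine le_trans (le_of_eq ?_) (ENNReal.rpow_le_rpow (ENNReal.le_tsum n) (by norm_num))
  rw [← ENNReal.rpow_natCast, ← ENNReal.rpow_mul]
  norm_num

theorem exists_lintegral_iSup_le {b : ℝ} (h : 0 < b) (h1 : b < 1) {q : ℝ} (hq : 1 < q) :
    ∃ C : ℝ≥0∞, C ≠ ∞ ∧ ∀ f : 𝓢(ℝ, ℂ),
      ∫⁻ x, (⨆ n : ℤ, ‖mult ((Icc (-(b ^ n)) (b ^ n)).indicator 1) f x‖ₑ) ^ q ≤
        C * ∫⁻ x, ‖f x‖ₑ ^ q := by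
  set η : ℝ → ℝ := fun u => plateau (u / 2) - plateau (4 * u) with hη
  have hηc : ContDiff ℝ (⊤ : ℕ∞) η :=
    (contDiff_plateau.comp (by fun_prop)).sub (contDiff_plateau.comp (by fun_prop))
  obtain ⟨E, hE⟩ := exists_schwartz_of_support hηc (a := -4) (b := 4) fun u hu => by
    rw [mem_Icc, ← abs_le, not_le] at hu
    have h1 : 2 ≤ |u / 2| := by rw [abs_div, abs_two]; linarith
    have h2 : 2 ≤ |4 * u| := by rw [abs_mul, abs_of_pos (four_pos)]; linarith
    simp only [hη, plateau_of_le_abs h1, plateau_of_le_abs h2, sub_self]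
  obtain ⟨M, hM⟩ := exists_schwartz_of_support (φ := fun u => plateau u * (1 - η u))
    (contDiff_plateau.mul (contDiff_const.sub hηc)) (a := -4) (b := 4) fun u hu => by
    rw [mem_Icc, ← abs_le, not_le] at hu
    rw [plateau_of_le_abs (by linarith), zero_mul]
  have hE0 : E 0 = 0 := by simp [hE, hη]
  have hone : ∀ u, 1 ≤ |u| → |u| ≤ 2 → η u = 1 := fun u h1 h2 => by
    have h3 : |u / 2| ≤ 1 := by rw [abs_div, abs_two]; linarith
    have h4 : 2 ≤ |4 * u| := by rw [abs_mul, abs_of_pos (four_pos)]; linarith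
    simp only [hη, plateau_of_abs_le h3, plateau_of_le_abs h4, sub_zero]
  have hdec : ∀ n : ℤ, ((Icc (-(b ^ n)) (b ^ n)).indicator 1 : ℝ → ℂ) = fun ξ =>
      M (ξ / b ^ n) + (Icc (-(b ^ n)) (b ^ n)).indicator 1 ξ * E (ξ / b ^ n) := by
    intro n
    ext ξ
    have hb : 0 < b ^ n := by positivity
    have habs : |ξ / b ^ n| = |ξ| / b ^ n := by rw [abs_div, abs_of_pos hb]
    simp only [hM, hE]
    by_cases hξ : |ξ| ≤ b ^ n
    · have : |ξ / b ^ n| ≤ 1 := by rwa [habs, div_le_one hb]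
      rw [indicator_of_mem (by exact abs_le.1 hξ), plateau_of_abs_le this]
      simp
    · rw [indicator_of_notMem (by rwa [mem_Icc, ← abs_le])]
      have h1 : 1 ≤ |ξ / b ^ n| := by rw [habs, one_le_div hb]; exact (not_le.1 hξ).le
      rcases le_total |ξ / b ^ n| 2 with h2 | h2
      · simp [hone _ h1 h2]
      · simp [plateau_of_le_abs h2]
  obtain ⟨C₁, hC₁, hh₁⟩ := exists_enorm_mult_le_maximal h M
  obtain ⟨C₂, hC₂, hh₂⟩ := exists_lintegral_tsum_Icc_le h h1 hE0 hq
  have hq0 : 0 < q := one_pos.trans hq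
  set D : ℝ≥0∞ := ENNReal.ofReal q * 10 * ENNReal.ofReal (2 ^ (q - 1) / (q - 1))
  refine ⟨2 ^ (q - 1) * (C₁ ^ q * D + C₂), by finiteness, fun f => ?_⟩
  obtain ⟨R, hR⟩ := schwartz_bounded f
  have hmax : ∫⁻ x, maximal (fun y => ‖f y‖ₑ) x ^ q ≤ D * ∫⁻ x, ‖f x‖ₑ ^ q := by
    refine maximal_strong_type hq _ f.continuous.measurable.enorm f.integrable.2.ne
      (B := ENNReal.ofReal R) ENNReal.ofReal_ne_top fun y => ?_
    rw [← ofReal_norm]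
    exact ENNReal.ofReal_le_ofReal (hR y)
  have hpt : ∀ x, (⨆ n : ℤ, ‖mult ((Icc (-(b ^ n)) (b ^ n)).indicator 1) f x‖ₑ) ^ q ≤
      2 ^ (q - 1) * (C₁ ^ q * maximal (fun y => ‖f y‖ₑ) x ^ q + (∑' n : ℤ, ‖mult (fun ξ =>
        (Icc (-(b ^ n)) (b ^ n)).indicator 1 ξ * E (ξ / b ^ n)) f x‖ₑ ^ 2) ^ (q / 2)) := by
    intro x
    have hsq : ∀ s : ℝ≥0∞, s ^ (q / 2) = (s ^ (1 / 2 : ℝ)) ^ q := fun s => by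
      rw [← ENNReal.rpow_mul, one_div_mul_eq_div]
    rw [hsq, ← ENNReal.mul_rpow_of_nonneg _ _ hq0.le]
    refine le_trans ?_ (ENNReal.rpow_add_le_mul_rpow_add_rpow _ _ hq.le)
    gcongr
    refine iSup_le fun n => ?_
    have hsM : IsSymbol fun ξ => M (ξ / b ^ n) := by
      simp only [← dilate_scaleUnit h]
      exact .of_schwartz _
    have hsE : IsSymbol fun ξ => (Icc (-(b ^ n)) (b ^ n)).indicator 1 ξ * E (ξ / b ^ n) := by
      simp only [← dilate_scaleUnit h]
      exact (IsSymbol.indicator measurableSet_Icc).mul (.of_schwartz _)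
    rw [hdec n, mult_add hsM hsE]
    exact (enorm_add_le _ _).trans (add_le_add (hh₁ n f x) (le_tsum_sq_rpow _ n))
  refine (lintegral_mono hpt).trans ?_
  rw [lintegral_const_mul' _ _ (by finiteness), lintegral_add_left
    (((measurable_maximal _).pow_const q).const_mul _), lintegral_const_mul' _ _ (by finiteness),
    mul_assoc, add_mul, mul_assoc]
  gcongr
  exact hh₂ _ _ (fun n => by have : 0 < b ^ n := (by positivity); linarith) f

theorem exists_lintegral_tsum_lacunary_le {a : ℝ} (h : 0 < a) (h1 : a < 1) {p : ℝ} (hp : 1 < p) :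
    ∃ C : ℝ≥0∞, C ≠ ∞ ∧ ∀ f : 𝓢(ℝ, ℂ),
      ∫⁻ x, (∑' n : ℤ, ‖mult ((Icc (a ^ n) (a ^ (n - 1))).indicator 1) f x‖ₑ ^ 2) ^ (p / 2) ≤
        C * ∫⁻ x, ‖f x‖ₑ ^ p := by
  set η : ℝ → ℝ := fun u => smoothTransition (2 * u - 1) * smoothTransition (a⁻¹ + 1 - u) with hη
  have hηc : ContDiff ℝ (⊤ : ℕ∞) η := (smoothTransition.contDiff.comp (by fun_prop)).mul
    (smoothTransition.contDiff.comp (by fun_prop))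
  obtain ⟨E, hE⟩ := exists_schwartz_of_support hηc (a := 0) (b := a⁻¹ + 1) fun u hu => by
    rw [mem_Icc, not_and_or, not_le, not_le] at hu
    simp only [hη]
    rcases hu with hu | hu
    · rw [smoothTransition.zero_of_nonpos (by linarith), zero_mul]
    · rw [smoothTransition.zero_of_nonpos (x := a⁻¹ + 1 - u) (by linarith), mul_zero]
  have hE0 : E 0 = 0 := by
    simp only [hE, hη]
    rw [smoothTransition.zero_of_nonpos (by norm_num), zero_mul, Complex.ofReal_zero]
  obtain ⟨C, hC, hh⟩ := exists_lintegral_tsum_Icc_le h h1 hE0 hp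
  refine ⟨C, hC, fun f => ?_⟩
  have hdec : ∀ n : ℤ, ((Icc (a ^ n) (a ^ (n - 1))).indicator 1 : ℝ → ℂ) = fun ξ =>
      (Icc (a ^ n) (a ^ (n - 1))).indicator 1 ξ * E (ξ / a ^ n) := by
    intro n
    ext ξ
    have ha : 0 < a ^ n := by positivity
    by_cases hξ : ξ ∈ Icc (a ^ n) (a ^ (n - 1))
    · have h2 : 1 ≤ ξ / a ^ n := (one_le_div ha).2 hξ.1
      have h3 : ξ / a ^ n ≤ a⁻¹ := by
        rw [div_le_iff₀ ha, mul_comm, ← zpow_sub_one₀ h.ne']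
        exact hξ.2
      simp only [hE, hη]
      rw [smoothTransition.one_of_one_le (by linarith),
        smoothTransition.one_of_one_le (by linarith)]
      simp
    · rw [indicator_of_notMem hξ, zero_mul]
  have := hh (fun n => a ^ n) (fun n => a ^ (n - 1))
    (fun n => zpow_le_zpow_right_of_le_one₀ h h1.le (by omega)) f
  simp only [← hdec] at this
  exact this

theorem FT_eq_fourier (f : 𝓢(ℝ, ℂ)) (ξ : ℝ) : FT f ξ = 𝓕 f ξ := by
  rw [SchwartzMap.fourier_coe, Real.fourier_real_eq_integral_exp_smul]
  simp only [FT, smul_eq_mul]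

theorem integral_prod_eq_mult_mul_mult (f g : 𝓢(ℝ, ℂ)) (s t : Set ℝ) (x : ℝ) :
    ∫ ξ : ℝ × ℝ, Complex.exp (((2 * π * x * (ξ.1 + ξ.2) : ℝ) : ℂ) * Complex.I) *
      FT f ξ.1 * FT g ξ.2 * s.indicator 1 ξ.1 * t.indicator 1 ξ.2 =
    mult (s.indicator 1) f x * mult (t.indicator 1) g x := by
  rw [mult_eq_integral, mult_eq_integral, ← integral_prod_mul, ← Measure.volume_eq_prod]
  refine integral_congr_ae (ae_of_all _ fun ξ => ?_)
  have : ((2 * π * x * (ξ.1 + ξ.2) : ℝ) : ℂ) * Complex.I =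
      ((2 * π * (ξ.1 * x) : ℝ) : ℂ) * Complex.I + ((2 * π * (ξ.2 * x) : ℝ) : ℂ) * Complex.I := by
    push_cast
    ring
  simp only [FT_eq_fourier, this, Complex.exp_add]
  ring

theorem enorm_sqrt_tsum_mul_le {ι : Type*} (F G : ι → ℂ) :
    ‖√(∑' n, ‖F n * G n‖ ^ 2)‖ₑ ≤ (∑' n, ‖F n‖ₑ ^ 2) ^ (1 / 2 : ℝ) * ⨆ n, ‖G n‖ₑ := by
  have h : ENNReal.ofReal (∑' n, ‖F n * G n‖ ^ 2) ≤ (∑' n, ‖F n‖ₑ ^ 2) * (⨆ n, ‖G n‖ₑ) ^ 2 := by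
    by_cases hs : Summable fun n => ‖F n * G n‖ ^ 2
    · rw [ENNReal.ofReal_tsum_of_nonneg (fun n => by positivity) hs, ← ENNReal.tsum_mul_right]
      refine ENNReal.tsum_le_tsum fun n => ?_
      rw [ENNReal.ofReal_pow (norm_nonneg _), ofReal_norm, enorm_mul, mul_pow]
      gcongr
      exact le_iSup (fun n => ‖G n‖ₑ) n
    · rw [tsum_eq_zero_of_not_summable hs, ENNReal.ofReal_zero]
      exact zero_le
  rw [Real.enorm_of_nonneg (Real.sqrt_nonneg _), Real.sqrt_eq_rpow,
    ← ENNReal.ofReal_rpow_of_nonneg (tsum_nonneg fun n => by positivity) (by norm_num)]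
  refine (ENNReal.rpow_le_rpow h (by norm_num)).trans_eq ?_
  rw [ENNReal.mul_rpow_of_nonneg _ _ (by norm_num), ← ENNReal.rpow_natCast, ← ENNReal.rpow_mul]
  norm_num

theorem eLpNorm_ofReal_eq {E : Type*} [NormedAddCommGroup E] {p : ℝ} (hp : 0 < p) (f : ℝ → E) :
    eLpNorm f (ENNReal.ofReal p) volume = (∫⁻ x, ‖f x‖ₑ ^ p) ^ (1 / p) := by
  rw [eLpNorm_eq_lintegral_rpow_enorm_toReal (by simpa using hp) ENNReal.ofReal_ne_top,
    ENNReal.toReal_ofReal hp.le]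

end SquareFunction

/-- **Diestel.** For `a, b ∈ (0,1)` with `a ≠ b` and
`p, q, r ∈ (1,∞)` with `1/r = 1/p + 1/q`, the multiscale paraproduct square
function associated to the cutoffs `1_{[a^n, a^{n-1}]}(ξ₁) 1_{[-b^n, b^n]}(ξ₂)`
maps `L^p × L^q` into `L^r`. -/
theorem diestel_square_function
    (a b : ℝ) (ha : a ∈ Set.Ioo (0 : ℝ) 1) (hb : b ∈ Set.Ioo (0 : ℝ) 1) (hab : a ≠ b)
    (p q r : ℝ) (hp : 1 < p) (hq : 1 < q) (hr : 1 / r = 1 / p + 1 / q) :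
    ∃ c : ℝ, 0 < c ∧ ∀ f g : SchwartzMap ℝ ℂ,
      eLpNorm (fun x : ℝ =>
          Real.sqrt (∑' n : ℤ,
            ‖∫ ξ : ℝ × ℝ,
                Complex.exp (((2 * Real.pi * x * (ξ.1 + ξ.2) : ℝ) : ℂ) * Complex.I) *
                FT (⇑f) ξ.1 * FT (⇑g) ξ.2 *
                (Set.Icc (a ^ n) (a ^ (n - 1))).indicator 1 ξ.1 *
                (Set.Icc (-(b ^ n)) (b ^ n)).indicator 1 ξ.2‖ ^ 2))
          (ENNReal.ofReal r) volume ≤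
        ENNReal.ofReal c * eLpNorm (⇑f) (ENNReal.ofReal p) volume *
          eLpNorm (⇑g) (ENNReal.ofReal q) volume := by
  have hp0 : 0 < p := one_pos.trans hp
  have hq0 : 0 < q := one_pos.trans hq
  have hr0 : 0 < r := one_div_pos.1 (by rw [hr]; positivity)
  have hrp : r < p := by
    have : 1 / p < 1 / r := by rw [hr]; linarith [one_div_pos.2 hq0]
    exact (one_div_lt_one_div hp0 hr0).1 this
  obtain ⟨C₁, hC₁, h₁⟩ := SquareFunction.exists_lintegral_tsum_lacunary_le ha.1 ha.2 hp
  obtain ⟨C₂, hC₂, h₂⟩ := SquareFunction.exists_lintegral_iSup_le hb.1 hb.2 hq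
  have hC : C₁ ^ (1 / p) * C₂ ^ (1 / q) ≠ ∞ := by finiteness
  refine ⟨(C₁ ^ (1 / p) * C₂ ^ (1 / q)).toReal + 1, by positivity, fun f g => ?_⟩
  have hmeas : ∀ (s : Set ℝ) (hs : MeasurableSet s) (f : SchwartzMap ℝ ℂ),
      Measurable fun x => ‖SquareFunction.mult (s.indicator 1) f x‖ₑ := fun s hs f =>
    ((SquareFunction.IsSymbol.indicator hs).measurable_mult f).enorm
  simp only [SquareFunction.integral_prod_eq_mult_mul_mult]
  rw [SquareFunction.eLpNorm_ofReal_eq hr0, SquareFunction.eLpNorm_ofReal_eq hp0,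
    SquareFunction.eLpNorm_ofReal_eq hq0]
  set F : ℝ → ℝ≥0∞ := fun x =>
    (∑' n : ℤ, ‖SquareFunction.mult ((Icc (a ^ n) (a ^ (n - 1))).indicator 1) f x‖ₑ ^ 2) ^
      (1 / 2 : ℝ) with hF
  set G : ℝ → ℝ≥0∞ := fun x =>
    ⨆ n : ℤ, ‖SquareFunction.mult ((Icc (-(b ^ n)) (b ^ n)).indicator 1) g x‖ₑ
  have hFm : Measurable F := (Measurable.tsum fun n =>
    (hmeas _ measurableSet_Icc f).pow_const 2).pow_const _
  have hGm : Measurable G := .iSup fun n => hmeas _ measurableSet_Icc g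
  have hFp : ∫⁻ x, F x ^ p ≤ C₁ * ∫⁻ x, ‖f x‖ₑ ^ p := by
    refine le_trans (le_of_eq ?_) (h₁ f)
    simp only [hF, ← ENNReal.rpow_mul, one_div_mul_eq_div]
  calc _ ≤ (∫⁻ x, (F * G) x ^ r) ^ (1 / r) := by
        gcongr with x
        exact SquareFunction.enorm_sqrt_tsum_mul_le _ _
    _ ≤ (∫⁻ x, F x ^ p) ^ (1 / p) * (∫⁻ x, G x ^ q) ^ (1 / q) :=
        ENNReal.lintegral_Lp_mul_le_Lq_mul_Lr hr0 hrp hr volume hFm.aemeasurable hGm.aemeasurable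
    _ ≤ (C₁ * ∫⁻ x, ‖f x‖ₑ ^ p) ^ (1 / p) * (C₂ * ∫⁻ x, ‖g x‖ₑ ^ q) ^ (1 / q) := by
        gcongr
        exact h₂ g
    _ = C₁ ^ (1 / p) * C₂ ^ (1 / q) * (∫⁻ x, ‖f x‖ₑ ^ p) ^ (1 / p) *
          (∫⁻ x, ‖g x‖ₑ ^ q) ^ (1 / q) := by
        rw [ENNReal.mul_rpow_of_nonneg _ _ (by positivity),
          ENNReal.mul_rpow_of_nonneg _ _ (by positivity)]
        ring
    _ ≤ _ := by
        gcongr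
        rw [ENNReal.le_ofReal_iff_toReal_le hC (by positivity)]
        linarith
end

section
/- Let p ∈ [2, ∞) and let Ψ be a Schwartz function on ℝ. Then there exists a constant c = c(p, Ψ) such that for every Schwartz function f on ℝ, ‖ ( Σ_{n∈ℤ} [ ∫_ℝ e^{2πi n y} Ψ(y) f(x−y) dy ]² )^{1/2} ‖_{L^p(ℝ)} ≤ c ‖f‖_{L^p(ℝ)}. -/
open MeasureTheory Real Set
open scoped ENNReal

open scoped FourierTransform
open TopologicalSpace

/-- **Parseval's identity for periodizations**: the values of `𝓕 f` at the integers are the Fourier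
coefficients of `∑' n : ℤ, f (x + n)`. -/
theorem hasSum_sq_fourier_intCast {f : C(ℝ, ℂ)}
    (hf : ∀ K : Compacts ℝ,
      Summable fun n : ℤ => ‖(f.comp (ContinuousMap.addRight n)).restrict K‖) :
    HasSum (fun m : ℤ => ‖𝓕 (f : ℝ → ℂ) m‖ ^ 2)
      (∫ x in (0 : ℝ)..1, ‖∑' n : ℤ, f (x + n)‖ ^ 2) := by
  set h : C(ℝ, ℂ) := ∑' n : ℤ, f.comp (ContinuousMap.addRight n) with hh
  have happ (x : ℝ) : h x = ∑' n : ℤ, f (x + n) := by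
    rw [hh, ← ContinuousMap.tsum_apply (ContinuousMap.summable_of_locally_summable_norm hf)]
    rfl
  have hL2 : MemLp h 2 (volume.restrict (Ioc 0 1)) := by
    obtain ⟨M, hM⟩ := isCompact_Icc.exists_bound_of_continuousOn
      (s := Icc (0 : ℝ) 1) h.continuous.continuousOn
    exact MemLp.of_bound h.continuous.aestronglyMeasurable M
      (ae_restrict_of_forall_mem measurableSet_Ioc fun x hx => hM x (Ioc_subset_Icc_self hx))
  have key := hasSum_sq_fourierCoeffOn zero_lt_one hL2
  simp_rw [sub_zero, inv_one, one_smul, happ] at key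
  convert key using 4 with m
  rw [← Real.fourierCoeff_tsum_comp_add hf, fourierCoeff_eq_intervalIntegral _ m 0,
    fourierCoeffOn_eq_integral]
  simp [h]

/-- The Lebesgue integral over `ℝ` as the integral over `(0, 1]` of the periodization. -/
theorem lintegral_Ioc_tsum_comp_add_int {g : ℝ → ℝ≥0∞} (hg : Measurable g) :
    ∫⁻ x in Ioc (0 : ℝ) 1, ∑' n : ℤ, g (x + n) = ∫⁻ x, g x := by
  rw [lintegral_tsum fun n => by fun_prop]
  conv_rhs => rw [← setLIntegral_univ, ← iUnion_Ioc_intCast ℝ,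
    lintegral_iUnion (fun n => measurableSet_Ioc) (pairwise_disjoint_Ioc_intCast ℝ)]
  congr 1 with n
  rw [← (measurePreserving_add_right volume (n : ℝ)).setLIntegral_comp_preimage measurableSet_Ioc hg]
  simp

/-- Weighted Cauchy–Schwarz inequality for series. -/
theorem ENNReal.sq_tsum_mul_le {ι : Type*} [Countable ι] (w F : ι → ℝ≥0∞) :
    (∑' i, w i * F i) ^ 2 ≤ (∑' i, w i) * ∑' i, w i * F i ^ 2 := by
  let _ : MeasurableSpace ι := ⊤
  have key := ENNReal.lintegral_mul_norm_pow_le (μ := Measure.count) (f := w)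
    (g := fun i => w i * F i ^ 2) (p := 1 / 2) (q := 1 / 2)
    (Measurable.of_discrete.aemeasurable) (Measurable.of_discrete.aemeasurable)
    (by norm_num) (by norm_num) (by norm_num)
  simp only [lintegral_count] at key
  have hsq (a : ℝ≥0∞) : (a ^ (1 / 2 : ℝ)) ^ 2 = a := by
    rw [← ENNReal.rpow_natCast, ← ENNReal.rpow_mul]; norm_num
  have hsq' (a : ℝ≥0∞) : (a ^ 2) ^ (1 / 2 : ℝ) = a := by
    rw [← ENNReal.rpow_natCast, ← ENNReal.rpow_mul]; norm_num
  have hi (i : ι) : w i ^ (1 / 2 : ℝ) * (w i * F i ^ 2) ^ (1 / 2 : ℝ) = w i * F i := by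
    rw [ENNReal.mul_rpow_of_nonneg _ _ (by norm_num), hsq', ← mul_assoc, ← sq, hsq]
  simp_rw [hi] at key
  calc _ ≤ _ := pow_le_pow_left₀ (zero_le) key 2
    _ = _ := by rw [mul_pow, hsq, hsq]

/-- Hölder's inequality with respect to the measure with density `w`. -/
theorem ENNReal.lintegral_mul_sq_rpow_le {α : Type*} [MeasurableSpace α] {μ : Measure α}
    {w F : α → ℝ≥0∞} (hw : AEMeasurable w μ) (hF : AEMeasurable F μ) {p : ℝ} (hp : 2 ≤ p) :
    (∫⁻ y, w y * F y ^ 2 ∂μ) ^ (p / 2) ≤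
      (∫⁻ y, w y ∂μ) ^ (p / 2 - 1) * ∫⁻ y, w y * F y ^ p ∂μ := by
  have hp0 : 0 < p := by linarith
  have h2p : 2 / p ≤ 1 := (div_le_one hp0).2 hp
  have key := ENNReal.lintegral_mul_norm_pow_le (μ := μ) (f := w)
    (g := fun y => w y * F y ^ p) (p := 1 - 2 / p) (q := 2 / p) hw (by fun_prop)
    (by linarith) (by positivity) (by ring)
  have hi (y : α) : w y ^ (1 - 2 / p) * (w y * F y ^ p) ^ (2 / p) = w y * F y ^ 2 := by
    rw [ENNReal.mul_rpow_of_nonneg _ _ (by positivity), ← mul_assoc,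
      ← ENNReal.rpow_add_of_nonneg _ _ (by linarith) (by positivity), ← ENNReal.rpow_mul,
      mul_div_cancel₀ _ hp0.ne']
    norm_num
  simp_rw [hi] at key
  calc _ ≤ _ := ENNReal.rpow_le_rpow key (by positivity)
    _ = _ := by
      rw [ENNReal.mul_rpow_of_nonneg _ _ (by positivity), ← ENNReal.rpow_mul, ← ENNReal.rpow_mul]
      congr 2
      · field_simp
      · rw [show 2 / p * (p / 2) = 1 by field_simp, ENNReal.rpow_one]

/-- A Schwartz function has locally uniformly summable integer translates. -/
theorem SchwartzMap.summable_norm_restrict_comp_addRight (Ψ : SchwartzMap ℝ ℂ) (K : Compacts ℝ) :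
    Summable fun n : ℤ =>
      ‖((⟨Ψ, Ψ.continuous⟩ : C(ℝ, ℂ)).comp (ContinuousMap.addRight (n : ℝ))).restrict K‖ :=
  summable_of_isBigO (Real.summable_abs_int_rpow one_lt_two)
    ((isBigO_norm_restrict_cocompact ⟨Ψ, Ψ.continuous⟩ zero_lt_two
      (Ψ.isBigO_cocompact_rpow (-2)) K).comp_tendsto Int.tendsto_coe_cofinite)

theorem SchwartzMap.exists_tsum_enorm_add_int_le (Ψ : SchwartzMap ℝ ℂ) :
    ∃ C : ℝ≥0∞, C ≠ ∞ ∧ ∀ x ∈ Ioc (0 : ℝ) 1, ∑' n : ℤ, ‖Ψ (x + n)‖ₑ ≤ C := by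
  have hs := Ψ.summable_norm_restrict_comp_addRight ⟨Icc 0 1, isCompact_Icc⟩
  refine ⟨_, hs.tsum_ofReal_ne_top, fun x hx => ENNReal.tsum_le_tsum fun n => ?_⟩
  rw [← ofReal_norm]
  exact ENNReal.ofReal_le_ofReal (ContinuousMap.norm_coe_le_norm
    (((⟨Ψ, Ψ.continuous⟩ : C(ℝ, ℂ)).comp (ContinuousMap.addRight (n : ℝ))).restrict
      (Icc (0 : ℝ) 1)) ⟨x, Ioc_subset_Icc_self hx⟩)

/-- The `ℓ²` norm of the integer frequencies of `Ψ * F` is controlled by a weighted `L²` norm of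
`F`, with a constant depending only on `Ψ`. -/
theorem SchwartzMap.exists_tsum_sq_fourier_mul_le (Ψ : SchwartzMap ℝ ℂ) :
    ∃ C : ℝ≥0∞, C ≠ ∞ ∧ ∀ F : ℝ → ℂ, Continuous F → (∃ M, ∀ y, ‖F y‖ ≤ M) →
      ENNReal.ofReal (∑' m : ℤ, ‖𝓕 (fun y => Ψ y * F y) m‖ ^ 2) ≤
        C * ∫⁻ y, ‖Ψ y‖ₑ * ‖F y‖ₑ ^ 2 := by
  obtain ⟨C, hC, hΨ⟩ := Ψ.exists_tsum_enorm_add_int_le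
  refine ⟨C, hC, fun F hF ⟨M, hM⟩ => ?_⟩
  have hM0 : 0 ≤ M := (norm_nonneg _).trans (hM 0)
  let g : C(ℝ, ℂ) := ⟨fun y => Ψ y * F y, Ψ.continuous.mul hF⟩
  have hg (K : Compacts ℝ) :
      Summable fun n : ℤ => ‖(g.comp (ContinuousMap.addRight (n : ℝ))).restrict K‖ := by
    refine Summable.of_nonneg_of_le (fun n => norm_nonneg _) (fun n => ?_)
      ((Ψ.summable_norm_restrict_comp_addRight K).mul_right M)
    refine (ContinuousMap.norm_le _ (by positivity)).2 fun y => ?_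
    refine (norm_mul_le _ _).trans (mul_le_mul ?_ (hM _) (norm_nonneg _) (norm_nonneg _))
    exact ContinuousMap.norm_coe_le_norm
      (((⟨Ψ, Ψ.continuous⟩ : C(ℝ, ℂ)).comp (ContinuousMap.addRight (n : ℝ))).restrict K) y
  have hΨm : Measurable Ψ := Ψ.continuous.measurable
  have hFm : Measurable F := hF.measurable
  calc ENNReal.ofReal (∑' m : ℤ, ‖𝓕 (fun y => Ψ y * F y) m‖ ^ 2)
      = ENNReal.ofReal (∫ x in Ioc (0 : ℝ) 1, ‖∑' n : ℤ, g (x + n)‖ ^ 2) := by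
        rw [← intervalIntegral.integral_of_le zero_le_one, ← (hasSum_sq_fourier_intCast hg).tsum_eq]
        rfl
    _ ≤ ∫⁻ x in Ioc (0 : ℝ) 1, ‖∑' n : ℤ, g (x + n)‖ₑ ^ 2 := by
        refine (ENNReal.ofReal_le_ofReal (le_abs_self _)).trans ?_
        rw [← Real.norm_eq_abs, ofReal_norm]
        refine (enorm_integral_le_lintegral_enorm _).trans (le_of_eq ?_)
        simp [enorm_pow]
    _ ≤ ∫⁻ x in Ioc (0 : ℝ) 1, C * ∑' n : ℤ, ‖Ψ (x + n)‖ₑ * ‖F (x + n)‖ₑ ^ 2 := by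
        refine setLIntegral_mono' measurableSet_Ioc fun x hx => ?_
        calc ‖∑' n : ℤ, g (x + n)‖ₑ ^ 2
            ≤ (∑' n : ℤ, ‖Ψ (x + n)‖ₑ * ‖F (x + n)‖ₑ) ^ 2 := by
              refine pow_le_pow_left₀ zero_le (enorm_tsum_le_tsum_enorm.trans_eq ?_) 2
              simp [g, enorm_mul]
          _ ≤ _ := ENNReal.sq_tsum_mul_le _ _
          _ ≤ _ := by gcongr; exact hΨ x hx
    _ = C * ∫⁻ y, ‖Ψ y‖ₑ * ‖F y‖ₑ ^ 2 := by
        rw [lintegral_const_mul' _ _ hC,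
          lintegral_Ioc_tsum_comp_add_int (g := fun y => ‖Ψ y‖ₑ * ‖F y‖ₑ ^ 2) (by fun_prop)]

/-- **modulated smooth Littlewood–Paley inequality.** For `p ∈ [2,∞)`
and any Schwartz function `Ψ`, the modulated square function
`(Σ_{n∈ℤ} |∫ e^{2πiny} Ψ(y) f(x-y) dy|²)^{1/2}` is bounded on `L^p(ℝ)`. -/
theorem modulated_littlewood_paley (p : ℝ) (hp : 2 ≤ p) (Ψ : SchwartzMap ℝ ℂ) :
    ∃ c : ℝ, 0 < c ∧ ∀ f : SchwartzMap ℝ ℂ,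
      eLpNorm (fun x : ℝ =>
          Real.sqrt (∑' n : ℤ,
            ‖∫ y : ℝ, Complex.exp (((2 * Real.pi * (n : ℝ) * y : ℝ) : ℂ) * Complex.I) *
                Ψ y * f (x - y)‖ ^ 2))
          (ENNReal.ofReal p) volume ≤
        ENNReal.ofReal c * eLpNorm (⇑f) (ENNReal.ofReal p) volume := by
  obtain ⟨C, hC, hCf⟩ := Ψ.exists_tsum_sq_fourier_mul_le
  have hp0 : 0 < p := by linarith
  set A : ℝ≥0∞ := ∫⁻ y, ‖Ψ y‖ₑ with hA
  have hAtop : A ≠ ∞ := Ψ.integrable.2.ne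
  have hD : (C * A) ^ (1 / 2 : ℝ) ≠ ∞ :=
    ENNReal.rpow_ne_top_of_nonneg (by norm_num) (ENNReal.mul_ne_top hC hAtop)
  refine ⟨((C * A) ^ (1 / 2 : ℝ)).toReal + 1, by positivity, fun f => ?_⟩
  have hle : (C * A) ^ (1 / 2 : ℝ) ≤ ENNReal.ofReal (((C * A) ^ (1 / 2 : ℝ)).toReal + 1) := by
    rw [← ENNReal.ofReal_toReal hD]
    exact ENNReal.ofReal_le_ofReal (by simp)
  refine le_trans ?_ (mul_le_mul_left hle _)
  have hΨm : Measurable Ψ := Ψ.continuous.measurable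
  have hfm : Measurable f := f.continuous.measurable
  have hpt (x : ℝ) : ‖Real.sqrt (∑' n : ℤ,
      ‖∫ y : ℝ, Complex.exp (((2 * Real.pi * (n : ℝ) * y : ℝ) : ℂ) * Complex.I) *
        Ψ y * f (x - y)‖ ^ 2)‖ₑ ^ p ≤
      C ^ (p / 2) * (A ^ (p / 2 - 1) * ∫⁻ y, ‖Ψ y‖ₑ * ‖f (x - y)‖ₑ ^ p) := by
    have hsum : ∑' n : ℤ, ‖∫ y : ℝ, Complex.exp (((2 * Real.pi * (n : ℝ) * y : ℝ) : ℂ) *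
        Complex.I) * Ψ y * f (x - y)‖ ^ 2 =
        ∑' m : ℤ, ‖𝓕 (fun y => Ψ y * f (x - y)) (m : ℝ)‖ ^ 2 := by
      rw [← (Equiv.neg ℤ).tsum_eq]
      congr 1 with m
      rw [Real.fourier_real_eq_integral_exp_smul]
      congr 3 with y
      rw [smul_eq_mul, ← mul_assoc]
      congr 4
      simp
      ring
    have hF := hCf (fun y => f (x - y)) (by fun_prop)
      ⟨_, fun y => (f.toBoundedContinuousFunction).norm_coe_le_norm (x - y)⟩
    rw [hsum, Real.enorm_eq_ofReal (Real.sqrt_nonneg _), Real.sqrt_eq_rpow,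
      ← ENNReal.ofReal_rpow_of_nonneg (tsum_nonneg fun _ => by positivity) (by norm_num),
      ← ENNReal.rpow_mul, show 1 / 2 * p = p / 2 by ring]
    calc _ ≤ _ := ENNReal.rpow_le_rpow hF (by positivity)
      _ = _ := ENNReal.mul_rpow_of_nonneg _ _ (by positivity)
      _ ≤ _ := by
        gcongr
        exact ENNReal.lintegral_mul_sq_rpow_le (by fun_prop) (by fun_prop) hp
  have hconv : ∫⁻ x, ∫⁻ y, ‖Ψ y‖ₑ * ‖f (x - y)‖ₑ ^ p = A * ∫⁻ x, ‖f x‖ₑ ^ p := by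
    rw [lintegral_lintegral_swap (by fun_prop)]
    have hy (y : ℝ) : ∫⁻ x, ‖Ψ y‖ₑ * ‖f (x - y)‖ₑ ^ p = ‖Ψ y‖ₑ * ∫⁻ x, ‖f x‖ₑ ^ p := by
      rw [lintegral_const_mul' _ _ enorm_ne_top,
        lintegral_sub_right_eq_self (fun x => ‖f x‖ₑ ^ p) y]
    simp_rw [hy]
    rw [lintegral_mul_const _ (by fun_prop)]
  rw [eLpNorm_eq_lintegral_rpow_enorm_toReal (by simpa using hp0) ENNReal.ofReal_ne_top,
    eLpNorm_eq_lintegral_rpow_enorm_toReal (by simpa using hp0) ENNReal.ofReal_ne_top,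
    ENNReal.toReal_ofReal hp0.le]
  calc _ ≤ (∫⁻ x, C ^ (p / 2) * (A ^ (p / 2 - 1) * ∫⁻ y, ‖Ψ y‖ₑ * ‖f (x - y)‖ₑ ^ p)) ^ (1 / p) :=
        ENNReal.rpow_le_rpow (lintegral_mono hpt) (by positivity)
    _ = ((C * A) ^ (p / 2) * ∫⁻ x, ‖f x‖ₑ ^ p) ^ (1 / p) := by
        rw [lintegral_const_mul' _ _ (ENNReal.rpow_ne_top_of_nonneg (by positivity) hC),
          lintegral_const_mul' _ _ (ENNReal.rpow_ne_top_of_nonneg (by linarith) hAtop), hconv,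
          ENNReal.mul_rpow_of_nonneg _ _ (by positivity : 0 ≤ p / 2), ← mul_assoc (A ^ _),
          ← mul_assoc (C ^ _)]
        congr 3
        conv_lhs => rw [← ENNReal.rpow_one A, ← ENNReal.rpow_mul, one_mul]
        rw [← ENNReal.rpow_add_of_nonneg _ _ (by linarith) zero_le_one, sub_add_cancel]
    _ = _ := by
        rw [ENNReal.mul_rpow_of_nonneg _ _ (by positivity), ← ENNReal.rpow_mul]
        congr 2
        field_simp
end
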